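/- Let γ > 1/2 and let u₀ ∈ H^γ(ℝ³;ℝ³) be divergence-free. Then there exists T > 0 such that the generalized Navier–Stokes system ∂_t u − Δu = Q(u,u), u(0) = u₀, has a unique mild solution u ∈ C([0,T]; H^γ) ∩ L²((0,T); Ḣ^{γ+1}). Moreover there exists t₀ ∈ (0,T] such that for any sufficiently small δ > 0 with γ > 1/2 + 2δ there is a constant C > 0 so that for all t ∈ (0, t₀]: ‖ e^{λ(t)√t |ξ|} û(t,ξ) |ξ|^{1/2+δ} ‖_{L²_ξ} ≤ C t^{−(γ+δ−1/2)/2} |ln t|^{(γ−1/2)/2} e^{(3/4)β(t)}, where η_J^γ(t) := max_{0≤τ≤t} ‖ 1_{|ξ|≥0.01J} |ξ|^γ û(τ,ξ) ‖_{L²_ξ}, β(t) := min{ |ln η^γ_{t^{−1/2}}(t)| , (1/2)(γ−1/2)|ln t| } if η^γ_{t^{−1/2}}(t) > 0 and β(t) := (1/2)(γ−1/2)|ln t| if η^γ_{t^{−1/2}}(t) = 0, and λ(t) := √( (2γ−1)(|ln t| + ln|ln t|) + 3β(t) ). -/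

import Mathlib

noncomputable section

open MeasureTheory Set Filter
open scoped ENNReal Topology

/-- Frequency space ℝ³ (as functions `Fin 3 → ℝ`, with the product Lebesgue measure). -/
abbrev V3 : Type := Fin 3 → ℝ

/-- The Euclidean norm on `V3`. -/
def en (ξ : V3) : ℝ := Real.sqrt (∑ i, ξ i ^ 2)

/-- Squared Euclidean magnitude of a vector in ℂ³. -/
def vnSq (v : Fin 3 → ℂ) : ℝ := ∑ j, ‖v j‖ ^ 2

/-- Weighted L²-norm in the frequency variable, valued in `ℝ≥0∞`:
`wnorm w f = ( ∫ (w ξ)² |f ξ|² dξ )^{1/2}`. -/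
def wnorm (w : V3 → ℝ) (f : V3 → Fin 3 → ℂ) : ℝ≥0∞ :=
  (∫⁻ ξ : V3, ENNReal.ofReal (w ξ ^ 2 * vnSq (f ξ))) ^ ((1 : ℝ) / 2)

/-- Weight of the inhomogeneous Sobolev norm `H^γ`, i.e. `⟨ξ⟩^γ`. -/
def wH (γ : ℝ) : V3 → ℝ := fun ξ => (1 + en ξ ^ 2) ^ (γ / 2)

/-- Weight of the homogeneous Sobolev norm `Ḣ^s`, i.e. `|ξ|^s`. -/
def wD (s : ℝ) : V3 → ℝ := fun ξ => en ξ ^ s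

/-- Coefficients `α^{j,m,n,p}_{k,ℓ}` of the bilinear form `Q`
(order of arguments: `α j m n p k l`). -/
abbrev Coeffs : Type := Fin 3 → Fin 3 → Fin 3 → Fin 3 → Fin 3 → Fin 3 → ℝ

/-- The symbol `q^{j,m}_{k,ℓ}(ξ) = Σ_{n,p} α^{j,m,n,p}_{k,ℓ} ξ_n ξ_p / |ξ|²`. -/
def qsym (α : Coeffs) (j m k l : Fin 3) (ξ : V3) : ℝ :=
  ∑ n, ∑ p, α j m n p k l * (ξ n * ξ p) / en ξ ^ 2

/-- Fourier side of the bilinear term `Q(u,v)`: with the convention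
`f̂(ξ) = ∫ f(x) e^{-ix·ξ} dx`, the product `u^k v^ℓ` has Fourier transform
`(2π)⁻³ (û^k ∗ v̂^ℓ)(ξ)`, so that
`(Q^j(u,v))^(ξ) = Σ_{k,ℓ,m} q^{j,m}_{k,ℓ}(ξ) · iξ_m · (2π)⁻³ (û^k ∗ v̂^ℓ)(ξ)`. -/
def Qhat (α : Coeffs) (U W : V3 → Fin 3 → ℂ) : V3 → Fin 3 → ℂ := fun ξ j =>
  ∑ k : Fin 3, ∑ l : Fin 3, ∑ m : Fin 3,
    (qsym α j m k l ξ : ℂ) * (Complex.I * (ξ m : ℂ)) *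
      ((((2 * Real.pi) ^ (3 : ℕ))⁻¹ : ℝ) : ℂ) * ∫ η : V3, U η k * W (ξ - η) l

/-- `U` is (the Fourier transform of) a mild solution of the generalized Navier–Stokes
equations on `[0,T]` with (Fourier-side) data `U₀`:
`û(t,ξ) = e^{-t|ξ|²} û₀(ξ) + ∫₀^t e^{-(t-s)|ξ|²} (Q(u,u))^(s,ξ) ds`. -/
def IsMildSol (α : Coeffs) (U₀ : V3 → Fin 3 → ℂ) (U : ℝ → V3 → Fin 3 → ℂ) (T : ℝ) : Prop :=
  ∀ t ∈ Icc (0 : ℝ) T, ∀ ξ : V3, ∀ j : Fin 3,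
    U t ξ j = (Real.exp (-(t * en ξ ^ 2)) : ℂ) * U₀ ξ j
      + ∫ s in (0 : ℝ)..t, (Real.exp (-((t - s) * en ξ ^ 2)) : ℂ) * Qhat α (U s) (U s) ξ j

/-- Continuity on `[0,T]` with values in the weighted L²-space with weight `w`
(this encodes `u ∈ C([0,T]; H)` for the corresponding Sobolev space `H`). -/
def ContInW (w : V3 → ℝ) (U : ℝ → V3 → Fin 3 → ℂ) (T : ℝ) : Prop :=
  (∀ t ∈ Icc (0 : ℝ) T, wnorm w (U t) < ⊤) ∧
  ∀ t ∈ Icc (0 : ℝ) T, ∀ ε : ℝ≥0∞, 0 < ε → ∃ d > (0 : ℝ), ∀ s ∈ Icc (0 : ℝ) T,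
    |s - t| < d → wnorm w (fun ξ j => U s ξ j - U t ξ j) < ε

/-- Membership in `L²((0,T); H)` for the weighted space `H` with weight `w`. -/
def MemL2W (w : V3 → ℝ) (U : ℝ → V3 → Fin 3 → ℂ) (T : ℝ) : Prop :=
  ∫⁻ t in Ioo (0 : ℝ) T, wnorm w (U t) ^ (2 : ℕ) < ⊤

/-- Joint measurability of a time-dependent (Fourier-side) vector field. -/
def MeasVF (U : ℝ → V3 → Fin 3 → ℂ) : Prop :=
  ∀ j : Fin 3, Measurable (Function.uncurry fun t ξ => U t ξ j)

/-- Divergence-free condition on the Fourier side: `ξ · û₀(ξ) = 0`. -/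
def DivFree (U₀ : V3 → Fin 3 → ℂ) : Prop := ∀ ξ : V3, ∑ j : Fin 3, (ξ j : ℂ) * U₀ ξ j = 0

/-- `U₀` is the Fourier transform of a real (ℝ³-valued) vector field. -/
def RealField (U₀ : V3 → Fin 3 → ℂ) : Prop :=
  ∀ ξ : V3, ∀ j : Fin 3, U₀ (-ξ) j = (starRingEnd ℂ) (U₀ ξ j)

/-- `η_J^γ(t) = max_{0≤τ≤t} ‖ 1_{|ξ|≥0.01J} |ξ|^γ û(τ,ξ) ‖_{L²_ξ}`. -/
def etaSup (γ : ℝ) (U : ℝ → V3 → Fin 3 → ℂ) (J t : ℝ) : ℝ≥0∞ :=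
  ⨆ τ ∈ Icc (0 : ℝ) t, wnorm (fun ξ => if 0.01 * J ≤ en ξ then en ξ ^ γ else 0) (U τ)

/-- `β(t)` from \eqref{S1eq2}. -/
def betaF (γ : ℝ) (U : ℝ → V3 → Fin 3 → ℂ) (t : ℝ) : ℝ :=
  if etaSup γ U (t ^ (-(1 : ℝ) / 2)) t = 0 then 1 / 2 * (γ - 1 / 2) * |Real.log t|
  else min |Real.log ((etaSup γ U (t ^ (-(1 : ℝ) / 2)) t).toReal)|
    (1 / 2 * (γ - 1 / 2) * |Real.log t|)

/-- `λ(t) = √( (2γ−1)(|ln t| + ln|ln t|) + 3β(t) )`. -/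
def lamSub (γ : ℝ) (U : ℝ → V3 → Fin 3 → ℂ) (t : ℝ) : ℝ :=
  Real.sqrt ((2 * γ - 1) * (|Real.log t| + Real.log |Real.log t|) + 3 * betaF γ U t)

/-! ### The Euclidean length -/

lemma en_nonneg (ξ : V3) : 0 ≤ en ξ := Real.sqrt_nonneg _

lemma en_eq_norm (ξ : V3) : en ξ = ‖(WithLp.toLp 2 ξ : EuclideanSpace ℝ (Fin 3))‖ := by
  rw [EuclideanSpace.norm_eq]; simp [en]

lemma en_add_le (ξ η : V3) : en (ξ + η) ≤ en ξ + en η := by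
  simp only [en_eq_norm, WithLp.toLp_add]; exact norm_add_le _ _

lemma en_le_add_sub (ξ η : V3) : en ξ ≤ en η + en (ξ - η) := by
  simpa using en_add_le η (ξ - η)

lemma en_smul (c : ℝ) (ξ : V3) : en (c • ξ) = |c| * en ξ := by
  simp only [en_eq_norm, WithLp.toLp_smul]; exact norm_smul _ _

lemma abs_coord_le_en (ξ : V3) (i : Fin 3) : |ξ i| ≤ en ξ := by
  rw [en, ← Real.sqrt_sq_eq_abs]
  exact Real.sqrt_le_sqrt
    (Finset.single_le_sum (f := fun i => ξ i ^ 2) (fun i _ => sq_nonneg _) (Finset.mem_univ i))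

lemma norm_le_en (ξ : V3) : ‖ξ‖ ≤ en ξ :=
  (pi_norm_le_iff_of_nonneg (en_nonneg ξ)).2 fun i => by simpa using abs_coord_le_en ξ i

lemma continuous_en : Continuous en := by unfold en; fun_prop

@[fun_prop]
lemma measurable_en : Measurable en := continuous_en.measurable

/-! ### Weighted square norms and convolutions of nonnegative functions -/

/-- The weight `(b + |ξ|)^σ`. -/
def lw (b σ : ℝ) (ξ : V3) : ℝ≥0∞ := ENNReal.ofReal ((b + en ξ) ^ σ)

/-- The squared `L²` norm of `f` with weight `(b + |ξ|)^σ`. -/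
def sqNorm (b σ : ℝ) (f : V3 → ℝ≥0∞) : ℝ≥0∞ := ∫⁻ ξ, (lw b σ ξ * f ξ) ^ 2

/-- The convolution of nonnegative functions. -/
def cv (f g : V3 → ℝ≥0∞) (ξ : V3) : ℝ≥0∞ := ∫⁻ η, f η * g (ξ - η)

@[fun_prop]
lemma measurable_lw (b σ : ℝ) : Measurable (lw b σ) := by
  unfold lw; fun_prop

lemma measurable_cv {f g : V3 → ℝ≥0∞} (hf : Measurable f) (hg : Measurable g) :
    Measurable (cv f g) := by
  unfold cv
  exact Measurable.lintegral_prod_right' (f := fun p : V3 × V3 => f p.2 * g (p.1 - p.2))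
    (by fun_prop)

lemma cv_mono {f f' g g' : V3 → ℝ≥0∞} (hf : ∀ ξ, f ξ ≤ f' ξ) (hg : ∀ ξ, g ξ ≤ g' ξ) (ξ : V3) :
    cv f g ξ ≤ cv f' g' ξ :=
  lintegral_mono fun η => mul_le_mul' (hf η) (hg _)

lemma cv_comm (f g : V3 → ℝ≥0∞) (ξ : V3) : cv f g ξ = cv g f ξ := by
  unfold cv
  rw [← lintegral_sub_left_eq_self (fun η => f η * g (ξ - η)) ξ]
  exact lintegral_congr fun η => by simp [mul_comm]

lemma lw_add {b σ τ : ℝ} (hb : 0 < b) (ξ : V3) : lw b (σ + τ) ξ = lw b σ ξ * lw b τ ξ := by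
  have := en_nonneg ξ
  rw [lw, lw, lw, ← ENNReal.ofReal_mul (by positivity), Real.rpow_add (by positivity)]

lemma lw_zero {b : ℝ} (ξ : V3) : lw b 0 ξ = 1 := by simp [lw]

lemma lw_neg_mul {b σ : ℝ} (hb : 0 < b) (ξ : V3) : lw b (-σ) ξ * lw b σ ξ = 1 := by
  rw [← lw_add hb]; simp [lw_zero]

lemma sqNorm_mono {b σ : ℝ} {f g : V3 → ℝ≥0∞} (h : ∀ ξ, f ξ ≤ g ξ) :
    sqNorm b σ f ≤ sqNorm b σ g :=
  lintegral_mono fun ξ => by gcongr; exact h ξ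

lemma sq_add_le (x y : ℝ≥0∞) : (x + y) ^ 2 ≤ 2 * x ^ 2 + 2 * y ^ 2 := by
  have h := ENNReal.rpow_add_le_mul_rpow_add_rpow x y (p := 2) (by norm_num)
  norm_num at h
  rwa [mul_add] at h

lemma sqNorm_add_le {b σ : ℝ} {f g : V3 → ℝ≥0∞} (hf : Measurable f) :
    sqNorm b σ (fun ξ => f ξ + g ξ) ≤ 2 * sqNorm b σ f + 2 * sqNorm b σ g := by
  unfold sqNorm
  rw [← lintegral_const_mul' _ _ (by simp), ← lintegral_const_mul' _ _ (by simp),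
    ← lintegral_add_left (by fun_prop)]
  refine lintegral_mono fun ξ => ?_
  rw [mul_add]
  exact sq_add_le _ _

lemma sqNorm_const_mul {b σ : ℝ} (c : ℝ≥0∞) {f : V3 → ℝ≥0∞} (hf : Measurable f) :
    sqNorm b σ (fun ξ => c * f ξ) = c ^ 2 * sqNorm b σ f := by
  unfold sqNorm
  rw [← lintegral_const_mul _ (by fun_prop)]
  exact lintegral_congr fun ξ => by ring

lemma lintegral_mul_sq_le {X : Type*} [MeasurableSpace X] {μ : Measure X} {f g : X → ℝ≥0∞}
    (hf : AEMeasurable f μ) (hg : AEMeasurable g μ) :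
    (∫⁻ x, f x * g x ∂μ) ^ 2 ≤ (∫⁻ x, f x ^ 2 ∂μ) * ∫⁻ x, g x ^ 2 ∂μ := by
  have h := ENNReal.lintegral_mul_le_Lp_mul_Lq μ (p := 2) (q := 2)
    (by constructor <;> norm_num) hf hg
  simp only [Pi.mul_apply, ENNReal.rpow_ofNat] at h
  calc _ ≤ ((∫⁻ x, f x ^ 2 ∂μ) ^ (1 / 2 : ℝ) * (∫⁻ x, g x ^ 2 ∂μ) ^ (1 / 2 : ℝ)) ^ 2 := by
        gcongr
    _ = _ := by
      rw [mul_pow]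
      congr 1 <;> · rw [← ENNReal.rpow_natCast, ← ENNReal.rpow_mul]; norm_num

lemma lintegral_mul_sq_le' {X : Type*} [MeasurableSpace X] {μ : Measure X} {f g : X → ℝ≥0∞}
    (hf : AEMeasurable f μ) (hg : AEMeasurable g μ) :
    (∫⁻ x, f x * g x ∂μ) ^ 2 ≤ (∫⁻ x, f x ∂μ) * ∫⁻ x, f x * g x ^ 2 ∂μ := by
  have hs : ∀ x : ℝ≥0∞, (x ^ (1 / 2 : ℝ)) ^ 2 = x := fun x => by
    rw [← ENNReal.rpow_natCast, ← ENNReal.rpow_mul]; norm_num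
  have h := lintegral_mul_sq_le (μ := μ) (f := fun x => f x ^ (1 / 2 : ℝ))
    (g := fun x => f x ^ (1 / 2 : ℝ) * g x) (hf.pow_const _) ((hf.pow_const _).mul hg)
  simp only [mul_pow, hs, ← mul_assoc] at h
  simpa only [← sq, hs] using h

/-- Young's inequality `L¹ * L² → L²`. -/
lemma lintegral_cv_sq_le {f g : V3 → ℝ≥0∞} (hf : Measurable f) (hg : Measurable g) :
    ∫⁻ ξ, cv f g ξ ^ 2 ≤ (∫⁻ ξ, f ξ) ^ 2 * ∫⁻ ξ, g ξ ^ 2 := by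
  calc ∫⁻ ξ, cv f g ξ ^ 2
      ≤ ∫⁻ ξ, (∫⁻ η, f η) * ∫⁻ η, f η * g (ξ - η) ^ 2 :=
        lintegral_mono fun ξ => lintegral_mul_sq_le' (by fun_prop) (by fun_prop)
    _ = (∫⁻ η, f η) * ∫⁻ ξ, ∫⁻ η, f η * g (ξ - η) ^ 2 := by
        rw [lintegral_const_mul]
        exact Measurable.lintegral_prod_right'
          (f := fun p : V3 × V3 => f p.2 * g (p.1 - p.2) ^ 2) (by fun_prop)
    _ = (∫⁻ η, f η) * ∫⁻ η, f η * ∫⁻ ξ, g ξ ^ 2 := by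
        rw [lintegral_lintegral_swap (by fun_prop)]
        congr 1
        refine lintegral_congr fun η => ?_
        rw [lintegral_const_mul _ (by fun_prop)]
        congr 1
        exact lintegral_sub_right_eq_self (fun ξ => g ξ ^ 2) η
    _ = _ := by rw [lintegral_mul_const _ hf, sq]; ring

lemma cv_sq_le {f g : V3 → ℝ≥0∞} (hf : Measurable f) (hg : Measurable g) (ξ : V3) :
    cv f g ξ ^ 2 ≤ (∫⁻ ξ, f ξ ^ 2) * ∫⁻ ξ, g ξ ^ 2 := by
  refine (lintegral_mul_sq_le (by fun_prop) (by fun_prop)).trans_eq ?_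
  congr 1
  exact lintegral_sub_left_eq_self (fun η => g η ^ 2) ξ

/-- The integral of `(1 + |ξ|)^(-2 * p)`. -/
def decayInt (p : ℝ) : ℝ≥0∞ := ∫⁻ ξ, lw 1 (-p) ξ ^ 2

lemma lw_sq {b σ : ℝ} (hb : 0 < b) (ξ : V3) : lw b σ ξ ^ 2 = lw b (2 * σ) ξ := by
  rw [two_mul, lw_add hb, sq]

lemma decayInt_lt_top {p : ℝ} (hp : 3 / 2 < p) : decayInt p < ⊤ := by
  have h := integrable_one_add_norm (E := V3) (μ := volume) (r := 2 * p) (by simp; linarith)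
  refine lt_of_le_of_lt (lintegral_mono fun ξ => ?_) h.lintegral_lt_top
  rw [lw_sq one_pos, lw]
  have := norm_le_en ξ
  refine ENNReal.ofReal_le_ofReal ?_
  rw [show 2 * -p = -(2 * p) by ring]
  exact Real.rpow_le_rpow_of_nonpos (by positivity) (by linarith) (by linarith)

lemma lw_smul {b σ : ℝ} (hb : 0 < b) (ξ : V3) :
    lw b σ (b • ξ) = ENNReal.ofReal (b ^ σ) * lw 1 σ ξ := by
  have := en_nonneg ξ
  rw [lw, lw, en_smul, abs_of_pos hb, ← ENNReal.ofReal_mul (by positivity),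
    ← Real.mul_rpow hb.le (by positivity)]
  ring_nf

lemma lintegral_lw_sq {b p : ℝ} (hb : 0 < b) :
    ∫⁻ ξ, lw b (-p) ξ ^ 2 = ENNReal.ofReal (b ^ (3 - 2 * p)) * decayInt p := by
  have h := Measure.map_addHaar_smul (volume : Measure V3) (inv_ne_zero hb.ne')
  have h2 : ∫⁻ ξ, lw 1 (-p) ξ ^ 2 ∂(Measure.map (fun x : V3 => b⁻¹ • x) volume)
      = ∫⁻ ξ, lw 1 (-p) (b⁻¹ • ξ) ^ 2 :=
    lintegral_map (by fun_prop) (by fun_prop)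
  rw [h, lintegral_smul_measure] at h2
  have h3 : ∀ ξ, lw b (-p) ξ = ENNReal.ofReal (b ^ (-p)) * lw 1 (-p) (b⁻¹ • ξ) := fun ξ => by
    rw [← lw_smul hb, smul_inv_smul₀ hb.ne']
  simp only [h3, mul_pow]
  rw [lintegral_const_mul _ (by fun_prop), ← h2, smul_eq_mul, ← mul_assoc, decayInt]
  congr 1
  rw [← ENNReal.ofReal_pow (by positivity), ← ENNReal.ofReal_mul (by positivity)]
  congr 1
  rw [abs_of_pos (by positivity), ← Real.rpow_natCast (b ^ (-p)), ← Real.rpow_mul hb.le]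
  simp only [Module.finrank_fin_fun, inv_pow, inv_inv]
  rw [← Real.rpow_natCast b 3, ← Real.rpow_add hb]
  congr 1; push_cast; ring

lemma lw_le_of_nonneg {b b' σ : ℝ} (hb : 0 ≤ b) (hσ : 0 ≤ σ) {ξ η : V3}
    (h : b + en ξ ≤ b' + en η) : lw b σ ξ ≤ lw b' σ η := by
  have := en_nonneg ξ
  exact ENNReal.ofReal_le_ofReal (Real.rpow_le_rpow (by positivity) h hσ)

lemma lw_le_of_nonpos {b σ : ℝ} (hb : 0 < b) (hσ : σ ≤ 0) {ξ η : V3}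
    (h : en η ≤ en ξ) : lw b σ ξ ≤ lw b σ η := by
  have := en_nonneg η
  exact ENNReal.ofReal_le_ofReal
    (Real.rpow_le_rpow_of_nonpos (by positivity) (by linarith) hσ)

lemma lw_le_mul {b b' σ c : ℝ} (hb : 0 ≤ b) (hb' : 0 ≤ b') (hc : 0 ≤ c) (hσ : 0 ≤ σ) {ξ η : V3}
    (h : b + en ξ ≤ c * (b' + en η)) : lw b σ ξ ≤ ENNReal.ofReal (c ^ σ) * lw b' σ η := by
  have h1 := en_nonneg ξ
  have h2 := en_nonneg η
  rw [lw, lw, ← ENNReal.ofReal_mul (by positivity), ← Real.mul_rpow hc (by positivity)]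
  exact ENNReal.ofReal_le_ofReal (Real.rpow_le_rpow (by positivity) h hσ)

lemma lw_subadd {b σ : ℝ} (hb : 0 ≤ b) (hσ : 0 ≤ σ) (ξ η : V3) :
    lw b σ ξ ≤ ENNReal.ofReal (2 ^ σ) * (lw b σ η + lw b σ (ξ - η)) := by
  have h := en_le_add_sub ξ η
  rcases le_total (en η) (en (ξ - η)) with h' | h'
  · refine (lw_le_mul (b' := b) (c := 2) (η := ξ - η) hb hb (by norm_num) hσ
      (by linarith)).trans ?_
    gcongr; exact le_add_self
  · refine (lw_le_mul (b' := b) (c := 2) (η := η) hb hb (by norm_num) hσ (by linarith)).trans ?_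
    gcongr; exact le_self_add

lemma lw_neg_mul_le {b r γ : ℝ} (hb : 0 < b) (hr : 0 ≤ r) (hγ : 0 ≤ γ) (ξ ζ : V3) :
    lw b (-r) ξ * lw b (-γ) ζ ≤ lw b (-(r + γ)) ξ + lw b (-(r + γ)) ζ := by
  rw [neg_add]
  rcases le_total (en ξ) (en ζ) with h | h
  · refine le_trans ?_ le_self_add
    rw [lw_add hb]
    gcongr
    exact lw_le_of_nonpos hb (by linarith) h
  · refine le_trans ?_ le_add_self
    rw [lw_add hb]
    gcongr
    exact lw_le_of_nonpos hb (by linarith) h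

lemma lintegral_lw_cv_sq_le {b r γ : ℝ} (hb : 0 < b) (hr : 0 ≤ r) (hγ : 0 ≤ γ)
    {F G : V3 → ℝ≥0∞} (hF : Measurable F) (hG : Measurable G) :
    ∫⁻ ξ, (lw b (-r) ξ * cv F (fun ζ => lw b (-γ) ζ * G ζ) ξ) ^ 2
      ≤ 4 * (∫⁻ ξ, lw b (-(r + γ)) ξ ^ 2) * (∫⁻ ξ, F ξ ^ 2) * ∫⁻ ξ, G ξ ^ 2 := by
  set p := r + γ
  set J := ∫⁻ ξ, lw b (-p) ξ ^ 2
  have hk : Measurable fun ζ => lw b (-p) ζ * G ζ := by fun_prop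
  have hpt : ∀ ξ, lw b (-r) ξ * cv F (fun ζ => lw b (-γ) ζ * G ζ) ξ
      ≤ lw b (-p) ξ * cv F G ξ + cv (fun ζ => lw b (-p) ζ * G ζ) F ξ := fun ξ => by
    rw [cv_comm (fun ζ => lw b (-p) ζ * G ζ)]
    unfold cv
    rw [← lintegral_const_mul _ (by fun_prop), ← lintegral_const_mul _ (by fun_prop),
      ← lintegral_add_left (by fun_prop)]
    refine lintegral_mono fun η => ?_
    calc lw b (-r) ξ * (F η * (lw b (-γ) (ξ - η) * G (ξ - η)))
        = (lw b (-r) ξ * lw b (-γ) (ξ - η)) * (F η * G (ξ - η)) := by ring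
      _ ≤ (lw b (-p) ξ + lw b (-p) (ξ - η)) * (F η * G (ξ - η)) := by
          gcongr; exact lw_neg_mul_le hb hr hγ _ _
      _ = _ := by ring
  have h1 : ∫⁻ ξ, (lw b (-p) ξ * cv F G ξ) ^ 2 ≤ J * ((∫⁻ ξ, F ξ ^ 2) * ∫⁻ ξ, G ξ ^ 2) := by
    rw [← lintegral_mul_const _ (by fun_prop)]
    refine lintegral_mono fun ξ => ?_
    rw [mul_pow]
    gcongr
    exact cv_sq_le hF hG ξ
  have h2 : ∫⁻ ξ, cv (fun ζ => lw b (-p) ζ * G ζ) F ξ ^ 2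
      ≤ (J * ∫⁻ ξ, G ξ ^ 2) * ∫⁻ ξ, F ξ ^ 2 :=
    (lintegral_cv_sq_le hk hF).trans
      (by gcongr; exact lintegral_mul_sq_le (by fun_prop) (by fun_prop))
  calc _ ≤ ∫⁻ ξ, (2 * (lw b (-p) ξ * cv F G ξ) ^ 2
            + 2 * cv (fun ζ => lw b (-p) ζ * G ζ) F ξ ^ 2) :=
        lintegral_mono fun ξ => (pow_le_pow_left' (hpt ξ) 2).trans (sq_add_le _ _)
    _ = 2 * (∫⁻ ξ, (lw b (-p) ξ * cv F G ξ) ^ 2)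
          + 2 * ∫⁻ ξ, cv (fun ζ => lw b (-p) ζ * G ζ) F ξ ^ 2 := by
        have := measurable_cv hF hG
        rw [lintegral_add_left (by fun_prop), lintegral_const_mul _ (by fun_prop),
          lintegral_const_mul _ ((measurable_cv hk hF).pow_const _)]
    _ ≤ 2 * (J * ((∫⁻ ξ, F ξ ^ 2) * ∫⁻ ξ, G ξ ^ 2))
          + 2 * ((J * ∫⁻ ξ, G ξ ^ 2) * ∫⁻ ξ, F ξ ^ 2) := by gcongr
    _ = _ := by ring

/-- The product law in weighted `L²` spaces on the Fourier side, with its scaling in `b`. -/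
lemma exists_sqNorm_cv_le {γ r : ℝ} (hr : 0 ≤ r) (hγ : 0 ≤ γ) (h : 3 / 2 < r + γ) :
    ∃ C : ℝ, 0 < C ∧ ∀ b : ℝ, 0 < b → ∀ f g : V3 → ℝ≥0∞, Measurable f → Measurable g →
      sqNorm b (γ - r) (cv f g)
        ≤ ENNReal.ofReal (C * b ^ (3 - 2 * (r + γ))) * (sqNorm b γ f * sqNorm b γ g) := by
  obtain ⟨D, hD0, hD⟩ : ∃ D : ℝ, 0 ≤ D ∧ decayInt (r + γ) = ENNReal.ofReal D :=
    ⟨_, ENNReal.toReal_nonneg, (ENNReal.ofReal_toReal (decayInt_lt_top h).ne).symm⟩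
  refine ⟨16 * (2 ^ γ) ^ 2 * (D + 1), by positivity, ?_⟩
  intro b hb f g hf hg
  set F := fun ξ => lw b γ ξ * f ξ with hF
  set G := fun ξ => lw b γ ξ * g ξ with hG
  have hFm : Measurable F := by fun_prop
  have hGm : Measurable G := by fun_prop
  have hfF : f = fun ξ => lw b (-γ) ξ * F ξ := by
    ext ξ; simp only [hF]; rw [← mul_assoc, lw_neg_mul hb, one_mul]
  have hgG : g = fun ξ => lw b (-γ) ξ * G ξ := by
    ext ξ; simp only [hG]; rw [← mul_assoc, lw_neg_mul hb, one_mul]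
  have hpt : ∀ ξ, lw b (γ - r) ξ * cv f g ξ
      ≤ ENNReal.ofReal (2 ^ γ) * (lw b (-r) ξ * cv F g ξ + lw b (-r) ξ * cv G f ξ) := fun ξ => by
    rw [sub_eq_add_neg, lw_add hb, mul_comm (lw b γ ξ), mul_assoc, ← mul_add,
      mul_left_comm (ENNReal.ofReal (2 ^ γ))]
    refine mul_le_mul' le_rfl ?_
    rw [cv_comm G f]
    unfold cv
    rw [← lintegral_const_mul _ (by fun_prop), ← lintegral_add_left (by fun_prop),
      ← lintegral_const_mul _ (by fun_prop)]
    refine lintegral_mono fun η => ?_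
    calc lw b γ ξ * (f η * g (ξ - η))
        ≤ ENNReal.ofReal (2 ^ γ) * (lw b γ η + lw b γ (ξ - η)) * (f η * g (ξ - η)) := by
          gcongr; exact lw_subadd hb.le hγ _ _
      _ = _ := by simp only [hF, hG]; ring
  have h1 := lintegral_lw_cv_sq_le hb hr hγ hFm hGm
  have h2 := lintegral_lw_cv_sq_le hb hr hγ hGm hFm
  rw [← hgG] at h1
  rw [← hfF] at h2
  have hm1 := measurable_cv hFm hg
  have hm2 := measurable_cv hGm hf
  set J := ∫⁻ ξ, lw b (-(r + γ)) ξ ^ 2 with hJdef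
  calc sqNorm b (γ - r) (cv f g)
      ≤ ∫⁻ ξ, ENNReal.ofReal (2 ^ γ) ^ 2 * (2 * (lw b (-r) ξ * cv F g ξ) ^ 2
          + 2 * (lw b (-r) ξ * cv G f ξ) ^ 2) :=
        lintegral_mono fun ξ => (pow_le_pow_left' (hpt ξ) 2).trans (by
          rw [mul_pow]; gcongr; exact sq_add_le _ _)
    _ = ENNReal.ofReal (2 ^ γ) ^ 2 * (2 * (∫⁻ ξ, (lw b (-r) ξ * cv F g ξ) ^ 2)
          + 2 * ∫⁻ ξ, (lw b (-r) ξ * cv G f ξ) ^ 2) := by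
        rw [lintegral_const_mul _ (by fun_prop), lintegral_add_left (by fun_prop),
          lintegral_const_mul _ (by fun_prop), lintegral_const_mul _ (by fun_prop)]
    _ ≤ ENNReal.ofReal (2 ^ γ) ^ 2 * (2 * (4 * J * (∫⁻ ξ, F ξ ^ 2) * ∫⁻ ξ, G ξ ^ 2)
          + 2 * (4 * J * (∫⁻ ξ, G ξ ^ 2) * ∫⁻ ξ, F ξ ^ 2)) := by gcongr
    _ = 16 * ENNReal.ofReal (2 ^ γ) ^ 2 * J * (sqNorm b γ f * sqNorm b γ g) := by
        simp only [sqNorm, hF, hG]; ring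
    _ ≤ _ := by
        gcongr
        rw [hJdef, lintegral_lw_sq hb, hD,
          ← ENNReal.ofReal_pow (by positivity),
          show (16 : ℝ≥0∞) = ENNReal.ofReal 16 by simp, ← ENNReal.ofReal_mul (by positivity),
          ← ENNReal.ofReal_mul (by positivity), ← ENNReal.ofReal_mul (by positivity)]
        refine ENNReal.ofReal_le_ofReal ?_
        have : 0 ≤ 16 * (2 ^ γ) ^ 2 * b ^ (3 - 2 * (r + γ)) := by positivity
        nlinarith

/-- Convolution with an integrable function supported in `|ξ| ≤ b`. -/
lemma sqNorm_cv_le_of_support {b γ r : ℝ} (hb : 0 < b) (hr : 0 ≤ r) (hγ : 0 ≤ γ)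
    {f g : V3 → ℝ≥0∞} (hf : Measurable f) (hg : Measurable g)
    (hsupp : ∀ ξ, b < en ξ → f ξ = 0) :
    sqNorm b (γ - r) (cv f g)
      ≤ ENNReal.ofReal (4 ^ γ * b ^ (-2 * r)) * ((∫⁻ ξ, f ξ) ^ 2 * sqNorm b γ g) := by
  have hG : Measurable fun ξ => lw b γ ξ * g ξ := by fun_prop
  have hr' : ∀ ξ, lw b (-r) ξ ≤ ENNReal.ofReal (b ^ (-r)) := fun ξ => by
    have := en_nonneg ξ
    exact ENNReal.ofReal_le_ofReal
      (Real.rpow_le_rpow_of_nonpos hb (by linarith) (by linarith))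
  have hpt : ∀ ξ, lw b (γ - r) ξ * cv f g ξ
      ≤ ENNReal.ofReal (b ^ (-r)) * ENNReal.ofReal (2 ^ γ)
        * cv f (fun ξ => lw b γ ξ * g ξ) ξ := fun ξ => by
    rw [sub_eq_add_neg, lw_add hb, mul_comm (lw b γ ξ), mul_assoc, mul_assoc]
    refine mul_le_mul' (hr' ξ) ?_
    unfold cv
    rw [← lintegral_const_mul _ (by fun_prop), ← lintegral_const_mul _ (by fun_prop)]
    refine lintegral_mono fun η => ?_
    by_cases hη : b < en η
    · simp [hsupp η hη]
    · calc lw b γ ξ * (f η * g (ξ - η))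
          ≤ ENNReal.ofReal (2 ^ γ) * lw b γ (ξ - η) * (f η * g (ξ - η)) := by
            gcongr
            have h1 := en_le_add_sub ξ η
            have h2 := en_nonneg (ξ - η)
            exact lw_le_mul hb.le hb.le (by norm_num) hγ (by linarith)
        _ = _ := by ring
  calc sqNorm b (γ - r) (cv f g)
      ≤ ∫⁻ ξ, (ENNReal.ofReal (b ^ (-r)) * ENNReal.ofReal (2 ^ γ)) ^ 2
        * cv f (fun ξ => lw b γ ξ * g ξ) ξ ^ 2 :=
        lintegral_mono fun ξ => (pow_le_pow_left' (hpt ξ) 2).trans_eq (by rw [mul_pow])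
    _ ≤ (ENNReal.ofReal (b ^ (-r)) * ENNReal.ofReal (2 ^ γ)) ^ 2
        * ((∫⁻ ξ, f ξ) ^ 2 * sqNorm b γ g) := by
        rw [lintegral_const_mul _ ((measurable_cv hf hG).pow_const _)]
        gcongr
        exact lintegral_cv_sq_le hf hG
    _ = _ := by
        congr 1
        rw [← ENNReal.ofReal_mul (by positivity), ← ENNReal.ofReal_pow (by positivity)]
        congr 1
        have h1 : (b ^ (-r)) ^ 2 = b ^ (-2 * r) := by
          rw [← Real.rpow_natCast, ← Real.rpow_mul hb.le]; congr 1; push_cast; ring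
        have h2 : ((2 : ℝ) ^ γ) ^ 2 = 4 ^ γ := by
          rw [← Real.rpow_natCast, ← Real.rpow_mul (by norm_num), mul_comm γ,
            Real.rpow_mul (by norm_num)]
          norm_num
        rw [mul_pow, h1, h2, mul_comm]

lemma lintegral_sq_le_of_support {R p r : ℝ} (hR : 0 ≤ R) (hr : 0 ≤ r)
    {f : V3 → ℝ≥0∞} (hf : Measurable f) (hsupp : ∀ ξ, R < en ξ → f ξ = 0) :
    (∫⁻ ξ, f ξ) ^ 2 ≤ ENNReal.ofReal ((1 + R) ^ (2 * r)) * (decayInt (r + p) * sqNorm 1 p f) := by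
  have hpt : ∀ ξ, f ξ ≤ ENNReal.ofReal ((1 + R) ^ r) * (lw 1 (-(r + p)) ξ * (lw 1 p ξ * f ξ)) :=
    fun ξ => by
    by_cases hξ : R < en ξ
    · simp [hsupp ξ hξ]
    have h1 : lw 1 r ξ ≤ ENNReal.ofReal ((1 + R) ^ r) := by
      have := en_nonneg ξ
      exact ENNReal.ofReal_le_ofReal (Real.rpow_le_rpow (by positivity) (by linarith) hr)
    calc f ξ = lw 1 r ξ * (lw 1 (-(r + p)) ξ * (lw 1 p ξ * f ξ)) := by
          rw [← mul_assoc, ← mul_assoc, ← lw_add one_pos, ← lw_add one_pos]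
          simp [lw_zero]
      _ ≤ _ := by gcongr
  calc (∫⁻ ξ, f ξ) ^ 2
      ≤ (ENNReal.ofReal ((1 + R) ^ r) * ∫⁻ ξ, lw 1 (-(r + p)) ξ * (lw 1 p ξ * f ξ)) ^ 2 := by
        rw [← lintegral_const_mul _ (by fun_prop)]
        exact pow_le_pow_left' (lintegral_mono hpt) 2
    _ ≤ _ := by
        rw [mul_pow, ← ENNReal.ofReal_pow (by positivity), ← Real.rpow_natCast,
          ← Real.rpow_mul (by positivity), mul_comm r]
        refine mul_le_mul' (by simp) ?_
        exact lintegral_mul_sq_le (Measurable.aemeasurable (by fun_prop))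
          (Measurable.aemeasurable (by fun_prop))

lemma rpow_mul_exp_neg_le {x τ p : ℝ} (hx : 0 ≤ x) (hτ : 0 < τ) (hp : 0 ≤ p) (hp1 : p ≤ 1) :
    x ^ (2 * p) * Real.exp (-(τ * x ^ 2 / 2)) ≤ 2 * τ ^ (-p) := by
  have h1 : x ^ (2 * p) = (τ * x ^ 2) ^ p * τ ^ (-p) := by
    rw [Real.mul_rpow hτ.le (by positivity), Real.rpow_mul hx, Real.rpow_neg hτ.le]
    have : τ ^ p ≠ 0 := by positivity
    field_simp
    norm_num
  have h2 : (τ * x ^ 2) ^ p ≤ 2 * Real.exp (τ * x ^ 2 / 2) := by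
    have h0 : 0 ≤ τ * x ^ 2 := by positivity
    have h3 : (τ * x ^ 2) ^ p ≤ 1 + τ * x ^ 2 := by
      rcases le_total (τ * x ^ 2) 1 with h | h
      · exact (Real.rpow_le_one h0 h hp).trans (by linarith)
      · exact (Real.rpow_le_rpow_of_exponent_le h hp1).trans (by simp)
    have := Real.add_one_le_exp (τ * x ^ 2 / 2)
    linarith
  calc x ^ (2 * p) * Real.exp (-(τ * x ^ 2 / 2))
      ≤ (2 * Real.exp (τ * x ^ 2 / 2) * τ ^ (-p)) * Real.exp (-(τ * x ^ 2 / 2)) := by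
        rw [h1]; gcongr
    _ = 2 * τ ^ (-p) := by
        rw [Real.exp_neg]; field_simp

lemma heat_kernel_le {a r τ x : ℝ} (ha : 0 < a) (hr : 0 ≤ r) (hr1 : r ≤ 1) (hτ : 0 < τ)
    (hx : 0 ≤ x) :
    x * (a + x) ^ r * Real.exp (-(τ * (x ^ 2 - a * x)))
      ≤ 6 * (τ ^ (-((1 + r) / 2)) + a ^ (1 + r)) * Real.exp (τ * a ^ 2 / 4) := by
  have hτp : 0 < τ ^ (-((1 + r) / 2)) := by positivity
  have hap : 0 < a ^ (1 + r) := by positivity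
  rcases le_total x (2 * a) with h | h
  · have h1 : (a + x) ^ r ≤ 3 * a ^ r := by
      calc (a + x) ^ r ≤ (3 * a) ^ r := Real.rpow_le_rpow (by positivity) (by linarith) hr
        _ = 3 ^ r * a ^ r := Real.mul_rpow (by norm_num) ha.le
        _ ≤ 3 ^ (1 : ℝ) * a ^ r := by
            gcongr; norm_num
        _ = _ := by simp
    have h2 : Real.exp (-(τ * (x ^ 2 - a * x))) ≤ Real.exp (τ * a ^ 2 / 4) := by
      apply Real.exp_le_exp.2
      nlinarith [mul_nonneg hτ.le (sq_nonneg (x - a / 2))]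
    calc _ ≤ (2 * a) * (3 * a ^ r) * Real.exp (τ * a ^ 2 / 4) := by gcongr
      _ = 6 * a ^ (1 + r) * Real.exp (τ * a ^ 2 / 4) := by
          rw [Real.rpow_add ha, Real.rpow_one]; ring
      _ ≤ _ := by gcongr; linarith
  · have hx0 : 0 < x := by linarith
    have h1 : (a + x) ^ r ≤ 2 * x ^ r := by
      calc (a + x) ^ r ≤ (2 * x) ^ r := Real.rpow_le_rpow (by positivity) (by linarith) hr
        _ = 2 ^ r * x ^ r := Real.mul_rpow (by norm_num) hx
        _ ≤ 2 ^ (1 : ℝ) * x ^ r := by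
            gcongr; norm_num
        _ = _ := by simp
    have h2 : Real.exp (-(τ * (x ^ 2 - a * x))) ≤ Real.exp (-(τ * x ^ 2 / 2)) := by
      apply Real.exp_le_exp.2
      have : a * x ≤ x ^ 2 / 2 := by nlinarith
      nlinarith
    have h3 := rpow_mul_exp_neg_le hx hτ (p := (1 + r) / 2) (by linarith) (by linarith)
    have h4 : x ^ (2 * ((1 + r) / 2)) = x * x ^ r := by
      rw [mul_div_cancel₀ _ (by norm_num), Real.rpow_add hx0, Real.rpow_one]
    rw [h4] at h3
    calc _ ≤ x * (2 * x ^ r) * Real.exp (-(τ * x ^ 2 / 2)) := by gcongr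
      _ = 2 * (x * x ^ r * Real.exp (-(τ * x ^ 2 / 2))) := by ring
      _ ≤ 2 * (2 * τ ^ (-((1 + r) / 2))) := by gcongr
      _ ≤ 6 * (τ ^ (-((1 + r) / 2)) + a ^ (1 + r)) * 1 := by linarith
      _ ≤ _ := by gcongr; exact Real.one_le_exp (by positivity)

lemma lintegral_rpow_mul_exp_neg {q k : ℝ} (hq : 0 < q) (hk : 0 < k) :
    ∫⁻ τ in Ioi (0 : ℝ), ENNReal.ofReal (τ ^ (q - 1) * Real.exp (-(k * τ)))
      = ENNReal.ofReal ((1 / k) ^ q * Real.Gamma q) := by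
  have h := Real.integral_rpow_mul_exp_neg_mul_Ioi hq hk
  have hpos : 0 < (1 / k) ^ q * Real.Gamma q := by
    have := Real.Gamma_pos_of_pos hq; positivity
  have h_int : IntegrableOn (fun τ : ℝ => τ ^ (q - 1) * Real.exp (-(k * τ))) (Ioi 0) := by
    by_contra hcon
    rw [integral_undef hcon] at h
    exact hpos.ne h
  rw [← h, ofReal_integral_eq_lintegral_ofReal h_int]
  filter_upwards [ae_restrict_mem measurableSet_Ioi] with τ hτ
  have : (0 : ℝ) < τ := hτ
  simp only [Pi.zero_apply]; positivity

lemma exists_lintegral_heat_kernel_le {r c : ℝ} (hr1 : r < 1) (hc : 0 < c) :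
    ∃ C : ℝ, 0 < C ∧ ∀ a t : ℝ, 0 < a →
      ∫⁻ s in Ioo 0 t, ENNReal.ofReal (6 * ((t - s) ^ (-((1 + r) / 2)) + a ^ (1 + r))
          * Real.exp ((t - s) * a ^ 2 / 4)) * ENNReal.ofReal (Real.exp ((1 / 4 + c) * (a ^ 2 * s)))
        ≤ ENNReal.ofReal (C * a ^ (r - 1) * Real.exp ((1 / 4 + c) * (a ^ 2 * t))) := by
  set q := (1 - r) / 2 with hq
  have hq0 : 0 < q := by rw [hq]; linarith
  have hG := Real.Gamma_pos_of_pos hq0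
  refine ⟨6 * ((1 / c) ^ q * Real.Gamma q + 1 / c), by positivity, fun a t ha => ?_⟩
  have hk : 0 < c * a ^ 2 := by positivity
  set E := Real.exp ((1 / 4 + c) * (a ^ 2 * t)) with hE
  set F : ℝ → ℝ≥0∞ := fun τ => ENNReal.ofReal (E * 6) *
    (ENNReal.ofReal (τ ^ (q - 1) * Real.exp (-(c * a ^ 2 * τ)))
      + ENNReal.ofReal (a ^ (1 + r)) * ENNReal.ofReal (τ ^ ((1 : ℝ) - 1)
        * Real.exp (-(c * a ^ 2 * τ)))) with hF
  have hFm : Measurable F := by fun_prop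
  have h1 : ∀ s ∈ Ioo 0 t, ENNReal.ofReal (6 * ((t - s) ^ (-((1 + r) / 2)) + a ^ (1 + r))
          * Real.exp ((t - s) * a ^ 2 / 4)) * ENNReal.ofReal (Real.exp ((1 / 4 + c) * (a ^ 2 * s)))
      = (Ioi (0 : ℝ)).indicator F (t - s) := by
    intro s hs
    have hts : 0 < t - s := by linarith [hs.2]
    rw [indicator_of_mem (by exact hts), hF]
    simp only
    rw [← ENNReal.ofReal_mul (by positivity), ← ENNReal.ofReal_mul (by positivity),
      ← ENNReal.ofReal_add (by positivity) (by positivity), ← ENNReal.ofReal_mul (by positivity)]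
    congr 1
    have e1 : Real.exp ((t - s) * a ^ 2 / 4) * Real.exp ((1 / 4 + c) * (a ^ 2 * s))
        = E * Real.exp (-(c * a ^ 2 * (t - s))) := by
      rw [hE, ← Real.exp_add, ← Real.exp_add]; congr 1; ring
    have e2 : q - 1 = -((1 + r) / 2) := by rw [hq]; ring
    rw [mul_assoc, e1, e2, sub_self, Real.rpow_zero]; ring
  calc _ = ∫⁻ s in Ioo 0 t, (Ioi (0 : ℝ)).indicator F (t - s) :=
        setLIntegral_congr_fun measurableSet_Ioo h1
    _ ≤ ∫⁻ s, (Ioi (0 : ℝ)).indicator F (t - s) := setLIntegral_le_lintegral _ _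
    _ = ∫⁻ τ in Ioi 0, F τ := by
        rw [lintegral_sub_left_eq_self, lintegral_indicator measurableSet_Ioi]
    _ = ENNReal.ofReal (E * 6) * (ENNReal.ofReal ((1 / (c * a ^ 2)) ^ q * Real.Gamma q)
          + ENNReal.ofReal (a ^ (1 + r)) * ENNReal.ofReal ((1 / (c * a ^ 2)) ^ (1 : ℝ)
            * Real.Gamma 1)) := by
        rw [hF, lintegral_const_mul _ (by fun_prop), lintegral_add_left (by fun_prop),
          lintegral_const_mul _ (by fun_prop), lintegral_rpow_mul_exp_neg hq0 hk,
          lintegral_rpow_mul_exp_neg one_pos hk]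
    _ = _ := by
        rw [Real.Gamma_one, Real.rpow_one, mul_one, ← ENNReal.ofReal_mul (by positivity),
          ← ENNReal.ofReal_add (by positivity) (by positivity),
          ← ENNReal.ofReal_mul (by positivity)]
        congr 1
        have e3 : (1 / (c * a ^ 2)) ^ q = (1 / c) ^ q * a ^ (r - 1) := by
          rw [← one_div_mul_one_div, one_div (a ^ 2), Real.mul_rpow (by positivity) (by positivity),
            ← Real.rpow_natCast a 2, ← Real.rpow_neg ha.le, ← Real.rpow_mul ha.le]
          congr 2; rw [hq]; push_cast; ring
        have e4 : a ^ (1 + r) * (1 / (c * a ^ 2)) = 1 / c * a ^ (r - 1) := by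
          rw [show 1 + r = (r - 1) + (2 : ℕ) by push_cast; ring, Real.rpow_add_natCast ha.ne']
          field_simp
        rw [e3, e4]; ring

/-- The Duhamel integral gains `r` derivatives, uniformly in exponentially weighted spaces. -/
lemma exists_sqNorm_duhamel_le {r c : ℝ} (hr : 0 ≤ r) (hr1 : r < 1) (hc : 0 < c) :
    ∃ C : ℝ, 0 < C ∧ ∀ γ a b t : ℝ, 0 < b → b ≤ a → ∀ h : ℝ → V3 → ℝ≥0∞,
      Measurable (Function.uncurry h) → ∀ H : ℝ≥0∞,
      (∀ s ∈ Ioo 0 t, sqNorm b (γ - r) (h s)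
        ≤ ENNReal.ofReal (Real.exp ((1 / 4 + c) * (a ^ 2 * s))) ^ 2 * H) →
      sqNorm b γ (fun ξ => ∫⁻ s in Ioo 0 t,
          ENNReal.ofReal (en ξ * Real.exp (-((t - s) * (en ξ ^ 2 - a * en ξ)))) * h s ξ)
        ≤ ENNReal.ofReal (C * a ^ (r - 1) * Real.exp ((1 / 4 + c) * (a ^ 2 * t))) ^ 2 * H := by
  obtain ⟨C, hC, hCle⟩ := exists_lintegral_heat_kernel_le hr1 hc
  refine ⟨C, hC, fun γ a b t hb hba h hh H hH => ?_⟩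
  have ha : 0 < a := hb.trans_le hba
  set φ : ℝ → ℝ≥0∞ := fun s => ENNReal.ofReal (6 * ((t - s) ^ (-((1 + r) / 2)) + a ^ (1 + r))
          * Real.exp ((t - s) * a ^ 2 / 4)) with hφ
  set ψ : ℝ → ℝ≥0∞ := fun s => ENNReal.ofReal (Real.exp ((1 / 4 + c) * (a ^ 2 * s))) with hψ
  set ψ' : ℝ → ℝ≥0∞ := fun s => ENNReal.ofReal (Real.exp (-((1 / 4 + c) * (a ^ 2 * s)))) with hψ'
  have hψψ : ∀ s, ψ s * ψ' s = 1 := fun s => by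
    simp only [hψ, hψ']
    rw [← ENNReal.ofReal_mul (by positivity), ← Real.exp_add]; simp
  have hφm : Measurable φ := by fun_prop
  have hψm : Measurable ψ := by fun_prop
  have hψm' : Measurable ψ' := by fun_prop
  have hhs : ∀ s, Measurable (h s) := fun s => hh.comp (by fun_prop : Measurable fun ξ => (s, ξ))
  have hhx : ∀ ξ, Measurable fun s => h s ξ := fun ξ =>
    hh.comp (by fun_prop : Measurable fun s => (s, ξ))
  have hpt : ∀ ξ, lw b γ ξ * ∫⁻ s in Ioo 0 t,
      ENNReal.ofReal (en ξ * Real.exp (-((t - s) * (en ξ ^ 2 - a * en ξ)))) * h s ξ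
      ≤ ∫⁻ s in Ioo 0 t, (φ s * ψ s) * (ψ' s * (lw b (γ - r) ξ * h s ξ)) := fun ξ => by
    have := hhx ξ
    have hx := en_nonneg ξ
    rw [← lintegral_const_mul _ (by fun_prop)]
    refine setLIntegral_mono (by fun_prop) fun s hs => ?_
    calc lw b γ ξ * (ENNReal.ofReal (en ξ * Real.exp (-((t - s) * (en ξ ^ 2 - a * en ξ))))
            * h s ξ)
        = (lw b r ξ * ENNReal.ofReal (en ξ * Real.exp (-((t - s) * (en ξ ^ 2 - a * en ξ)))))
            * (lw b (γ - r) ξ * h s ξ) := by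
          rw [show lw b γ ξ = lw b (γ - r) ξ * lw b r ξ by rw [← lw_add hb]; simp]; ring
      _ ≤ φ s * (lw b (γ - r) ξ * h s ξ) := by
          gcongr
          refine (mul_le_mul' (lw_le_of_nonneg hb.le hr (b' := a) (η := ξ) (by linarith))
            le_rfl).trans ?_
          rw [lw, ← ENNReal.ofReal_mul (by positivity)]
          refine ENNReal.ofReal_le_ofReal ?_
          convert heat_kernel_le ha hr hr1.le (sub_pos.2 hs.2) hx using 1
          ring
      _ = (φ s * ψ s) * (ψ' s * (lw b (γ - r) ξ * h s ξ)) := by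
          rw [mul_assoc (φ s), ← mul_assoc (ψ s), hψψ, one_mul]
  have hK := hCle a t ha
  set K := ∫⁻ s in Ioo 0 t, φ s * ψ s with hKdef
  have hm2 : Measurable (Function.uncurry fun (ξ : V3) (s : ℝ) =>
      (φ s * ψ s) * (ψ' s * (lw b (γ - r) ξ * h s ξ)) ^ 2) := by
    have : Measurable fun p : V3 × ℝ => h p.2 p.1 := hh.comp measurable_swap
    simp only [Function.uncurry_def]
    fun_prop
  calc _ ≤ ∫⁻ ξ, K * ∫⁻ s in Ioo 0 t,
            (φ s * ψ s) * (ψ' s * (lw b (γ - r) ξ * h s ξ)) ^ 2 := by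
        refine lintegral_mono fun ξ => (pow_le_pow_left' (hpt ξ) 2).trans ?_
        have := hhx ξ
        exact lintegral_mul_sq_le' (by fun_prop) (by fun_prop)
    _ = K * ∫⁻ s in Ioo 0 t, ∫⁻ ξ, (φ s * ψ s) * (ψ' s * (lw b (γ - r) ξ * h s ξ)) ^ 2 := by
        have hm3 : Measurable fun ξ => ∫⁻ s in Ioo 0 t,
            (φ s * ψ s) * (ψ' s * (lw b (γ - r) ξ * h s ξ)) ^ 2 := hm2.lintegral_prod_right'
        rw [lintegral_const_mul _ hm3,
          lintegral_lintegral_swap hm2.aemeasurable]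
    _ ≤ K * ∫⁻ s in Ioo 0 t, (φ s * ψ s) * H := by
        gcongr 1
        refine setLIntegral_mono (by fun_prop) fun s hs => ?_
        have := hhs s
        rw [lintegral_const_mul _ (by fun_prop)]
        gcongr
        simp only [mul_pow (ψ' s)]
        rw [lintegral_const_mul _ (by fun_prop)]
        calc ψ' s ^ 2 * sqNorm b (γ - r) (h s) ≤ ψ' s ^ 2 * (ψ s ^ 2 * H) := by
              gcongr; exact hH s hs
          _ = (ψ s * ψ' s) ^ 2 * H := by ring
          _ = H := by rw [hψψ]; simp
    _ = K ^ 2 * H := by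
        rw [lintegral_mul_const _ (by fun_prop)]; ring
    _ ≤ _ := by gcongr

/-! ### Vector-valued fields and the bilinear term -/

lemma pi_enorm_le_iff {v : Fin 3 → ℂ} {c : ℝ≥0∞} : ‖v‖ₑ ≤ c ↔ ∀ j, ‖v j‖ₑ ≤ c := by
  induction c using ENNReal.recTopCoe with
  | top => simp
  | coe c =>
    simp only [enorm_eq_nnnorm, ENNReal.coe_le_coe]
    exact pi_nnnorm_le_iff

lemma enorm_apply_le (v : Fin 3 → ℂ) (j : Fin 3) : ‖v j‖ₑ ≤ ‖v‖ₑ := pi_enorm_le_iff.1 le_rfl j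

lemma enorm_sq_le_vnSq (v : Fin 3 → ℂ) : ‖v‖ₑ ^ 2 ≤ ENNReal.ofReal (vnSq v) := by
  have h : ‖v‖ ^ 2 ≤ vnSq v := by
    have h0 : 0 ≤ vnSq v := Finset.sum_nonneg fun _ _ => sq_nonneg _
    rw [← Real.sq_sqrt h0]
    refine pow_le_pow_left₀ (norm_nonneg _) ?_ 2
    refine (pi_norm_le_iff_of_nonneg (Real.sqrt_nonneg _)).2 fun j => Real.le_sqrt_of_sq_le ?_
    exact Finset.single_le_sum (f := fun j => ‖v j‖ ^ 2) (fun i _ => sq_nonneg _)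
      (Finset.mem_univ j)
  rw [← ofReal_norm, ← ENNReal.ofReal_pow (norm_nonneg _)]
  exact ENNReal.ofReal_le_ofReal h

lemma vnSq_le_enorm_sq (v : Fin 3 → ℂ) : ENNReal.ofReal (vnSq v) ≤ 3 * ‖v‖ₑ ^ 2 := by
  have h : vnSq v ≤ 3 * ‖v‖ ^ 2 := by
    have : ∀ j ∈ Finset.univ, ‖v j‖ ^ 2 ≤ ‖v‖ ^ 2 := fun j _ =>
      pow_le_pow_left₀ (norm_nonneg _) (norm_le_pi_norm v j) 2
    simpa [vnSq] using Finset.sum_le_card_nsmul _ _ _ this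
  refine (ENNReal.ofReal_le_ofReal h).trans_eq ?_
  rw [ENNReal.ofReal_mul (by norm_num), ENNReal.ofReal_pow (norm_nonneg _), ofReal_norm]
  norm_num

lemma wnorm_sq (w : V3 → ℝ) (f : V3 → Fin 3 → ℂ) :
    wnorm w f ^ 2 = ∫⁻ ξ : V3, ENNReal.ofReal (w ξ ^ 2 * vnSq (f ξ)) := by
  rw [wnorm, ← ENNReal.rpow_natCast, ← ENNReal.rpow_mul]; norm_num

lemma ofReal_sq_mul_vnSq (x : ℝ) (v : Fin 3 → ℂ) :
    ENNReal.ofReal (x ^ 2 * vnSq v) = ‖x‖ₑ ^ 2 * ENNReal.ofReal (vnSq v) := by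
  rw [ENNReal.ofReal_mul (sq_nonneg _), ← sq_abs, ENNReal.ofReal_pow (abs_nonneg _),
    ← Real.enorm_eq_ofReal_abs]

lemma wnorm_sq_le (w : V3 → ℝ) (f : V3 → Fin 3 → ℂ) :
    wnorm w f ^ 2 ≤ 3 * ∫⁻ ξ, (‖w ξ‖ₑ * ‖f ξ‖ₑ) ^ 2 := by
  rw [wnorm_sq, ← lintegral_const_mul' _ _ (by simp)]
  refine lintegral_mono fun ξ => ?_
  rw [ofReal_sq_mul_vnSq]
  calc _ ≤ ‖w ξ‖ₑ ^ 2 * (3 * ‖f ξ‖ₑ ^ 2) := by gcongr; exact vnSq_le_enorm_sq _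
    _ = _ := by ring

lemma lintegral_sq_le_wnorm_sq (w : V3 → ℝ) (f : V3 → Fin 3 → ℂ) :
    ∫⁻ ξ, (‖w ξ‖ₑ * ‖f ξ‖ₑ) ^ 2 ≤ wnorm w f ^ 2 := by
  rw [wnorm_sq]
  refine lintegral_mono fun ξ => ?_
  rw [ofReal_sq_mul_vnSq, mul_pow]
  gcongr; exact enorm_sq_le_vnSq _

lemma enorm_wH_le {γ : ℝ} (hγ : 0 ≤ γ) (ξ : V3) : ‖wH γ ξ‖ₑ ≤ lw 1 γ ξ := by
  have := en_nonneg ξ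
  rw [wH, Real.enorm_eq_ofReal (by positivity), lw]
  refine ENNReal.ofReal_le_ofReal ?_
  calc (1 + en ξ ^ 2) ^ (γ / 2) ≤ ((1 + en ξ) ^ 2) ^ (γ / 2) :=
        Real.rpow_le_rpow (by positivity) (by nlinarith) (by positivity)
    _ = _ := by
        rw [← Real.rpow_natCast, ← Real.rpow_mul (by positivity)]; congr 1; push_cast; ring

lemma lw_le_enorm_wH {γ : ℝ} (hγ : 0 ≤ γ) (ξ : V3) :
    lw 1 γ ξ ≤ ENNReal.ofReal (2 ^ (γ / 2)) * ‖wH γ ξ‖ₑ := by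
  have := en_nonneg ξ
  rw [wH, Real.enorm_eq_ofReal (by positivity), lw, ← ENNReal.ofReal_mul (by positivity),
    ← Real.mul_rpow (by positivity) (by positivity)]
  refine ENNReal.ofReal_le_ofReal ?_
  calc (1 + en ξ) ^ γ = ((1 + en ξ) ^ 2) ^ (γ / 2) := by
        rw [← Real.rpow_natCast, ← Real.rpow_mul (by positivity)]; congr 1; push_cast; ring
    _ ≤ _ := Real.rpow_le_rpow (by positivity) (by nlinarith [sq_nonneg (1 - en ξ)])
        (by positivity)

lemma wnorm_wH_sq_le {γ : ℝ} (hγ : 0 ≤ γ) (f : V3 → Fin 3 → ℂ) :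
    wnorm (wH γ) f ^ 2 ≤ 3 * sqNorm 1 γ fun ξ => ‖f ξ‖ₑ := by
  refine (wnorm_sq_le _ _).trans ?_
  unfold sqNorm
  gcongr
  exact enorm_wH_le hγ _

lemma sqNorm_le_wnorm_wH {γ : ℝ} (hγ : 0 ≤ γ) (f : V3 → Fin 3 → ℂ) :
    (sqNorm 1 γ fun ξ => ‖f ξ‖ₑ) ≤ ENNReal.ofReal (2 ^ γ) * wnorm (wH γ) f ^ 2 := by
  refine le_trans ?_ (mul_le_mul_right (lintegral_sq_le_wnorm_sq _ _) _)
  unfold sqNorm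
  rw [← lintegral_const_mul' _ _ ENNReal.ofReal_ne_top]
  refine lintegral_mono fun ξ => ?_
  calc (lw 1 γ ξ * ‖f ξ‖ₑ) ^ 2 ≤ (ENNReal.ofReal (2 ^ (γ / 2)) * ‖wH γ ξ‖ₑ * ‖f ξ‖ₑ) ^ 2 := by
        gcongr; exact lw_le_enorm_wH hγ _
    _ = ENNReal.ofReal (2 ^ (γ / 2)) ^ 2 * (‖wH γ ξ‖ₑ * ‖f ξ‖ₑ) ^ 2 := by ring
    _ = _ := by
        rw [← ENNReal.ofReal_pow (by positivity), ← Real.rpow_natCast, ← Real.rpow_mul (by simp)]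
        congr 3; push_cast; ring

/-- The linear combination defining `Qhat`, applied to the matrix of convolutions. -/
def Qsum (α : Coeffs) (ξ : V3) (I : Fin 3 → Fin 3 → ℂ) : Fin 3 → ℂ := fun j =>
  ∑ k : Fin 3, ∑ l : Fin 3, ∑ m : Fin 3,
    (qsym α j m k l ξ : ℂ) * (Complex.I * (ξ m : ℂ)) *
      ((((2 * Real.pi) ^ (3 : ℕ))⁻¹ : ℝ) : ℂ) * I k l

lemma Qhat_eq_Qsum (α : Coeffs) (U W : V3 → Fin 3 → ℂ) (ξ : V3) :
    Qhat α U W ξ = Qsum α ξ fun k l => ∫ η : V3, U η k * W (ξ - η) l := rfl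

lemma Qsum_sub (α : Coeffs) (ξ : V3) (I J : Fin 3 → Fin 3 → ℂ) :
    Qsum α ξ I - Qsum α ξ J = Qsum α ξ fun k l => I k l - J k l := by
  ext j; simp only [Qsum, Pi.sub_apply, ← Finset.sum_sub_distrib, ← mul_sub]

lemma abs_qsym_le (α : Coeffs) : ∃ A : ℝ, 0 ≤ A ∧ ∀ j m k l ξ, |qsym α j m k l ξ| ≤ A := by
  obtain ⟨A, hA⟩ := (Set.finite_range fun i : Fin 3 × Fin 3 × Fin 3 × Fin 3 =>
    ∑ n, ∑ p, |α i.1 i.2.1 n p i.2.2.1 i.2.2.2|).bddAbove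
  refine ⟨max A 0, le_max_right _ _, fun j m k l ξ => ?_⟩
  refine le_trans ?_ ((hA ⟨(j, m, k, l), rfl⟩).trans (le_max_left A 0))
  refine (Finset.abs_sum_le_sum_abs _ _).trans (Finset.sum_le_sum fun n _ => ?_)
  refine (Finset.abs_sum_le_sum_abs _ _).trans (Finset.sum_le_sum fun p _ => ?_)
  rw [abs_div, abs_mul, abs_mul, abs_of_nonneg (sq_nonneg (en ξ)), mul_div_assoc]
  refine mul_le_of_le_one_right (abs_nonneg _) (div_le_one_of_le₀ ?_ (sq_nonneg _))
  rw [sq]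
  exact mul_le_mul (abs_coord_le_en ξ n) (abs_coord_le_en ξ p) (abs_nonneg _) (en_nonneg ξ)

lemma exists_enorm_Qsum_le (α : Coeffs) : ∃ A : ℝ, 0 < A ∧ ∀ ξ I (X : ℝ≥0∞),
    (∀ k l, ‖I k l‖ₑ ≤ X) → ‖Qsum α ξ I‖ₑ ≤ ENNReal.ofReal (A * en ξ) * X := by
  obtain ⟨A, hA0, hA⟩ := abs_qsym_le α
  refine ⟨27 * (A + 1), by positivity, fun ξ I X hX => pi_enorm_le_iff.2 fun j => ?_⟩
  have hx := en_nonneg ξ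
  have hterm : ∀ k l m, ‖(qsym α j m k l ξ : ℂ) * (Complex.I * (ξ m : ℂ)) *
      ((((2 * Real.pi) ^ (3 : ℕ))⁻¹ : ℝ) : ℂ) * I k l‖ₑ
        ≤ ENNReal.ofReal ((A + 1) * en ξ) * X := fun k l m => by
    rw [enorm_mul]
    refine mul_le_mul' ?_ (hX k l)
    rw [← ofReal_norm]
    refine ENNReal.ofReal_le_ofReal ?_
    rw [norm_mul, norm_mul, norm_mul, Complex.norm_I, one_mul, Complex.norm_real,
      Complex.norm_real, Complex.norm_real, Real.norm_eq_abs, Real.norm_eq_abs, Real.norm_eq_abs]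
    have hpi : |((2 * Real.pi) ^ 3)⁻¹| ≤ 1 := by
      rw [abs_of_nonneg (by positivity)]
      exact inv_le_one_of_one_le₀ (one_le_pow₀ (by linarith [Real.pi_gt_three]))
    calc _ ≤ A * en ξ * 1 := by
          gcongr
          · exact hA j m k l ξ
          · exact abs_coord_le_en ξ m
      _ ≤ _ := by nlinarith
  calc _ ≤ ∑ k : Fin 3, ∑ l : Fin 3, ∑ m : Fin 3, ENNReal.ofReal ((A + 1) * en ξ) * X := by
        refine (enorm_sum_le _ _).trans (Finset.sum_le_sum fun k _ => ?_)
        refine (enorm_sum_le _ _).trans (Finset.sum_le_sum fun l _ => ?_)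
        exact (enorm_sum_le _ _).trans (Finset.sum_le_sum fun m _ => hterm k l m)
    _ = _ := by
        simp only [Finset.sum_const, Finset.card_univ, Fintype.card_fin, nsmul_eq_mul]
        rw [mul_assoc (27 : ℝ), ENNReal.ofReal_mul (p := 27) (by norm_num),
          show ENNReal.ofReal 27 = 27 by norm_num]
        push_cast
        ring

lemma enorm_integral_mul_le (U W : V3 → Fin 3 → ℂ) (ξ : V3) (k l : Fin 3) :
    ‖∫ η : V3, U η k * W (ξ - η) l‖ₑ ≤ cv (fun ξ => ‖U ξ‖ₑ) (fun ξ => ‖W ξ‖ₑ) ξ := by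
  refine (enorm_integral_le_lintegral_enorm _).trans (lintegral_mono fun η => ?_)
  rw [enorm_mul]
  exact mul_le_mul' (enorm_apply_le _ _) (enorm_apply_le _ _)

lemma integrable_mul_of_cv_lt_top {U W : V3 → Fin 3 → ℂ} (hU : ∀ k, Measurable fun ξ => U ξ k)
    (hW : ∀ k, Measurable fun ξ => W ξ k) {ξ : V3}
    (h : cv (fun ξ => ‖U ξ‖ₑ) (fun ξ => ‖W ξ‖ₑ) ξ < ⊤) (k l : Fin 3) :
    Integrable fun η => U η k * W (ξ - η) l := by
  have := hU k
  have hw := hW l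
  refine ⟨Measurable.aestronglyMeasurable ?_, lt_of_le_of_lt (lintegral_mono fun η => ?_) h⟩
  · exact this.mul (hw.comp (measurable_const.sub measurable_id))
  · rw [enorm_mul]
    exact mul_le_mul' (enorm_apply_le _ _) (enorm_apply_le _ _)

/-- Bounds for the bilinear term in terms of convolutions of absolute values. -/
lemma exists_enorm_Qhat_le (α : Coeffs) : ∃ A : ℝ, 0 < A ∧
    (∀ U W ξ, ‖Qhat α U W ξ‖ₑ
      ≤ ENNReal.ofReal (A * en ξ) * cv (fun ξ => ‖U ξ‖ₑ) (fun ξ => ‖W ξ‖ₑ) ξ) ∧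
    ∀ U W ξ, (∀ k, Measurable fun ξ => U ξ k) → (∀ k, Measurable fun ξ => W ξ k) →
      cv (fun ξ => ‖U ξ‖ₑ) (fun ξ => ‖U ξ‖ₑ) ξ < ⊤ →
      cv (fun ξ => ‖W ξ‖ₑ) (fun ξ => ‖W ξ‖ₑ) ξ < ⊤ →
      ‖Qhat α U U ξ - Qhat α W W ξ‖ₑ ≤ ENNReal.ofReal (A * en ξ) *
        cv (fun ξ => ‖U ξ‖ₑ + ‖W ξ‖ₑ) (fun ξ => ‖U ξ - W ξ‖ₑ) ξ := by
  obtain ⟨A, hA, hQ⟩ := exists_enorm_Qsum_le α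
  refine ⟨A, hA, fun U W ξ => hQ _ _ _ fun k l => enorm_integral_mul_le U W ξ k l, ?_⟩
  intro U W ξ hU hW hUU hWW
  rw [Qhat_eq_Qsum, Qhat_eq_Qsum, Qsum_sub]
  refine hQ _ _ _ fun k l => ?_
  rw [← integral_sub (integrable_mul_of_cv_lt_top hU hU hUU k l)
    (integrable_mul_of_cv_lt_top hW hW hWW k l)]
  have mU : Measurable fun ξ => ‖U ξ‖ₑ := (measurable_pi_iff.2 hU).enorm
  have mW : Measurable fun ξ => ‖W ξ‖ₑ := (measurable_pi_iff.2 hW).enorm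
  have mD : Measurable fun ξ => ‖U ξ - W ξ‖ₑ :=
    ((measurable_pi_iff.2 hU).sub (measurable_pi_iff.2 hW)).enorm
  calc _ ≤ ∫⁻ η, (‖U η‖ₑ * ‖U (ξ - η) - W (ξ - η)‖ₑ + ‖U η - W η‖ₑ * ‖W (ξ - η)‖ₑ) := by
        refine (enorm_integral_le_lintegral_enorm _).trans (lintegral_mono fun η => ?_)
        rw [show U η k * U (ξ - η) l - W η k * W (ξ - η) l
          = U η k * (U (ξ - η) - W (ξ - η)) l + (U η - W η) k * W (ξ - η) l by
            simp only [Pi.sub_apply]; ring]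
        refine (enorm_add_le _ _).trans ?_
        rw [enorm_mul, enorm_mul]
        gcongr <;> exact enorm_apply_le _ _
    _ = cv (fun ξ => ‖U ξ‖ₑ) (fun ξ => ‖U ξ - W ξ‖ₑ) ξ
          + cv (fun ξ => ‖U ξ - W ξ‖ₑ) (fun ξ => ‖W ξ‖ₑ) ξ :=
        lintegral_add_left (by fun_prop) _
    _ = cv (fun ξ => ‖U ξ‖ₑ) (fun ξ => ‖U ξ - W ξ‖ₑ) ξ
          + cv (fun ξ => ‖W ξ‖ₑ) (fun ξ => ‖U ξ - W ξ‖ₑ) ξ := by rw [cv_comm _ fun ξ => ‖W ξ‖ₑ]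
    _ = _ := by
        unfold cv
        rw [← lintegral_add_left (by fun_prop)]
        simp only [add_mul]

lemma Qhat_congr_ae (α : Coeffs) {U W : V3 → Fin 3 → ℂ} (h : U =ᵐ[volume] W) (ξ : V3) :
    Qhat α U U ξ = Qhat α W W ξ := by
  rw [Qhat_eq_Qsum, Qhat_eq_Qsum]
  congr 1; ext k l
  refine integral_congr_ae ?_
  have h' := (quasiMeasurePreserving_sub_left (volume : Measure V3) ξ).ae_eq h
  filter_upwards [h, h'] with η h1 h2
  simp only [Function.comp_def] at h2
  rw [h1, h2]

lemma MeasVF.measurable {U : ℝ → V3 → Fin 3 → ℂ} (hU : MeasVF U) :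
    Measurable (Function.uncurry U) := measurable_pi_iff.2 hU

lemma measurable_Qhat (α : Coeffs) {U : ℝ → V3 → Fin 3 → ℂ} (hU : MeasVF U) :
    MeasVF fun t => Qhat α (U t) (U t) := by
  intro j
  have h_int : ∀ k l, Measurable fun p : ℝ × V3 => ∫ η : V3, U p.1 η k * U p.1 (p.2 - η) l :=
    fun k l => by
    refine (StronglyMeasurable.integral_prod_right'
      (f := fun q : (ℝ × V3) × V3 => U q.1.1 q.2 k * U q.1.1 (q.1.2 - q.2) l) ?_).measurable
    refine Measurable.stronglyMeasurable ?_
    have h1 : Measurable fun q : (ℝ × V3) × V3 => U q.1.1 q.2 k :=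
      (hU k).comp (by fun_prop : Measurable fun q : (ℝ × V3) × V3 => (q.1.1, q.2))
    have h2 : Measurable fun q : (ℝ × V3) × V3 => U q.1.1 (q.1.2 - q.2) l :=
      (hU l).comp (by fun_prop : Measurable fun q : (ℝ × V3) × V3 => (q.1.1, q.1.2 - q.2))
    exact h1.mul h2
  simp only [Qhat, Function.uncurry_def]
  refine Finset.measurable_sum _ fun k _ => Finset.measurable_sum _ fun l _ =>
    Finset.measurable_sum _ fun m _ => ?_
  have := h_int k l
  unfold qsym
  fun_prop

/-! ### The Duhamel map -/

/-- The right-hand side of the mild formulation. -/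
def duh (α : Coeffs) (U₀ : V3 → Fin 3 → ℂ) (U : ℝ → V3 → Fin 3 → ℂ) (t : ℝ) (ξ : V3) :
    Fin 3 → ℂ := fun j =>
  (Real.exp (-(t * en ξ ^ 2)) : ℂ) * U₀ ξ j
    + ∫ s in (0 : ℝ)..t, (Real.exp (-((t - s) * en ξ ^ 2)) : ℂ) * Qhat α (U s) (U s) ξ j

lemma isMildSol_iff {α : Coeffs} {U₀ : V3 → Fin 3 → ℂ} {U : ℝ → V3 → Fin 3 → ℂ} {T : ℝ} :
    IsMildSol α U₀ U T ↔ ∀ t ∈ Icc 0 T, ∀ ξ, U t ξ = duh α U₀ U t ξ :=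
  forall_congr' fun _ => forall_congr' fun _ => forall_congr' fun _ => funext_iff.symm

lemma MeasVF.comp {F : ℝ → V3 → Fin 3 → ℂ} (hF : MeasVF F) {X : Type*} [MeasurableSpace X]
    {f : X → ℝ} {g : X → V3} (hf : Measurable f) (hg : Measurable g) (j : Fin 3) :
    Measurable fun x => F (f x) (g x) j :=
  Measurable.comp (hF j) (hf.prodMk hg)

lemma measVF_duh (α : Coeffs) {U₀ : V3 → Fin 3 → ℂ} (hU₀ : ∀ j, Measurable fun ξ => U₀ ξ j)
    {U : ℝ → V3 → Fin 3 → ℂ} (hU : MeasVF U) (T : ℝ) :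
    MeasVF ((Icc 0 T).indicator (duh α U₀ U)) := by
  intro j
  have hQ := measurable_Qhat α hU
  have h_int : Measurable fun p : ℝ × V3 => ∫ s, (Ioc 0 p.1).indicator (fun s =>
      (Real.exp (-((p.1 - s) * en p.2 ^ 2)) : ℂ) * Qhat α (U s) (U s) p.2 j) s := by
    refine (StronglyMeasurable.integral_prod_right' (f := fun q : (ℝ × V3) × ℝ =>
      {q : (ℝ × V3) × ℝ | q.2 ∈ Ioc 0 q.1.1}.indicator (fun q : (ℝ × V3) × ℝ =>
        (Real.exp (-((q.1.1 - q.2) * en q.1.2 ^ 2)) : ℂ) * Qhat α (U q.2) (U q.2) q.1.2 j) q)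
      (Measurable.stronglyMeasurable ?_)).measurable
    have h1 : Measurable fun q : (ℝ × V3) × ℝ => Qhat α (U q.2) (U q.2) q.1.2 j :=
      hQ.comp measurable_snd (measurable_snd.comp measurable_fst) j
    refine Measurable.indicator (by fun_prop) ?_
    exact (measurableSet_lt measurable_const measurable_snd).inter
      (measurableSet_le measurable_snd (by fun_prop))
  have hj := hU₀ j
  have : (Function.uncurry fun t ξ => (Icc 0 T).indicator (duh α U₀ U) t ξ j)
      = {p : ℝ × V3 | p.1 ∈ Icc 0 T}.indicator fun p =>
        (Real.exp (-(p.1 * en p.2 ^ 2)) : ℂ) * U₀ p.2 j + ∫ s, (Ioc 0 p.1).indicator (fun s =>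
      (Real.exp (-((p.1 - s) * en p.2 ^ 2)) : ℂ) * Qhat α (U s) (U s) p.2 j) s := by
    ext ⟨t, ξ⟩
    by_cases ht : t ∈ Icc 0 T
    · simp only [Function.uncurry_apply_pair, indicator_of_mem ht, duh, mem_ofPred_eq, ht,
        indicator_of_mem]
      rw [intervalIntegral.integral_of_le ht.1, integral_indicator measurableSet_Ioc]
    · rw [Function.uncurry_apply_pair, indicator_of_notMem ht]
      exact (indicator_of_notMem (s := {p : ℝ × V3 | p.1 ∈ Icc 0 T}) ht _).symm
  rw [this]
  refine Measurable.indicator (by fun_prop) ?_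
  exact measurable_fst measurableSet_Icc

lemma enorm_exp_mul (x : ℝ) (z : ℂ) :
    ‖(Real.exp x : ℂ) * z‖ₑ = ENNReal.ofReal (Real.exp x) * ‖z‖ₑ := by
  rw [enorm_mul, ← ofReal_norm, Complex.norm_real, Real.norm_eq_abs, Real.abs_exp]

lemma enorm_duh_le (α : Coeffs) (U₀ : V3 → Fin 3 → ℂ) (U : ℝ → V3 → Fin 3 → ℂ) {t : ℝ}
    (ht : 0 ≤ t) (ξ : V3) :
    ‖duh α U₀ U t ξ‖ₑ ≤ ENNReal.ofReal (Real.exp (-(t * en ξ ^ 2))) * ‖U₀ ξ‖ₑ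
      + ∫⁻ s in Ioo 0 t, ENNReal.ofReal (Real.exp (-((t - s) * en ξ ^ 2)))
          * ‖Qhat α (U s) (U s) ξ‖ₑ := by
  refine pi_enorm_le_iff.2 fun j => (enorm_add_le _ _).trans (add_le_add ?_ ?_)
  · rw [enorm_exp_mul]
    gcongr; exact enorm_apply_le _ _
  · rw [intervalIntegral.integral_of_le ht, integral_Ioc_eq_integral_Ioo]
    refine (enorm_integral_le_lintegral_enorm _).trans (lintegral_mono fun s => ?_)
    rw [enorm_exp_mul]
    gcongr; exact enorm_apply_le _ _

lemma integrableOn_Qhat (α : Coeffs) {U : ℝ → V3 → Fin 3 → ℂ} (hU : MeasVF U) {t : ℝ} {ξ : V3}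
    {B : ℝ≥0∞} (hB : B < ⊤)
    (h : ∀ s ∈ Ioo 0 t, cv (fun ξ => ‖U s ξ‖ₑ) (fun ξ => ‖U s ξ‖ₑ) ξ ≤ B) (j : Fin 3) :
    IntegrableOn (fun s => Qhat α (U s) (U s) ξ j) (Ioo 0 t) := by
  obtain ⟨A, hA, hQ, -⟩ := exists_enorm_Qhat_le α
  have hm : Measurable fun s => Qhat α (U s) (U s) ξ j :=
    (measurable_Qhat α hU).comp measurable_id measurable_const j
  refine ⟨hm.aestronglyMeasurable, ?_⟩
  calc ∫⁻ s in Ioo 0 t, ‖Qhat α (U s) (U s) ξ j‖ₑ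
      ≤ ∫⁻ s in Ioo 0 t, ENNReal.ofReal (A * en ξ) * B := by
        refine setLIntegral_mono (by fun_prop) fun s hs => ?_
        exact (enorm_apply_le _ _).trans ((hQ _ _ _).trans (by gcongr; exact h s hs))
    _ < ⊤ := by
        rw [setLIntegral_const]
        exact ENNReal.mul_lt_top (ENNReal.mul_lt_top ENNReal.ofReal_lt_top hB) (by simp)

lemma enorm_duh_sub_le (α : Coeffs) (U₀ : V3 → Fin 3 → ℂ) {U W : ℝ → V3 → Fin 3 → ℂ}
    (hU : MeasVF U) (hW : MeasVF W) {t : ℝ} (ht : 0 ≤ t) {ξ : V3} {B : ℝ≥0∞} (hB : B < ⊤)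
    (hBU : ∀ s ∈ Ioo 0 t, cv (fun ξ => ‖U s ξ‖ₑ) (fun ξ => ‖U s ξ‖ₑ) ξ ≤ B)
    (hBW : ∀ s ∈ Ioo 0 t, cv (fun ξ => ‖W s ξ‖ₑ) (fun ξ => ‖W s ξ‖ₑ) ξ ≤ B) :
    ‖duh α U₀ U t ξ - duh α U₀ W t ξ‖ₑ
      ≤ ∫⁻ s in Ioo 0 t, ENNReal.ofReal (Real.exp (-((t - s) * en ξ ^ 2)))
          * ‖Qhat α (U s) (U s) ξ - Qhat α (W s) (W s) ξ‖ₑ := by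
  have h_int : ∀ {U : ℝ → V3 → Fin 3 → ℂ}, MeasVF U →
      (∀ s ∈ Ioo 0 t, cv (fun ξ => ‖U s ξ‖ₑ) (fun ξ => ‖U s ξ‖ₑ) ξ ≤ B) → ∀ j, IntegrableOn
      (fun s => (Real.exp (-((t - s) * en ξ ^ 2)) : ℂ) * Qhat α (U s) (U s) ξ j) (Ioo 0 t) := by
    intro U hU hBU j
    refine (integrableOn_Qhat α hU hB hBU j).bdd_mul (c := 1)
      (by fun_prop : Measurable fun s : ℝ =>
        (Real.exp (-((t - s) * en ξ ^ 2)) : ℂ)).aestronglyMeasurable ?_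
    refine (ae_restrict_mem measurableSet_Ioo).mono fun s hs => ?_
    rw [Complex.norm_real, Real.norm_eq_abs, Real.abs_exp, Real.exp_le_one_iff]
    have := mul_nonneg (sub_nonneg.2 hs.2.le) (sq_nonneg (en ξ))
    linarith
  refine pi_enorm_le_iff.2 fun j => ?_
  simp only [duh, Pi.sub_apply, add_sub_add_left_eq_sub]
  rw [intervalIntegral.integral_of_le ht, intervalIntegral.integral_of_le ht,
    integral_Ioc_eq_integral_Ioo, integral_Ioc_eq_integral_Ioo,
    ← integral_sub (h_int hU hBU j) (h_int hW hBW j)]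
  refine (enorm_integral_le_lintegral_enorm _).trans (lintegral_mono fun s => ?_)
  rw [← mul_sub, enorm_exp_mul]
  gcongr
  exact enorm_apply_le (Qhat α (U s) (U s) ξ - Qhat α (W s) (W s) ξ) j

/-! ### Pointwise majorants with analyticity weight `exp(-√t|ξ|)` -/

/-- The weight `exp(-√t |ξ|)`. -/
def gw (t : ℝ) (ξ : V3) : ℝ≥0∞ := ENNReal.ofReal (Real.exp (-(Real.sqrt t * en ξ)))

/-- The bilinear majorant `q (1+|ξ|)^{-r} (F * G)`. -/
def majB (r : ℝ) (q : ℝ) (F G : V3 → ℝ≥0∞) (ξ : V3) : ℝ≥0∞ :=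
  ENNReal.ofReal q * (lw 1 (-r) ξ * cv F G ξ)

lemma gw_le_one (t : ℝ) (ξ : V3) : gw t ξ ≤ 1 := by
  rw [gw, ← ENNReal.ofReal_one]
  refine ENNReal.ofReal_le_ofReal (Real.exp_le_one_iff.2 ?_)
  have := mul_nonneg (Real.sqrt_nonneg t) (en_nonneg ξ)
  linarith

lemma gw_ne_top (t : ℝ) (ξ : V3) : gw t ξ ≠ ⊤ := ENNReal.ofReal_ne_top

lemma measurable_majB {r q : ℝ} {F G : V3 → ℝ≥0∞} (hF : Measurable F) (hG : Measurable G) :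
    Measurable (majB r q F G) := by
  have := measurable_cv hF hG
  unfold majB; fun_prop

lemma majB_mono {r q : ℝ} {F F' G G' : V3 → ℝ≥0∞} (hF : ∀ ξ, F ξ ≤ F' ξ) (hG : ∀ ξ, G ξ ≤ G' ξ)
    (ξ : V3) : majB r q F G ξ ≤ majB r q F' G' ξ := by
  unfold majB; gcongr; exact cv_mono hF hG ξ

lemma sqNorm_majB {r q γ : ℝ} {F G : V3 → ℝ≥0∞} (hF : Measurable F) (hG : Measurable G) :
    sqNorm 1 γ (majB r q F G) = ENNReal.ofReal q ^ 2 * sqNorm 1 (γ - r) (cv F G) := by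
  have := measurable_cv hF hG
  unfold sqNorm majB
  rw [← lintegral_const_mul _ (by fun_prop)]
  refine lintegral_congr fun ξ => ?_
  rw [sub_eq_add_neg, lw_add one_pos]; ring

lemma gw_mul_le (t : ℝ) (ξ η : V3) : gw t η * gw t (ξ - η) ≤ gw t ξ := by
  rw [gw, gw, gw, ← ENNReal.ofReal_mul (by positivity), ← Real.exp_add]
  refine ENNReal.ofReal_le_ofReal (Real.exp_le_exp.2 ?_)
  nlinarith [en_le_add_sub ξ η, Real.sqrt_nonneg t]

lemma cv_gw_le {t : ℝ} {f g F G : V3 → ℝ≥0∞} (hf : ∀ ξ, f ξ ≤ gw t ξ * F ξ)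
    (hg : ∀ ξ, g ξ ≤ gw t ξ * G ξ) (ξ : V3) : cv f g ξ ≤ gw t ξ * cv F G ξ := by
  unfold cv
  rw [← lintegral_const_mul' _ _ (gw_ne_top t ξ)]
  refine lintegral_mono fun η => ?_
  calc f η * g (ξ - η) ≤ (gw t η * F η) * (gw t (ξ - η) * G (ξ - η)) :=
        mul_le_mul' (hf _) (hg _)
    _ = (gw t η * gw t (ξ - η)) * (F η * G (ξ - η)) := by ring
    _ ≤ _ := by gcongr; exact gw_mul_le t ξ η

lemma sqrt_sub_sqrt_le {s t : ℝ} (hs : 0 ≤ s) (hst : s ≤ t) :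
    Real.sqrt t - Real.sqrt s ≤ Real.sqrt (t - s) := by
  rw [sub_le_iff_le_add]
  refine Real.sqrt_le_left (by positivity) |>.2 ?_
  have h1 := Real.sq_sqrt hs
  have h2 := Real.sq_sqrt (sub_nonneg.2 hst)
  nlinarith [mul_nonneg (Real.sqrt_nonneg s) (Real.sqrt_nonneg (t - s))]

lemma exp_quarter_le_two : Real.exp (1 / 4) ≤ 2 := by
  have h := Real.add_one_le_exp (-(1 / 4) : ℝ)
  have h2 : Real.exp (1 / 4) * Real.exp (-(1 / 4)) = 1 := by rw [← Real.exp_add]; norm_num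
  nlinarith [Real.exp_pos (1 / 4)]

lemma exists_lintegral_gw_le {r : ℝ} (hr : 0 ≤ r) (hr1 : r < 1) :
    ∃ C : ℝ, 0 < C ∧ ∀ T : ℝ, 0 < T → T ≤ 1 → ∀ t ≤ T, ∀ ξ,
      ∫⁻ s in Ioo 0 t, ENNReal.ofReal (en ξ * Real.exp (-((t - s) * en ξ ^ 2))) * gw s ξ
        ≤ gw t ξ * (ENNReal.ofReal (C * T ^ ((1 - r) / 2)) * lw 1 (-r) ξ) := by
  obtain ⟨C, hC, hCle⟩ := exists_lintegral_heat_kernel_le hr1 one_pos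
  refine ⟨4 * (C * Real.exp (5 / 4)), by positivity, fun T hT hT1 t ht ξ => ?_⟩
  have hx := en_nonneg ξ
  set x := en ξ with hxdef
  set a : ℝ := T ^ (-(1 / 2 : ℝ)) with ha
  have ha0 : 0 < a := by positivity
  have ha2 : a ^ 2 = T⁻¹ := by
    rw [ha, ← Real.rpow_natCast, ← Real.rpow_mul hT.le]; norm_num [Real.rpow_neg_one]
  have hpt : ∀ s ∈ Ioo 0 t, ENNReal.ofReal (x * Real.exp (-((t - s) * x ^ 2))) * gw s ξ
      ≤ (gw t ξ * lw 1 (-r) ξ * ENNReal.ofReal 4) *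
        (ENNReal.ofReal (6 * ((t - s) ^ (-((1 + r) / 2)) + a ^ (1 + r))
          * Real.exp ((t - s) * a ^ 2 / 4))
          * ENNReal.ofReal (Real.exp ((1 / 4 + 1) * (a ^ 2 * s)))) := by
    intro s hs
    set τ := t - s with hτdef
    have hτ : 0 < τ := sub_pos.2 hs.2
    have hτ1 : τ ≤ 1 := by linarith [hs.1]
    have hτT : τ ≤ T := by linarith [hs.1]
    rw [gw, gw, lw, ← hxdef, ← ENNReal.ofReal_mul (by positivity),
      ← ENNReal.ofReal_mul (by positivity),
      ← ENNReal.ofReal_mul (by positivity), ← ENNReal.ofReal_mul (by positivity),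
      ← ENNReal.ofReal_mul (by positivity)]
    refine ENNReal.ofReal_le_ofReal ?_
    set b : ℝ := τ ^ (-(1 / 2 : ℝ)) with hb
    have hb0 : 0 < b := by positivity
    have hb1 : 1 ≤ b := Real.one_le_rpow_of_pos_of_le_one_of_nonpos hτ hτ1 (by norm_num)
    have hbs : τ * b = Real.sqrt τ := by
      rw [hb, Real.sqrt_eq_rpow]
      nth_rewrite 1 [← Real.rpow_one τ]
      rw [← Real.rpow_add hτ]; norm_num
    have hb2 : τ * b ^ 2 = 1 := by
      rw [hb, ← Real.rpow_natCast, ← Real.rpow_mul hτ.le]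
      norm_num [Real.rpow_neg_one]; field_simp
    have hbr : b ^ (1 + r) = τ ^ (-((1 + r) / 2)) := by
      rw [hb, ← Real.rpow_mul hτ.le]; congr 1; ring
    have hk := heat_kernel_le (τ := τ) hb0 hr hr1.le hτ hx
    rw [hbr, mul_div_assoc, ← mul_div_assoc τ, hb2] at hk
    have hexp : Real.exp (-(τ * x ^ 2)) * Real.exp (-(Real.sqrt s * x))
        ≤ Real.exp (-(Real.sqrt t * x)) * Real.exp (-(τ * (x ^ 2 - b * x))) := by
      rw [← Real.exp_add, ← Real.exp_add]
      refine Real.exp_le_exp.2 ?_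
      have h1 := mul_le_mul_of_nonneg_right (sqrt_sub_sqrt_le hs.1.le hs.2.le) hx
      rw [← hτdef, ← hbs] at h1
      nlinarith
    have h1r : 0 < (1 + x) ^ r := by positivity
    have hlow : (1 + x) ^ r ≤ (b + x) ^ r := by gcongr
    set P := τ ^ (-((1 + r) / 2)) with hP
    have hP0 : 0 < P := by positivity
    have h24 : x * Real.exp (-(τ * (x ^ 2 - b * x))) ≤ (1 + x) ^ (-r) * (24 * P) := by
      rw [Real.rpow_neg (by positivity), le_inv_mul_iff₀ h1r]
      calc (1 + x) ^ r * (x * Real.exp (-(τ * (x ^ 2 - b * x))))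
          ≤ (b + x) ^ r * (x * Real.exp (-(τ * (x ^ 2 - b * x)))) := by gcongr
        _ = x * (b + x) ^ r * Real.exp (-(τ * (x ^ 2 - b * x))) := by ring
        _ ≤ 6 * (P + P) * 2 := hk.trans (by gcongr; exact exp_quarter_le_two)
        _ = 24 * P := by ring
    calc x * Real.exp (-(τ * x ^ 2)) * Real.exp (-(√s * x))
        = x * (Real.exp (-(τ * x ^ 2)) * Real.exp (-(√s * x))) := by ring
      _ ≤ x * (Real.exp (-(√t * x)) * Real.exp (-(τ * (x ^ 2 - b * x)))) := by gcongr
      _ = Real.exp (-(√t * x)) * (x * Real.exp (-(τ * (x ^ 2 - b * x)))) := by ring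
      _ ≤ Real.exp (-(√t * x)) * ((1 + x) ^ (-r) * (24 * P)) := by gcongr
      _ = Real.exp (-(√t * x)) * (1 + x) ^ (-r) * 4 * (6 * (P + 0) * 1 * 1) := by ring
      _ ≤ _ := by
          have hs0 := hs.1.le
          gcongr
          · positivity
          · exact Real.one_le_exp (by positivity)
          · exact Real.one_le_exp (by positivity)
  calc _ ≤ _ := setLIntegral_mono (by fun_prop) hpt
    _ = (gw t ξ * lw 1 (-r) ξ * ENNReal.ofReal 4) * _ := by
        rw [lintegral_const_mul _ (by fun_prop)]
    _ ≤ (gw t ξ * lw 1 (-r) ξ * ENNReal.ofReal 4)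
          * ENNReal.ofReal (C * T ^ ((1 - r) / 2) * Real.exp (5 / 4)) := by
        gcongr
        refine (hCle a t ha0).trans (ENNReal.ofReal_le_ofReal ?_)
        have e : a ^ (r - 1) = T ^ ((1 - r) / 2) := by
          rw [ha, ← Real.rpow_mul hT.le]; congr 1; ring
        rw [e]
        gcongr
        rw [ha2]
        have : T⁻¹ * t ≤ 1 := by rw [inv_mul_le_iff₀ hT]; linarith
        linarith
    _ = _ := by
        rw [mul_assoc, ← ENNReal.ofReal_mul (by norm_num), mul_assoc, mul_comm (lw 1 (-r) ξ)]
        congr 3; ring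

/-- Duhamel integrals of convolutions preserve Gevrey majorants. -/
lemma exists_lintegral_heat_cv_le {r : ℝ} (hr : 0 ≤ r) (hr1 : r < 1) {A : ℝ} (hA : 0 < A) :
    ∃ C : ℝ, 0 < C ∧ ∀ T : ℝ, 0 < T → T ≤ 1 → ∀ t ≤ T, ∀ ξ, ∀ f g : ℝ → V3 → ℝ≥0∞,
      ∀ F G : V3 → ℝ≥0∞, (∀ s ∈ Ioo 0 t, ∀ ξ, f s ξ ≤ gw s ξ * F ξ) →
      (∀ s ∈ Ioo 0 t, ∀ ξ, g s ξ ≤ gw s ξ * G ξ) →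
      ∫⁻ s in Ioo 0 t, ENNReal.ofReal (Real.exp (-((t - s) * en ξ ^ 2)))
          * (ENNReal.ofReal (A * en ξ) * cv (f s) (g s) ξ)
        ≤ gw t ξ * majB r (C * T ^ ((1 - r) / 2)) F G ξ := by
  obtain ⟨C, hC, hCle⟩ := exists_lintegral_gw_le hr hr1
  refine ⟨A * C, by positivity, fun T hT hT1 t ht ξ f g F G hf hg => ?_⟩
  have hx := en_nonneg ξ
  have hm : Measurable fun s : ℝ => gw s ξ := by unfold gw; fun_prop
  calc _ ≤ ∫⁻ s in Ioo 0 t, (ENNReal.ofReal A * cv F G ξ) *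
          (ENNReal.ofReal (en ξ * Real.exp (-((t - s) * en ξ ^ 2))) * gw s ξ) := by
        refine setLIntegral_mono (by fun_prop) fun s hs => ?_
        rw [ENNReal.ofReal_mul hA.le, ENNReal.ofReal_mul hx]
        calc _ ≤ ENNReal.ofReal (Real.exp (-((t - s) * en ξ ^ 2)))
              * (ENNReal.ofReal A * ENNReal.ofReal (en ξ) * (gw s ξ * cv F G ξ)) := by
              gcongr; exact cv_gw_le (hf s hs) (hg s hs) ξ
          _ = _ := by ring
    _ = (ENNReal.ofReal A * cv F G ξ) * ∫⁻ s in Ioo 0 t,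
          (ENNReal.ofReal (en ξ * Real.exp (-((t - s) * en ξ ^ 2))) * gw s ξ) :=
        lintegral_const_mul _ (by fun_prop)
    _ ≤ (ENNReal.ofReal A * cv F G ξ) *
          (gw t ξ * (ENNReal.ofReal (C * T ^ ((1 - r) / 2)) * lw 1 (-r) ξ)) := by
        gcongr; exact hCle T hT hT1 t ht ξ
    _ = _ := by
        rw [majB, mul_assoc A C, ENNReal.ofReal_mul hA.le]; ring

lemma iSup_mul_iSup_of_monotone {a b : ℕ → ℝ≥0∞} (ha : Monotone a) (hb : Monotone b) :
    (⨆ n, a n) * (⨆ n, b n) = ⨆ n, a n * b n := by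
  refine le_antisymm ?_ (iSup_le fun n => mul_le_mul' (le_iSup a n) (le_iSup b n))
  rw [ENNReal.iSup_mul]
  refine iSup_le fun m => ?_
  rw [ENNReal.mul_iSup]
  refine iSup_le fun n => le_trans ?_ (le_iSup (fun n => a n * b n) (max m n))
  exact mul_le_mul' (ha (le_max_left _ _)) (hb (le_max_right _ _))

/-- The iteration producing the majorant. -/
def majSeq (r q : ℝ) (m₀ : V3 → ℝ≥0∞) : ℕ → V3 → ℝ≥0∞
  | 0 => 0
  | n + 1 => fun ξ => m₀ ξ + majB r q (majSeq r q m₀ n) (majSeq r q m₀ n) ξ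

lemma measurable_majSeq (r q : ℝ) {m₀ : V3 → ℝ≥0∞} (hm : Measurable m₀) :
    ∀ n, Measurable (majSeq r q m₀ n)
  | 0 => measurable_const
  | n + 1 => hm.add (measurable_majB (measurable_majSeq r q hm n) (measurable_majSeq r q hm n))

lemma monotone_majSeq (r q : ℝ) (m₀ : V3 → ℝ≥0∞) (ξ : V3) :
    Monotone fun n => majSeq r q m₀ n ξ := by
  refine monotone_nat_of_le_succ fun n => ?_
  induction n generalizing ξ with
  | zero => exact bot_le
  | succ n ih => exact add_le_add le_rfl (majB_mono ih ih ξ)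

lemma exists_majorant {r q γ : ℝ} {K : ℝ≥0∞} (hK : ∀ F G : V3 → ℝ≥0∞, Measurable F →
      Measurable G → sqNorm 1 γ (majB r q F G) ≤ K * (sqNorm 1 γ F * sqNorm 1 γ G))
    {m₀ : V3 → ℝ≥0∞} (hm : Measurable m₀) (hsmall : 256 * (K * sqNorm 1 γ m₀) ≤ 1) :
    ∃ M : V3 → ℝ≥0∞, Measurable M ∧ (∀ ξ, m₀ ξ + majB r q M M ξ ≤ M ξ) ∧
      sqNorm 1 γ M ≤ 4 * sqNorm 1 γ m₀ := by
  set m := majSeq r q m₀ with hmdef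
  have hmm : ∀ n, Measurable (m n) := measurable_majSeq r q hm
  have hmono : ∀ ξ, Monotone fun n => m n ξ := monotone_majSeq r q m₀
  refine ⟨fun ξ => ⨆ n, m n ξ, Measurable.iSup hmm, fun ξ => ?_, ?_⟩
  · have hcv : cv (fun ξ => ⨆ n, m n ξ) (fun ξ => ⨆ n, m n ξ) ξ = ⨆ n, cv (m n) (m n) ξ := by
      unfold cv
      simp only [iSup_mul_iSup_of_monotone (hmono _) (hmono _)]
      refine lintegral_iSup (fun n => by have := hmm n; fun_prop) fun i j hij η => ?_
      exact mul_le_mul' (hmono _ hij) (hmono _ hij)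
    rw [majB, hcv, ENNReal.mul_iSup, ENNReal.mul_iSup, ENNReal.add_iSup]
    exact iSup_le fun n => le_iSup (fun n => m n ξ) (n + 1)
  · have hb : ∀ n, sqNorm 1 γ (m n) ≤ 4 * sqNorm 1 γ m₀ := fun n => by
      induction n with
      | zero => simp [sqNorm, hmdef, majSeq]
      | succ n ih =>
        calc sqNorm 1 γ (m (n + 1)) ≤ 2 * sqNorm 1 γ m₀ + 2 * sqNorm 1 γ (majB r q (m n) (m n)) :=
              sqNorm_add_le hm
          _ ≤ 2 * sqNorm 1 γ m₀ + 2 * (K * ((4 * sqNorm 1 γ m₀) * (4 * sqNorm 1 γ m₀))) := by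
              gcongr
              exact (hK _ _ (hmm n) (hmm n)).trans (by gcongr)
          _ = 2 * sqNorm 1 γ m₀ + 32 * (K * sqNorm 1 γ m₀) * sqNorm 1 γ m₀ := by ring
          _ ≤ 2 * sqNorm 1 γ m₀ + 1 * sqNorm 1 γ m₀ := by
              gcongr
              refine le_trans ?_ hsmall
              gcongr; norm_num
          _ ≤ 2 * sqNorm 1 γ m₀ + 2 * sqNorm 1 γ m₀ := by gcongr; norm_num
          _ = 4 * sqNorm 1 γ m₀ := by ring
    have : sqNorm 1 γ (fun ξ => ⨆ n, m n ξ) = ⨆ n, sqNorm 1 γ (m n) := by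
      unfold sqNorm
      have hmono' : ∀ ξ, Monotone fun n => lw 1 γ ξ * m n ξ := fun ξ i j hij => by
        dsimp only; gcongr; exact hmono ξ hij
      simp only [ENNReal.mul_iSup, sq, iSup_mul_iSup_of_monotone (hmono' _) (hmono' _)]
      refine lintegral_iSup (fun n => by have := hmm n; fun_prop) fun i j hij ξ => ?_
      exact mul_le_mul' (hmono' ξ hij) (hmono' ξ hij)
    rw [this]
    exact iSup_le hb

/-- The iteration controlling differences of Picard iterates. -/
def diffSeq (r q : ℝ) (M : V3 → ℝ≥0∞) : ℕ → V3 → ℝ≥0∞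
  | 0 => M
  | n + 1 => majB r q (fun ξ => M ξ + M ξ) (diffSeq r q M n)

lemma measurable_diffSeq (r q : ℝ) {M : V3 → ℝ≥0∞} (hm : Measurable M) :
    ∀ n, Measurable (diffSeq r q M n)
  | 0 => hm
  | n + 1 => measurable_majB (hm.add hm) (measurable_diffSeq r q hm n)

lemma ae_tsum_lt_top_of_sqNorm_le {γ : ℝ} (hγ : 0 ≤ γ) {d : ℕ → V3 → ℝ≥0∞}
    (hd : ∀ n, Measurable (d n)) {S : ℝ≥0∞} (hS : S < ⊤)
    (h : ∀ n, sqNorm 1 γ (d n) ≤ (1 / 16) ^ n * S) :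
    ∀ᵐ ξ, ∑' n, d n ξ < ⊤ := by
  have h_int : ∫⁻ ξ, ∑' n, 4 ^ n * (lw 1 γ ξ * d n ξ) ^ 2 < ⊤ := by
    rw [lintegral_tsum fun n => by have := hd n; fun_prop]
    calc _ ≤ ∑' n : ℕ, (1 / 4 : ℝ≥0∞) ^ n * S := by
          refine ENNReal.tsum_le_tsum fun n => ?_
          have := hd n
          rw [lintegral_const_mul _ (by fun_prop)]
          calc _ ≤ 4 ^ n * ((1 / 16) ^ n * S) := by gcongr; exact h n
            _ = _ := by
              rw [← mul_assoc, ← mul_pow]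
              congr 2
              rw [show (16 : ℝ≥0∞) = 4 * 4 by norm_num, one_div, one_div,
                ENNReal.mul_inv (by norm_num) (by norm_num), ← mul_assoc,
                ENNReal.mul_inv_cancel (by norm_num) (by norm_num), one_mul]
      _ < ⊤ := by
          rw [ENNReal.tsum_mul_right, ENNReal.tsum_geometric]
          refine ENNReal.mul_lt_top (ENNReal.inv_lt_top.2 (tsub_pos_of_lt ?_)) hS
          rw [one_div]; exact ENNReal.inv_lt_one.2 (by norm_num)
  have hm : Measurable fun ξ => ∑' n, 4 ^ n * (lw 1 γ ξ * d n ξ) ^ 2 :=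
    Measurable.tsum fun n => by have := hd n; fun_prop
  filter_upwards [ae_lt_top hm h_int.ne] with ξ hξ
  set B := ∑' n, 4 ^ n * (lw 1 γ ξ * d n ξ) ^ 2
  have hlw : 1 ≤ lw 1 γ ξ := by
    rw [lw, ENNReal.one_le_ofReal]
    exact Real.one_le_rpow (by linarith [en_nonneg ξ]) hγ
  have hn : ∀ n, d n ξ ≤ B ^ (1 / 2 : ℝ) * (1 / 2) ^ n := fun n => by
    have h1 : (2 ^ n * d n ξ) ^ 2 ≤ B := by
      refine le_trans ?_ (ENNReal.le_tsum n)
      rw [mul_pow, ← pow_mul, mul_comm n 2, pow_mul, show (2 : ℝ≥0∞) ^ 2 = 4 by norm_num]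
      gcongr
      exact le_mul_of_one_le_left bot_le hlw
    have h2 : 2 ^ n * d n ξ ≤ B ^ (1 / 2 : ℝ) := by
      calc 2 ^ n * d n ξ = ((2 ^ n * d n ξ) ^ 2) ^ (1 / 2 : ℝ) := by
            generalize 2 ^ n * d n ξ = y
            rw [← ENNReal.rpow_natCast, ← ENNReal.rpow_mul]; norm_num
        _ ≤ _ := by gcongr
    calc d n ξ = (2 ^ n * d n ξ) * (1 / 2) ^ n := by
          rw [mul_right_comm, ← mul_pow, one_div, ENNReal.mul_inv_cancel (by norm_num) (by norm_num)]
          simp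
      _ ≤ _ := by gcongr
  calc ∑' n, d n ξ ≤ ∑' n, B ^ (1 / 2 : ℝ) * (1 / 2) ^ n := ENNReal.tsum_le_tsum hn
    _ < ⊤ := by
        rw [ENNReal.tsum_mul_left, ENNReal.tsum_geometric]
        refine ENNReal.mul_lt_top (ENNReal.rpow_lt_top_of_nonneg (by norm_num) hξ.ne)
          (ENNReal.inv_lt_top.2 (tsub_pos_of_lt ?_))
        rw [one_div]; exact ENNReal.inv_lt_one.2 (by norm_num)

lemma ae_tsum_diffSeq_lt_top {r q γ : ℝ} (hγ : 0 ≤ γ) {K S : ℝ≥0∞}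
    (hK : ∀ F G : V3 → ℝ≥0∞, Measurable F →
      Measurable G → sqNorm 1 γ (majB r q F G) ≤ K * (sqNorm 1 γ F * sqNorm 1 γ G))
    {M : V3 → ℝ≥0∞} (hM : Measurable M) (hS : sqNorm 1 γ M ≤ S) (hS' : S < ⊤)
    (hsmall : 64 * (K * S) ≤ 1) :
    ∀ᵐ ξ, ∑' n, diffSeq r q M n ξ < ⊤ := by
  refine ae_tsum_lt_top_of_sqNorm_le hγ (measurable_diffSeq r q hM) hS' fun n => ?_
  induction n with
  | zero => simpa [diffSeq] using hS
  | succ n ih =>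
    refine (hK _ _ (hM.add hM) (measurable_diffSeq r q hM n)).trans ?_
    have h2 : sqNorm 1 γ (fun ξ => M ξ + M ξ) ≤ 4 * S := by
      refine (sqNorm_add_le hM).trans ?_
      calc _ ≤ 2 * S + 2 * S := by gcongr
        _ = _ := by ring
    calc _ ≤ K * ((4 * S) * ((1 / 16) ^ n * S)) := mul_le_mul' le_rfl (mul_le_mul' h2 ih)
      _ = (4 * (K * S)) * ((1 / 16) ^ n * S) := by ring
      _ ≤ (1 / 16) * ((1 / 16) ^ n * S) := by
          gcongr
          rw [one_div, ENNReal.le_inv_iff_mul_le]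
          calc 4 * (K * S) * 16 = 64 * (K * S) := by ring
            _ ≤ 1 := hsmall
      _ = _ := by ring

lemma duh_congr_ae (α : Coeffs) (U₀ : V3 → Fin 3 → ℂ) {U W : ℝ → V3 → Fin 3 → ℂ} {t : ℝ}
    (ht : 0 ≤ t) (h : ∀ s ∈ Icc 0 t, U s =ᵐ[volume] W s) (ξ : V3) :
    duh α U₀ U t ξ = duh α U₀ W t ξ := by
  ext j
  unfold duh
  congr 1
  refine intervalIntegral.integral_congr fun s hs => ?_
  rw [uIcc_of_le ht] at hs
  simp only [Qhat_congr_ae α (h s hs) ξ]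

lemma exp_heat_le_gw (t : ℝ) (ht : 0 ≤ t) (ξ : V3) :
    ENNReal.ofReal (Real.exp (-(t * en ξ ^ 2))) ≤ gw t ξ * 2 := by
  rw [gw, show (2 : ℝ≥0∞) = ENNReal.ofReal 2 by simp, ← ENNReal.ofReal_mul (Real.exp_nonneg _)]
  refine ENNReal.ofReal_le_ofReal ?_
  calc Real.exp (-(t * en ξ ^ 2)) ≤ Real.exp (-(√t * en ξ) + 1 / 4) := by
        refine Real.exp_le_exp.2 ?_
        nlinarith [sq_nonneg (√t * en ξ - 1 / 2), Real.sq_sqrt ht]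
    _ ≤ _ := by rw [Real.exp_add]; gcongr; exact exp_quarter_le_two

lemma exists_enorm_duh_le_gw (α : Coeffs) {r : ℝ} (hr : 0 ≤ r) (hr1 : r < 1) :
    ∃ C : ℝ, 0 < C ∧ ∀ (U₀ : V3 → Fin 3 → ℂ) (T : ℝ), 0 < T → T ≤ 1 → ∀ t ∈ Icc 0 T, ∀ ξ,
      ∀ M : V3 → ℝ≥0∞, ∀ U : ℝ → V3 → Fin 3 → ℂ,
      (∀ s ∈ Ioo 0 t, ∀ ξ, ‖U s ξ‖ₑ ≤ gw s ξ * M ξ) →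
      ‖duh α U₀ U t ξ‖ₑ ≤ gw t ξ * (2 * ‖U₀ ξ‖ₑ + majB r (C * T ^ ((1 - r) / 2)) M M ξ) ∧
      ∀ (W : ℝ → V3 → Fin 3 → ℂ) (d : V3 → ℝ≥0∞), MeasVF U → MeasVF W → cv M M ξ < ⊤ →
        (∀ s ∈ Ioo 0 t, ∀ ξ, ‖W s ξ‖ₑ ≤ gw s ξ * M ξ) →
        (∀ s ∈ Ioo 0 t, ∀ ξ, ‖U s ξ - W s ξ‖ₑ ≤ gw s ξ * d ξ) →
        ‖duh α U₀ U t ξ - duh α U₀ W t ξ‖ₑ ≤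
          gw t ξ * majB r (C * T ^ ((1 - r) / 2)) (fun ξ => M ξ + M ξ) d ξ := by
  obtain ⟨A, hA, hQ, hQd⟩ := exists_enorm_Qhat_le α
  obtain ⟨C, hC, hCle⟩ := exists_lintegral_heat_cv_le hr hr1 hA
  refine ⟨C, hC, fun U₀ T hT hT1 t ht ξ M U hU => ⟨?_, ?_⟩⟩
  · refine (enorm_duh_le α U₀ U ht.1 ξ).trans ?_
    rw [mul_add]
    refine add_le_add ?_ ?_
    · rw [← mul_assoc]; gcongr; exact exp_heat_le_gw t ht.1 ξ
    · refine le_trans (lintegral_mono fun s => ?_) (hCle T hT hT1 t ht.2 ξ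
        (fun s ξ => ‖U s ξ‖ₑ) (fun s ξ => ‖U s ξ‖ₑ) M M hU hU)
      exact mul_le_mul' le_rfl (hQ _ _ _)
  · intro W d hUm hWm hM hW hd
    have hB : ∀ U : ℝ → V3 → Fin 3 → ℂ, (∀ s ∈ Ioo 0 t, ∀ ξ, ‖U s ξ‖ₑ ≤ gw s ξ * M ξ) →
        ∀ s ∈ Ioo 0 t, cv (fun ξ => ‖U s ξ‖ₑ) (fun ξ => ‖U s ξ‖ₑ) ξ ≤ cv M M ξ :=
      fun U hU s hs => (cv_gw_le (hU s hs) (hU s hs) ξ).trans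
        (mul_le_of_le_one_left bot_le (gw_le_one s ξ))
    refine (enorm_duh_sub_le α U₀ hUm hWm ht.1 hM (hB U hU) (hB W hW)).trans ?_
    refine le_trans (setLIntegral_mono' measurableSet_Ioo fun s hs => ?_)
      (hCle T hT hT1 t ht.2 ξ (fun s ξ => ‖U s ξ‖ₑ + ‖W s ξ‖ₑ) (fun s ξ => ‖U s ξ - W s ξ‖ₑ)
        (fun ξ => M ξ + M ξ) d (fun s hs ξ => ?_) hd)
    · refine mul_le_mul' le_rfl (hQd _ _ _ (fun k => ?_) (fun k => ?_) ?_ ?_)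
      · exact hUm.comp measurable_const measurable_id k
      · exact hWm.comp measurable_const measurable_id k
      · exact (hB U hU s hs).trans_lt hM
      · exact (hB W hW s hs).trans_lt hM
    · rw [mul_add]; exact add_le_add (hU s hs ξ) (hW s hs ξ)

lemma majB_tsum {r q : ℝ} {F : V3 → ℝ≥0∞} (hF : Measurable F) {d : ℕ → V3 → ℝ≥0∞}
    (hd : ∀ n, Measurable (d n)) (ξ : V3) :
    majB r q F (fun ξ => ∑' n, d n ξ) ξ = ∑' n, majB r q F (d n) ξ := by
  unfold majB cv
  rw [ENNReal.tsum_mul_left, ENNReal.tsum_mul_left,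
    ← lintegral_tsum fun n => by have := hd n; fun_prop]
  simp only [ENNReal.tsum_mul_left]

/-- Picard iterates for the mild formulation on `[0,T]`. -/
def picard (α : Coeffs) (U₀ : V3 → Fin 3 → ℂ) (T : ℝ) : ℕ → ℝ → V3 → Fin 3 → ℂ
  | 0 => 0
  | n + 1 => (Icc 0 T).indicator (duh α U₀ (picard α U₀ T n))

lemma measVF_picard (α : Coeffs) {U₀ : V3 → Fin 3 → ℂ} (hU₀ : ∀ j, Measurable fun ξ => U₀ ξ j)
    (T : ℝ) : ∀ n, MeasVF (picard α U₀ T n)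
  | 0 => fun _ => measurable_const
  | n + 1 => measVF_duh α hU₀ (measVF_picard α hU₀ T n) T

lemma enorm_indicator_apply_le {S : Set ℝ} {F : ℝ → V3 → Fin 3 → ℂ} {t : ℝ} {ξ : V3} {c : ℝ≥0∞}
    (h : t ∈ S → ‖F t ξ‖ₑ ≤ c) : ‖S.indicator F t ξ‖ₑ ≤ c := by
  by_cases ht : t ∈ S
  · simpa [ht] using h ht
  · simp [ht]

/-- Contraction argument: convergence of the Picard iterates under a pointwise majorant. -/
lemma exists_mildSol_of_majorant (α : Coeffs) {U₀ : V3 → Fin 3 → ℂ}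
    (hU₀ : ∀ j, Measurable fun ξ => U₀ ξ j) {r q T : ℝ} {M : V3 → ℝ≥0∞}
    (hM : Measurable M) (hMM : ∀ ξ, cv M M ξ < ⊤)
    (hmaj : ∀ ξ, 2 * ‖U₀ ξ‖ₑ + majB r q M M ξ ≤ M ξ)
    (hsum : ∀ᵐ ξ, ∑' n, diffSeq r q M n ξ < ⊤)
    (hduh : ∀ t ∈ Icc 0 T, ∀ ξ, ∀ U : ℝ → V3 → Fin 3 → ℂ,
      (∀ s ∈ Ioo 0 t, ∀ ξ, ‖U s ξ‖ₑ ≤ gw s ξ * M ξ) →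
      ‖duh α U₀ U t ξ‖ₑ ≤ gw t ξ * (2 * ‖U₀ ξ‖ₑ + majB r q M M ξ) ∧
      ∀ (W : ℝ → V3 → Fin 3 → ℂ) (d : V3 → ℝ≥0∞), MeasVF U → MeasVF W → cv M M ξ < ⊤ →
        (∀ s ∈ Ioo 0 t, ∀ ξ, ‖W s ξ‖ₑ ≤ gw s ξ * M ξ) →
        (∀ s ∈ Ioo 0 t, ∀ ξ, ‖U s ξ - W s ξ‖ₑ ≤ gw s ξ * d ξ) →
        ‖duh α U₀ U t ξ - duh α U₀ W t ξ‖ₑ ≤ gw t ξ * majB r q (fun ξ => M ξ + M ξ) d ξ) :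
    ∃ U : ℝ → V3 → Fin 3 → ℂ, MeasVF U ∧ IsMildSol α U₀ U T ∧
      ∀ t ∈ Icc 0 T, ∀ ξ, ‖U t ξ‖ₑ ≤ gw t ξ * M ξ := by
  set P := picard α U₀ T with hP
  set d := diffSeq r q M with hd
  have hdm : ∀ n, Measurable (d n) := measurable_diffSeq r q hM
  have hPm : ∀ n, MeasVF (P n) := measVF_picard α hU₀ T
  have hPM : ∀ n t ξ, ‖P n t ξ‖ₑ ≤ gw t ξ * M ξ := fun n => by
    induction n with
    | zero => intro t ξ; simp [hP, picard]
    | succ n ih =>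
      intro t ξ
      refine enorm_indicator_apply_le fun ht => ?_
      refine (hduh t ht ξ (P n) fun s _ ξ => ih s ξ).1.trans ?_
      gcongr; exact hmaj ξ
  have hPd : ∀ n t ξ, ‖P n t ξ - P (n + 1) t ξ‖ₑ ≤ gw t ξ * d n ξ := fun n => by
    induction n with
    | zero =>
      intro t ξ
      have : P 0 t ξ = 0 := rfl
      rw [this, zero_sub, enorm_neg]; exact hPM 1 t ξ
    | succ n ih =>
      intro t ξ
      have : P (n + 1) t ξ - P (n + 2) t ξ
          = (Icc 0 T).indicator (fun t ξ => duh α U₀ (P n) t ξ - duh α U₀ (P (n + 1)) t ξ) t ξ := by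
        by_cases ht : t ∈ Icc 0 T <;> simp [hP, picard, ht]
      rw [this]
      refine enorm_indicator_apply_le fun ht => ?_
      exact (hduh t ht ξ (P n) fun s _ ξ => hPM n s ξ).2 (P (n + 1)) (d n) (hPm n) (hPm (n + 1))
        (hMM ξ) (fun s _ ξ => hPM _ s ξ) (fun s _ ξ => ih s ξ)
  set G : Set V3 := {ξ | ∑' n, d n ξ < ⊤} with hG
  have hGm : MeasurableSet G := measurableSet_lt (Measurable.tsum hdm) measurable_const
  set V : ℕ → ℝ → V3 → Fin 3 → ℂ := fun n t => G.indicator (P n t) with hV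
  have hVm : ∀ n, MeasVF (V n) := fun n j => by
    have : (Function.uncurry fun t ξ => V n t ξ j)
        = {p : ℝ × V3 | p.2 ∈ G}.indicator (Function.uncurry fun t ξ => P n t ξ j) := by
      ext ⟨t, ξ⟩
      by_cases h : ξ ∈ G <;> simp [hV, h, Function.uncurry, indicator]
    rw [this]
    exact (hPm n j).indicator (measurable_snd hGm)
  have hVM : ∀ n t ξ, ‖V n t ξ‖ₑ ≤ gw t ξ * M ξ := fun n t ξ => by
    by_cases h : ξ ∈ G
    · simpa [hV, h] using hPM n t ξ
    · simp [hV, h]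
  have hVd : ∀ t ξ n, edist (V n t ξ) (V (n + 1) t ξ) ≤ G.indicator 1 ξ * (gw t ξ * d n ξ) :=
    fun t ξ n => by
    by_cases h : ξ ∈ G
    · simpa [hV, h, edist_eq_enorm_sub] using hPd n t ξ
    · simp [hV, h]
  have hsumV : ∀ t ξ, ∑' n, G.indicator 1 ξ * (gw t ξ * d n ξ) ≠ ⊤ := fun t ξ => by
    by_cases h : ξ ∈ G
    · simp only [h, indicator_of_mem, Pi.one_apply, one_mul]
      rw [ENNReal.tsum_mul_left]
      exact ENNReal.mul_ne_top (gw_ne_top t ξ) (ne_of_lt h)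
    · simp [h]
  have hlim : ∀ t ξ, ∃ l, Tendsto (fun n => V n t ξ) atTop (𝓝 l) := fun t ξ =>
    cauchySeq_tendsto_of_complete (cauchySeq_of_edist_le_of_tsum_ne_top _ (hVd t ξ) (hsumV t ξ))
  choose Z hZ using hlim
  have hZm : MeasVF Z := fun j => by
    refine measurable_of_tendsto_metrizable (fun n => hVm n j) ?_
    refine tendsto_pi_nhds.2 fun p => ?_
    exact (tendsto_pi_nhds.1 (hZ p.1 p.2)) j
  have hZM : ∀ t ξ, ‖Z t ξ‖ₑ ≤ gw t ξ * M ξ := fun t ξ =>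
    le_of_tendsto ((continuous_enorm.tendsto _).comp (hZ t ξ)) (Eventually.of_forall fun n => hVM n t ξ)
  have hZd : ∀ n t ξ, ‖Z t ξ - V n t ξ‖ₑ ≤ gw t ξ * ∑' m, d (n + m) ξ := fun n t ξ => by
    rw [← edist_eq_enorm_sub, edist_comm, ← ENNReal.tsum_mul_left]
    refine (edist_le_tsum_of_edist_le_of_tendsto _ (hVd t ξ) (hZ t ξ) n).trans ?_
    refine ENNReal.tsum_le_tsum fun m => mul_le_of_le_one_left bot_le ?_
    by_cases h : ξ ∈ G <;> simp [h]
  have hfix : ∀ t ∈ Icc 0 T, ∀ ξ ∈ G, Z t ξ = duh α U₀ Z t ξ := fun t ht ξ hξ => by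
    have h1 : ∀ n, edist (V (n + 1) t ξ) (duh α U₀ Z t ξ) ≤ ∑' m, d (m + (n + 1)) ξ := fun n => by
      have e1 : V (n + 1) t ξ = duh α U₀ (V n) t ξ := by
        have : V (n + 1) t ξ = duh α U₀ (P n) t ξ := by simp [hV, hξ, hP, picard, ht]
        rw [this]
        refine duh_congr_ae α U₀ ht.1 (fun s _ => ?_) ξ
        filter_upwards [hsum] with η hη
        have : η ∈ G := hη
        simp [hV, this]
      rw [e1, edist_comm, edist_eq_enorm_sub]
      refine ((hduh t ht ξ Z fun s _ ξ => hZM s ξ).2 (V n) _ hZm (hVm n) (hMM ξ)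
        (fun s _ ξ => hVM n s ξ) (fun s _ ξ => hZd n s ξ)).trans ?_
      refine (mul_le_of_le_one_left bot_le (gw_le_one t ξ)).trans ?_
      rw [majB_tsum (F := fun ξ => M ξ + M ξ) (hM.add hM) fun m => hdm (n + m)]
      refine ENNReal.tsum_le_tsum fun m => ?_
      rw [show m + (n + 1) = (n + m) + 1 by ring]
      exact le_rfl
    have h2 : Tendsto (fun n => ∑' m, d (m + (n + 1)) ξ) atTop (𝓝 0) :=
      (tendsto_add_atTop_iff_nat (f := fun n => ∑' m, d (m + n) ξ) 1).2
        (ENNReal.tendsto_sum_nat_add _ (ne_of_lt hξ))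
    have h3 : Tendsto (fun n => V (n + 1) t ξ) atTop (𝓝 (duh α U₀ Z t ξ)) :=
      tendsto_iff_edist_tendsto_0.2
        (tendsto_of_tendsto_of_tendsto_of_le_of_le tendsto_const_nhds h2 (fun _ => bot_le) h1)
    exact tendsto_nhds_unique ((tendsto_add_atTop_iff_nat 1).2 (hZ t ξ)) h3
  refine ⟨(Icc 0 T).indicator (duh α U₀ Z), measVF_duh α hU₀ hZm T,
    isMildSol_iff.2 fun t ht ξ => ?_, fun t ht ξ => enorm_indicator_apply_le fun _ =>
    (hduh t ht ξ Z fun s _ ξ => hZM s ξ).1.trans (by gcongr; exact hmaj ξ)⟩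
  rw [indicator_of_mem ht]
  refine duh_congr_ae α U₀ ht.1 (fun s hs => ?_) ξ
  have hs' : s ∈ Icc 0 T := ⟨hs.1, hs.2.trans ht.2⟩
  filter_upwards [hsum] with η hη
  rw [indicator_of_mem hs']
  exact hfix s hs' η hη

/-- Local existence of a mild solution with an integrable pointwise majorant. -/
lemma exists_mildSol (α : Coeffs) {γ r : ℝ} (hγ : 0 ≤ γ) (hr : 0 ≤ r) (hr1 : r < 1)
    (hrγ : 3 / 2 < r + γ) {U₀ : V3 → Fin 3 → ℂ} (hU₀ : ∀ j, Measurable fun ξ => U₀ ξ j)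
    (hH : sqNorm 1 γ (fun ξ => ‖U₀ ξ‖ₑ) < ⊤) :
    ∃ T : ℝ, 0 < T ∧ T ≤ 1 ∧ ∃ U : ℝ → V3 → Fin 3 → ℂ, MeasVF U ∧ IsMildSol α U₀ U T ∧
      ∃ M : V3 → ℝ≥0∞, Measurable M ∧ sqNorm 1 γ M < ⊤ ∧
        ∀ t ∈ Icc 0 T, ∀ ξ, ‖U t ξ‖ₑ ≤ gw t ξ * M ξ := by
  obtain ⟨C, hC, hduh⟩ := exists_enorm_duh_le_gw α hr hr1
  obtain ⟨D, hD, hDle⟩ := exists_sqNorm_cv_le hr hγ hrγ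
  have hUm : Measurable fun ξ => ‖U₀ ξ‖ₑ := (measurable_pi_iff.2 hU₀).enorm
  set m₀ : V3 → ℝ≥0∞ := fun ξ => 2 * ‖U₀ ξ‖ₑ with hm₀
  have hm₀m : Measurable m₀ := hUm.const_mul _
  have hS : sqNorm 1 γ m₀ < ⊤ := by
    rw [hm₀, sqNorm_const_mul _ hUm]
    exact ENNReal.mul_lt_top (by simp) hH
  set S := sqNorm 1 γ m₀ with hSdef
  -- choice of the existence time
  obtain ⟨T, hT, hT1, hsmall⟩ : ∃ T : ℝ, 0 < T ∧ T ≤ 1 ∧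
      256 * (ENNReal.ofReal (C * T ^ ((1 - r) / 2)) ^ 2 * ENNReal.ofReal D * S) ≤ 1 := by
    set y := 256 * C ^ 2 * D * S.toReal + 1 with hy
    have hy0 : 0 < y := by positivity
    have hy1 : 1 ≤ y := by rw [hy]; have : 0 ≤ 256 * C ^ 2 * D * S.toReal := by positivity
                           linarith
    refine ⟨y ^ (-(1 / (1 - r))), by positivity,
      Real.rpow_le_one_of_one_le_of_nonpos hy1 (by
        have : 0 < 1 / (1 - r) := by have := sub_pos.2 hr1; positivity
        linarith), ?_⟩
    rw [← ENNReal.ofReal_toReal hS.ne, ← ENNReal.ofReal_pow (by positivity),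
      ← ENNReal.ofReal_mul (by positivity), ← ENNReal.ofReal_mul (by positivity),
      show (256 : ℝ≥0∞) = ENNReal.ofReal 256 by simp, ← ENNReal.ofReal_mul (by norm_num),
      ENNReal.ofReal_le_one]
    have e1 : ((y ^ (-(1 / (1 - r)))) ^ ((1 - r) / 2)) ^ 2 = y⁻¹ := by
      rw [← Real.rpow_natCast, ← Real.rpow_mul hy0.le, ← Real.rpow_mul hy0.le, ← Real.rpow_neg_one]
      congr 1
      have : 1 - r ≠ 0 := by linarith
      push_cast; field_simp
    rw [mul_pow, e1]
    rw [show 256 * (C ^ 2 * y⁻¹ * D * S.toReal) = (256 * C ^ 2 * D * S.toReal) / y by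
      field_simp, div_le_one hy0]
    linarith
  set q := C * T ^ ((1 - r) / 2) with hq
  have hK : ∀ F G : V3 → ℝ≥0∞, Measurable F → Measurable G →
      sqNorm 1 γ (majB r q F G) ≤ (ENNReal.ofReal q ^ 2 * ENNReal.ofReal D)
        * (sqNorm 1 γ F * sqNorm 1 γ G) := fun F G hF hG => by
    rw [sqNorm_majB hF hG, mul_assoc]
    gcongr
    simpa using hDle 1 one_pos F G hF hG
  obtain ⟨M, hM, hmaj, hMS⟩ := exists_majorant hK hm₀m hsmall
  have hM4 : sqNorm 1 γ M < ⊤ := hMS.trans_lt (ENNReal.mul_lt_top (by simp) hS)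
  have hL2 : ∫⁻ ξ, M ξ ^ 2 < ⊤ := by
    refine lt_of_le_of_lt (lintegral_mono fun ξ => ?_) hM4
    have hlw : 1 ≤ lw 1 γ ξ := by
      rw [lw, ENNReal.one_le_ofReal]
      exact Real.one_le_rpow (by linarith [en_nonneg ξ]) hγ
    dsimp only
    gcongr
    exact le_mul_of_one_le_left bot_le hlw
  have hMM : ∀ ξ, cv M M ξ < ⊤ := fun ξ => by
    have := (cv_sq_le hM hM ξ).trans_lt (ENNReal.mul_lt_top hL2 hL2)
    exact (ENNReal.pow_lt_top_iff.1 this).resolve_right (by norm_num)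
  have hsum := ae_tsum_diffSeq_lt_top hγ hK hM hMS (ENNReal.mul_lt_top (by simp) hS) (by
    refine le_trans (le_of_eq ?_) hsmall; ring)
  obtain ⟨U, h1, h2, h3⟩ := exists_mildSol_of_majorant α hU₀ hM hMM hmaj hsum
    (fun t ht ξ U hU => hduh U₀ T hT hT1 t ht ξ M U hU)
  exact ⟨T, hT, hT1, U, h1, h2, M, hM, hM4, h3⟩

lemma one_le_lw_one {γ : ℝ} (hγ : 0 ≤ γ) (ξ : V3) : 1 ≤ lw 1 γ ξ := by
  rw [lw, ENNReal.one_le_ofReal]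
  exact Real.one_le_rpow (by linarith [en_nonneg ξ]) hγ

lemma lintegral_sq_le_sqNorm {γ : ℝ} (hγ : 0 ≤ γ) (f : V3 → ℝ≥0∞) :
    ∫⁻ ξ, f ξ ^ 2 ≤ sqNorm 1 γ f := by
  refine lintegral_mono fun ξ => ?_
  dsimp only
  gcongr
  exact le_mul_of_one_le_left bot_le (one_le_lw_one hγ ξ)

lemma cv_lt_top_of_sqNorm {γ : ℝ} (hγ : 0 ≤ γ) {f g : V3 → ℝ≥0∞} (hf : Measurable f)
    (hg : Measurable g) (hf' : sqNorm 1 γ f < ⊤) (hg' : sqNorm 1 γ g < ⊤) (ξ : V3) :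
    cv f g ξ < ⊤ := by
  have := (cv_sq_le hf hg ξ).trans_lt (ENNReal.mul_lt_top
    ((lintegral_sq_le_sqNorm hγ f).trans_lt hf') ((lintegral_sq_le_sqNorm hγ g).trans_lt hg'))
  exact (ENNReal.pow_lt_top_iff.1 this).resolve_right (by norm_num)

lemma IsMildSol.continuousOn {α : Coeffs} {U₀ : V3 → Fin 3 → ℂ} {U : ℝ → V3 → Fin 3 → ℂ} {T : ℝ}
    (h : IsMildSol α U₀ U T) (hU : MeasVF U) {M : V3 → ℝ≥0∞} (hMM : ∀ ξ, cv M M ξ < ⊤)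
    (hM : ∀ t ∈ Icc 0 T, ∀ ξ, ‖U t ξ‖ₑ ≤ M ξ) (ξ : V3) :
    ContinuousOn (fun t => U t ξ) (Icc 0 T) := by
  rcases lt_or_ge T 0 with hT | hT
  · simp [Icc_eq_empty_of_lt hT]
  refine continuousOn_pi.2 fun j => ?_
  have h_int : IntegrableOn (fun s => Qhat α (U s) (U s) ξ j) (Ioo 0 T) :=
    integrableOn_Qhat α hU (hMM ξ) (fun s hs => cv_mono (hM s ⟨hs.1.le, hs.2.le⟩)
      (hM s ⟨hs.1.le, hs.2.le⟩) ξ) j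
  have hint2 : IntegrableOn (fun s => (Real.exp (s * en ξ ^ 2) : ℂ) * Qhat α (U s) (U s) ξ j)
      (uIcc 0 T) := by
    rw [uIcc_of_le hT, integrableOn_Icc_iff_integrableOn_Ioo]
    refine h_int.bdd_mul (c := Real.exp (T * en ξ ^ 2))
      (by fun_prop : Measurable fun s : ℝ =>
        (Real.exp (s * en ξ ^ 2) : ℂ)).aestronglyMeasurable ?_
    refine (ae_restrict_mem measurableSet_Ioo).mono fun s hs => ?_
    rw [Complex.norm_real, Real.norm_eq_abs, Real.abs_exp]
    exact Real.exp_le_exp.2 (by have := hs.2.le; gcongr)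
  have hc := intervalIntegral.continuousOn_primitive_interval hint2
  rw [uIcc_of_le hT] at hc
  have : ContinuousOn (fun t => (Real.exp (-(t * en ξ ^ 2)) : ℂ) * (U₀ ξ j +
      ∫ s in (0 : ℝ)..t, (Real.exp (s * en ξ ^ 2) : ℂ) * Qhat α (U s) (U s) ξ j)) (Icc 0 T) :=
    ContinuousOn.mul (by fun_prop) (continuousOn_const.add hc)
  refine this.congr fun t ht => ?_
  rw [h t ht ξ j]
  dsimp only
  rw [mul_add, ← intervalIntegral.integral_const_mul]
  congr 1
  refine intervalIntegral.integral_congr fun s _ => ?_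
  rw [← mul_assoc, ← Complex.ofReal_mul, ← Real.exp_add]
  congr 3; ring_nf

lemma continuousOn_lintegral_of_dominated {F : ℝ → V3 → ℝ≥0∞} {S : Set ℝ} {B : V3 → ℝ≥0∞}
    (hF : ∀ s, Measurable (F s)) (hB : ∫⁻ ξ, B ξ < ⊤) (hFB : ∀ s ∈ S, ∀ ξ, F s ξ ≤ B ξ)
    (hc : ∀ᵐ ξ, ContinuousOn (fun s => F s ξ) S) : ContinuousOn (fun s => ∫⁻ ξ, F s ξ) S := by
  intro t ht
  refine tendsto_lintegral_filter_of_dominated_convergence B (Eventually.of_forall hF) ?_ hB.ne ?_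
  · exact eventually_mem_nhdsWithin.mono fun s hs => Eventually.of_forall (hFB s hs)
  · exact hc.mono fun ξ h => h t ht

lemma continuous_vnSq : Continuous vnSq := by unfold vnSq; fun_prop

lemma measurable_wH (γ : ℝ) : Measurable (wH γ) := by unfold wH; fun_prop

lemma ofReal_wH_sq_mul_vnSq_le {γ : ℝ} (hγ : 0 ≤ γ) (ξ : V3) (v : Fin 3 → ℂ) :
    ENNReal.ofReal (wH γ ξ ^ 2 * vnSq v) ≤ 3 * (lw 1 γ ξ * ‖v‖ₑ) ^ 2 := by
  rw [ofReal_sq_mul_vnSq]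
  calc _ ≤ lw 1 γ ξ ^ 2 * (3 * ‖v‖ₑ ^ 2) := by
        gcongr
        · exact enorm_wH_le hγ ξ
        · exact vnSq_le_enorm_sq v
    _ = _ := by ring

lemma contInW_of_majorant {γ T : ℝ} (hγ : 0 ≤ γ) {U : ℝ → V3 → Fin 3 → ℂ} (hU : MeasVF U)
    {M : V3 → ℝ≥0∞} (hMm : Measurable M) (hMf : sqNorm 1 γ M < ⊤)
    (hM : ∀ t ∈ Icc 0 T, ∀ ξ, ‖U t ξ‖ₑ ≤ M ξ)
    (hc : ∀ ξ, ContinuousOn (fun t => U t ξ) (Icc 0 T)) : ContInW (wH γ) U T := by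
  refine ⟨fun t ht => ?_, fun t ht ε hε => ?_⟩
  · have h1 : wnorm (wH γ) (U t) ^ 2 < ⊤ :=
      (wnorm_wH_sq_le hγ _).trans_lt (ENNReal.mul_lt_top (by simp)
        ((sqNorm_mono (hM t ht)).trans_lt hMf))
    exact (ENNReal.pow_lt_top_iff.1 h1).resolve_right (by norm_num)
  · have hUt : ∀ t, Measurable (U t) := fun t => measurable_pi_iff.2
      fun j => hU.comp measurable_const measurable_id j
    have hcont := continuousOn_lintegral_of_dominated (S := Icc 0 T)
      (F := fun s ξ => ENNReal.ofReal (wH γ ξ ^ 2 * vnSq (U s ξ - U t ξ)))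
      (B := fun ξ => 3 * (lw 1 γ ξ * (M ξ + M ξ)) ^ 2) (fun s => ?_) ?_ (fun s hs ξ => ?_) ?_
    · have h0 := hcont t ht
      have hz : (∫⁻ ξ, ENNReal.ofReal (wH γ ξ ^ 2 * vnSq (U t ξ - U t ξ))) = 0 := by
        simp [vnSq]
      have h1 : Tendsto (fun s => wnorm (wH γ) (fun ξ j => U s ξ j - U t ξ j)) (𝓝[Icc 0 T] t)
          (𝓝 0) := by
        rw [ContinuousWithinAt, hz] at h0
        have := (ENNReal.continuous_rpow_const (y := (1 : ℝ) / 2)).continuousAt.tendsto.comp h0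
        rw [ENNReal.zero_rpow_of_pos (by norm_num)] at this
        exact this
      have h2 := h1.eventually (gt_mem_nhds hε)
      obtain ⟨d, hd, hd'⟩ := Metric.mem_nhdsWithin_iff.1 h2
      refine ⟨d, hd, fun s hs hst => hd' ⟨?_, hs⟩⟩
      rwa [Metric.mem_ball, Real.dist_eq]
    · have := hUt s
      have := hUt t
      have := measurable_wH γ
      have := continuous_vnSq.measurable
      fun_prop
    · have h4 := (sqNorm_add_le (b := 1) (σ := γ) (g := M) hMm).trans_lt (ENNReal.add_lt_top.2
        ⟨ENNReal.mul_lt_top (by simp) hMf, ENNReal.mul_lt_top (by simp) hMf⟩)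
      rw [lintegral_const_mul _ (by fun_prop)]
      exact ENNReal.mul_lt_top (by simp) h4
    · refine (ofReal_wH_sq_mul_vnSq_le hγ ξ _).trans ?_
      gcongr
      exact enorm_sub_le.trans (add_le_add (hM s hs ξ) (hM t ht ξ))
    · refine Eventually.of_forall fun ξ => ?_
      refine ENNReal.continuous_ofReal.comp_continuousOn (continuousOn_const.mul
        (continuous_vnSq.comp_continuousOn ((hc ξ).sub continuousOn_const)))

lemma lintegral_sq_mul_gw_sq_le (T : ℝ) (ξ : V3) :
    ∫⁻ t in Ioo 0 T, ENNReal.ofReal (en ξ) ^ 2 * gw t ξ ^ 2 ≤ 2 := by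
  rcases le_or_gt T 0 with hT | hT
  · simp [Ioo_eq_empty_of_le hT]
  set x := en ξ
  have hx : 0 ≤ x := en_nonneg ξ
  have hpos : ∀ t ∈ Icc 0 T, 0 < 1 + t * x ^ 2 / 2 := fun t ht => by
    have := ht.1; positivity
  have hder : ∀ t ∈ uIcc 0 T, HasDerivAt (fun t => -2 * (1 + t * x ^ 2 / 2)⁻¹)
      (x ^ 2 / (1 + t * x ^ 2 / 2) ^ 2) t := fun t ht => by
    rw [uIcc_of_le hT.le] at ht
    have h1 : HasDerivAt (fun t => 1 + t * x ^ 2 / 2) (1 * x ^ 2 / 2) t :=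
      (((hasDerivAt_id t).mul_const _).div_const _).const_add _
    refine ((h1.inv (hpos t ht).ne').const_mul (-2)).congr_deriv ?_
    ring
  have hcont : ContinuousOn (fun t => x ^ 2 / (1 + t * x ^ 2 / 2) ^ 2) (Icc 0 T) :=
    ContinuousOn.div (by fun_prop) (by fun_prop) fun t ht => pow_ne_zero _ (hpos t ht).ne'
  have h_int : IntervalIntegrable (fun t => x ^ 2 / (1 + t * x ^ 2 / 2) ^ 2) volume 0 T :=
    (uIcc_of_le hT.le ▸ hcont :
      ContinuousOn (fun t => x ^ 2 / (1 + t * x ^ 2 / 2) ^ 2) (uIcc 0 T)).intervalIntegrable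
  have hI := intervalIntegral.integral_eq_sub_of_hasDerivAt hder h_int
  calc _ ≤ ∫⁻ t in Ioo 0 T, ENNReal.ofReal (x ^ 2 / (1 + t * x ^ 2 / 2) ^ 2) := by
        refine setLIntegral_mono' measurableSet_Ioo fun t ht => ?_
        rw [gw, ← ENNReal.ofReal_pow hx, ← ENNReal.ofReal_pow (by positivity),
          ← ENNReal.ofReal_mul (by positivity)]
        refine ENNReal.ofReal_le_ofReal ?_
        have h1 := hpos t ⟨ht.1.le, ht.2.le⟩
        have h2 : 1 + t * x ^ 2 / 2 ≤ Real.exp (√t * x) := by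
          have hy : 0 ≤ √t * x := by positivity
          refine le_trans ?_ (Real.quadratic_le_exp_of_nonneg hy)
          rw [mul_pow, Real.sq_sqrt ht.1.le]; linarith
        rw [Real.exp_neg, inv_pow, div_eq_mul_inv]
        gcongr
    _ = ENNReal.ofReal (∫ t in Ioo 0 T, x ^ 2 / (1 + t * x ^ 2 / 2) ^ 2) := by
        refine (ofReal_integral_eq_lintegral_ofReal ?_ ?_).symm
        · rw [intervalIntegrable_iff_integrableOn_Ioo_of_le hT.le] at h_int
          exact h_int
        · exact Eventually.of_forall fun t => by positivity
    _ ≤ ENNReal.ofReal 2 := by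
        refine ENNReal.ofReal_le_ofReal ?_
        rw [← integral_Ioc_eq_integral_Ioo, ← intervalIntegral.integral_of_le hT.le, hI]
        have := hpos T ⟨hT.le, le_rfl⟩
        have h3 : 0 < (1 + T * x ^ 2 / 2)⁻¹ := by positivity
        norm_num
        linarith
    _ = 2 := by simp

lemma memL2W_of_majorant {γ T : ℝ} (hγ : 0 ≤ γ) {U : ℝ → V3 → Fin 3 → ℂ}
    {M : V3 → ℝ≥0∞} (hMm : Measurable M) (hMf : sqNorm 1 γ M < ⊤)
    (hM : ∀ t ∈ Icc 0 T, ∀ ξ, ‖U t ξ‖ₑ ≤ gw t ξ * M ξ) : MemL2W (wD (γ + 1)) U T := by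
  have hgw : Measurable (Function.uncurry gw) := by unfold gw Function.uncurry; fun_prop
  have hgw' : ∀ ξ, Measurable fun t => gw t ξ := fun ξ => by unfold gw; fun_prop
  have hw : ∀ ξ, ‖wD (γ + 1) ξ‖ₑ ≤ lw 1 γ ξ * ENNReal.ofReal (en ξ) := fun ξ => by
    have hx := en_nonneg ξ
    rw [wD, lw, ← ENNReal.ofReal_mul (by positivity), Real.enorm_eq_ofReal (by positivity),
      Real.rpow_add_one' hx (by linarith)]
    gcongr
    linarith
  calc _ ≤ ∫⁻ t in Ioo 0 T, ∫⁻ ξ, 3 * (lw 1 γ ξ * M ξ) ^ 2 *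
          (ENNReal.ofReal (en ξ) ^ 2 * gw t ξ ^ 2) := by
        refine setLIntegral_mono' measurableSet_Ioo fun t ht => ?_
        refine (wnorm_sq_le _ _).trans ?_
        rw [← lintegral_const_mul' _ _ (by simp)]
        refine lintegral_mono fun ξ => ?_
        calc 3 * (‖wD (γ + 1) ξ‖ₑ * ‖U t ξ‖ₑ) ^ 2
            ≤ 3 * ((lw 1 γ ξ * ENNReal.ofReal (en ξ)) * (gw t ξ * M ξ)) ^ 2 := by
              gcongr
              · exact hw ξ
              · exact hM t ⟨ht.1.le, ht.2.le⟩ ξ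
          _ = _ := by ring
    _ = ∫⁻ ξ, ∫⁻ t in Ioo 0 T, 3 * (lw 1 γ ξ * M ξ) ^ 2 *
          (ENNReal.ofReal (en ξ) ^ 2 * gw t ξ ^ 2) := by
        refine lintegral_lintegral_swap (Measurable.aemeasurable ?_)
        unfold Function.uncurry at hgw ⊢
        fun_prop
    _ ≤ ∫⁻ ξ, 6 * (lw 1 γ ξ * M ξ) ^ 2 := by
        refine lintegral_mono fun ξ => ?_
        have := hgw' ξ
        rw [lintegral_const_mul _ (by fun_prop)]
        calc _ ≤ 3 * (lw 1 γ ξ * M ξ) ^ 2 * 2 := by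
              gcongr; exact lintegral_sq_mul_gw_sq_le T ξ
          _ = _ := by ring
    _ < ⊤ := by
        rw [lintegral_const_mul _ (by fun_prop)]
        exact ENNReal.mul_lt_top (by simp) hMf

lemma measurable_uncurry_cv {f g : ℝ → V3 → ℝ≥0∞} (hf : Measurable (Function.uncurry f))
    (hg : Measurable (Function.uncurry g)) : Measurable (Function.uncurry fun s => cv (f s) (g s)) := by
  have h1 : Measurable fun q : (ℝ × V3) × V3 => f q.1.1 q.2 :=
    hf.comp (by fun_prop : Measurable fun q : (ℝ × V3) × V3 => (q.1.1, q.2))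
  have h2 : Measurable fun q : (ℝ × V3) × V3 => g q.1.1 (q.1.2 - q.2) :=
    hg.comp (by fun_prop : Measurable fun q : (ℝ × V3) × V3 => (q.1.1, q.1.2 - q.2))
  exact (h1.mul h2).lintegral_prod_right'

lemma MeasVF.measurable_apply {U : ℝ → V3 → Fin 3 → ℂ} (hU : MeasVF U) (t : ℝ) :
    Measurable (U t) :=
  measurable_pi_iff.2 fun j => hU.comp measurable_const measurable_id j

lemma exists_sqNorm_le_of_contInW {γ T : ℝ} (hγ : 0 ≤ γ) {W : ℝ → V3 → Fin 3 → ℂ}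
    (hW : MeasVF W) (h : ContInW (wH γ) W T) :
    ∃ N : ℝ≥0∞, N < ⊤ ∧ ∀ t ∈ Icc 0 T, sqNorm 1 γ (fun ξ => ‖W t ξ‖ₑ) ≤ N := by
  have hm : ∀ s t, Measurable fun ξ => ‖W s ξ - W t ξ‖ₑ := fun s t =>
    ((hW.measurable_apply s).sub (hW.measurable_apply t)).enorm
  have key : ∃ N : ℝ≥0∞, N < ⊤ ∧ ∀ t ∈ Icc 0 T ∩ Icc 0 T, sqNorm 1 γ (fun ξ => ‖W t ξ‖ₑ) ≤ N := by
    refine isCompact_Icc.induction_on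
      (p := fun S => ∃ N : ℝ≥0∞, N < ⊤ ∧ ∀ t ∈ S ∩ Icc 0 T, sqNorm 1 γ (fun ξ => ‖W t ξ‖ₑ) ≤ N)
      ⟨0, by simp, by simp⟩ ?_ ?_ ?_
    · rintro s t hst ⟨N, hN, hle⟩
      exact ⟨N, hN, fun u hu => hle u ⟨hst hu.1, hu.2⟩⟩
    · rintro s t ⟨N, hN, hle⟩ ⟨N', hN', hle'⟩
      refine ⟨N + N', ENNReal.add_lt_top.2 ⟨hN, hN'⟩, ?_⟩
      rintro u ⟨hu | hu, hu'⟩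
      · exact (hle u ⟨hu, hu'⟩).trans le_self_add
      · exact (hle' u ⟨hu, hu'⟩).trans le_add_self
    · intro t ht
      obtain ⟨d, hd, hlt⟩ := h.2 t ht 1 one_pos
      refine ⟨Metric.ball t d ∩ Icc 0 T,
        inter_mem (mem_nhdsWithin_of_mem_nhds (Metric.ball_mem_nhds t hd)) self_mem_nhdsWithin,
        2 * (ENNReal.ofReal (2 ^ γ) * 1 ^ 2)
          + 2 * (ENNReal.ofReal (2 ^ γ) * wnorm (wH γ) (W t) ^ 2), ?_, ?_⟩
      · have := h.1 t ht
        refine ENNReal.add_lt_top.2 ⟨ENNReal.mul_lt_top (by simp) (by simp),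
          ENNReal.mul_lt_top (by simp) (ENNReal.mul_lt_top (by simp) (ENNReal.pow_lt_top this))⟩
      · rintro s ⟨⟨hs, -⟩, hs'⟩
        rw [Metric.mem_ball, Real.dist_eq] at hs
        have h1 := hlt s hs' hs
        calc sqNorm 1 γ (fun ξ => ‖W s ξ‖ₑ)
            ≤ sqNorm 1 γ (fun ξ => ‖W s ξ - W t ξ‖ₑ + ‖W t ξ‖ₑ) :=
              sqNorm_mono fun ξ => by
                simpa using enorm_add_le (W s ξ - W t ξ) (W t ξ)
          _ ≤ 2 * sqNorm 1 γ (fun ξ => ‖W s ξ - W t ξ‖ₑ) + 2 * sqNorm 1 γ (fun ξ => ‖W t ξ‖ₑ) :=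
              sqNorm_add_le (hm s t)
          _ ≤ _ := by
              gcongr
              · refine (sqNorm_le_wnorm_wH hγ (fun ξ => W s ξ - W t ξ)).trans ?_
                gcongr
                exact h1.le
              · exact sqNorm_le_wnorm_wH hγ _
  simpa using key

lemma ae_eq_zero_of_sqNorm_eq_zero {γ : ℝ} (hγ : 0 ≤ γ) {f : V3 → ℝ≥0∞} (hf : Measurable f)
    (h : sqNorm 1 γ f = 0) : ∀ᵐ ξ, f ξ = 0 := by
  have h1 : ∫⁻ ξ, f ξ ^ 2 = 0 := le_antisymm ((lintegral_sq_le_sqNorm hγ f).trans h.le) bot_le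
  filter_upwards [(lintegral_eq_zero_iff (by fun_prop)).1 h1] with ξ hξ
  simpa using hξ

lemma exists_rate_small {r : ℝ} (hr1 : r < 1) {K : ℝ≥0∞} (hK : K < ⊤) (C : ℝ) :
    ∃ a : ℝ, 1 ≤ a ∧ ENNReal.ofReal (C * a ^ (r - 1)) ^ 2 * K ≤ 1 / 2 := by
  have h1 : Tendsto (fun a : ℝ => C * a ^ (r - 1)) atTop (𝓝 (C * 0)) := by
    have := tendsto_rpow_neg_atTop (sub_pos.2 hr1)
    rw [neg_sub] at this
    exact this.const_mul C
  have h2 : Tendsto (fun a : ℝ => ENNReal.ofReal (C * a ^ (r - 1)) ^ 2 * K) atTop (𝓝 0) := by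
    have := ENNReal.Tendsto.mul_const ((ENNReal.continuous_pow 2).continuousAt.tendsto.comp
      (ENNReal.tendsto_ofReal h1)) (b := K) (Or.inr hK.ne)
    simpa using this
  have h3 := h2.eventually (ge_mem_nhds (show (0 : ℝ≥0∞) < 1 / 2 by simp))
  obtain ⟨a, ha, ha'⟩ := (h3.and (eventually_ge_atTop 1)).exists
  exact ⟨a, ha', ha⟩

lemma measurable_duhamel {h : ℝ → V3 → ℝ≥0∞} (hh : Measurable (Function.uncurry h)) (a t : ℝ) :
    Measurable fun ξ => ∫⁻ s in Ioo 0 t,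
      ENNReal.ofReal (en ξ * Real.exp (-((t - s) * (en ξ ^ 2 - a * en ξ)))) * h s ξ := by
  have h1 : Measurable fun p : V3 × ℝ => h p.2 p.1 := hh.comp measurable_swap
  have : Measurable fun p : V3 × ℝ =>
      ENNReal.ofReal (en p.1 * Real.exp (-((t - p.2) * (en p.1 ^ 2 - a * en p.1)))) * h p.2 p.1 := by
    fun_prop
  exact this.lintegral_prod_right'

set_option maxHeartbeats 1000000 in
/-- Uniqueness of mild solutions that are bounded in `H^γ`. -/
lemma IsMildSol.unique {α : Coeffs} {γ r : ℝ} (hγ : 0 ≤ γ) (hr : 0 ≤ r) (hr1 : r < 1)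
    (hrγ : 3 / 2 < r + γ) {U₀ : V3 → Fin 3 → ℂ} {U W : ℝ → V3 → Fin 3 → ℂ} {T : ℝ}
    (hU : IsMildSol α U₀ U T) (hW : IsMildSol α U₀ W T) (hUm : MeasVF U) (hWm : MeasVF W)
    {N : ℝ≥0∞} (hN : N < ⊤) (hUN : ∀ t ∈ Icc 0 T, sqNorm 1 γ (fun ξ => ‖U t ξ‖ₑ) ≤ N)
    (hWN : ∀ t ∈ Icc 0 T, sqNorm 1 γ (fun ξ => ‖W t ξ‖ₑ) ≤ N) :
    ∀ t ∈ Icc 0 T, ∀ ξ, U t ξ = W t ξ := by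
  rw [isMildSol_iff] at hU hW
  obtain ⟨A, hA, -, hQ⟩ := exists_enorm_Qhat_le α
  obtain ⟨C, hC, hheat⟩ := exists_sqNorm_duhamel_le (c := 1 / 4) hr hr1 (by norm_num)
  obtain ⟨B, hB, hBle⟩ := exists_sqNorm_cv_le hr hγ hrγ
  have hN4 : 4 * N < ⊤ := ENNReal.mul_lt_top (by simp) hN
  obtain ⟨a, ha1, ha⟩ := exists_rate_small hr1
    (K := ENNReal.ofReal A ^ 2 * (ENNReal.ofReal B * (4 * N)))
    (ENNReal.mul_lt_top (by simp) (ENNReal.mul_lt_top (by simp) hN4)) C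
  have ha0 : 0 < a := by linarith
  have hUe : Measurable (Function.uncurry fun s ξ => ‖U s ξ‖ₑ) := hUm.measurable.enorm
  have hWe : Measurable (Function.uncurry fun s ξ => ‖W s ξ‖ₑ) := hWm.measurable.enorm
  set D : ℝ → V3 → ℝ≥0∞ := fun s ξ => ‖U s ξ - W s ξ‖ₑ with hD
  have hDm : Measurable (Function.uncurry D) := (hUm.measurable.sub hWm.measurable).enorm
  have hUs : ∀ s, Measurable fun ξ => ‖U s ξ‖ₑ := fun s => (hUm.measurable_apply s).enorm
  have hWs : ∀ s, Measurable fun ξ => ‖W s ξ‖ₑ := fun s => (hWm.measurable_apply s).enorm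
  have hDs : ∀ s, Measurable (D s) := fun s =>
    ((hUm.measurable_apply s).sub (hWm.measurable_apply s)).enorm
  set F : ℝ → V3 → ℝ≥0∞ := fun s ξ => ‖U s ξ‖ₑ + ‖W s ξ‖ₑ with hF
  have hFN : ∀ s ∈ Icc 0 T, sqNorm 1 γ (F s) ≤ 4 * N := fun s hs => by
    refine (sqNorm_add_le (hUs s)).trans ?_
    calc _ ≤ 2 * N + 2 * N := by
          gcongr
          · exact hUN s hs
          · exact hWN s hs
      _ = _ := by ring
  set S : ℝ≥0∞ := ⨆ s ∈ Icc 0 T,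
    ENNReal.ofReal (Real.exp (-((1 / 4 + 1 / 4) * (a ^ 2 * s)))) ^ 2 * sqNorm 1 γ (D s) with hS
  have hexp : ∀ s : ℝ, ENNReal.ofReal (Real.exp ((1 / 4 + 1 / 4) * (a ^ 2 * s)))
      * ENNReal.ofReal (Real.exp (-((1 / 4 + 1 / 4) * (a ^ 2 * s)))) = 1 := fun s => by
    rw [← ENNReal.ofReal_mul (Real.exp_nonneg _), ← Real.exp_add, add_neg_cancel, Real.exp_zero,
      ENNReal.ofReal_one]
  have hDF : ∀ s ∈ Icc 0 T, sqNorm 1 γ (D s) ≤ 4 * N := fun s hs =>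
    (sqNorm_mono fun ξ => enorm_sub_le).trans (hFN s hs)
  have hSlt : S < ⊤ := by
    refine lt_of_le_of_lt (iSup₂_le fun s hs => ?_) hN4
    refine (mul_le_of_le_one_left bot_le (pow_le_one' ?_ 2)).trans (hDF s hs)
    rw [ENNReal.ofReal_le_one, Real.exp_le_one_iff]
    have := mul_nonneg (sq_nonneg a) hs.1
    linarith
  have hDS : ∀ s ∈ Icc 0 T, sqNorm 1 γ (D s)
      ≤ ENNReal.ofReal (Real.exp ((1 / 4 + 1 / 4) * (a ^ 2 * s))) ^ 2 * S := fun s hs => by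
    calc sqNorm 1 γ (D s) = ENNReal.ofReal (Real.exp ((1 / 4 + 1 / 4) * (a ^ 2 * s))) ^ 2 *
          (ENNReal.ofReal (Real.exp (-((1 / 4 + 1 / 4) * (a ^ 2 * s)))) ^ 2 * sqNorm 1 γ (D s)) := by
          rw [← mul_assoc, ← mul_pow, hexp, one_pow, one_mul]
      _ ≤ _ := by
          gcongr
          exact le_iSup₂ (f := fun s (_ : s ∈ Icc 0 T) => ENNReal.ofReal
            (Real.exp (-((1 / 4 + 1 / 4) * (a ^ 2 * s)))) ^ 2 * sqNorm 1 γ (D s)) s hs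
  set h : ℝ → V3 → ℝ≥0∞ := fun s => cv (F s) (D s) with hh
  have hhm : Measurable (Function.uncurry h) := measurable_uncurry_cv (hUe.add hWe) hDm
  have hhs : ∀ s ∈ Icc 0 T, sqNorm 1 (γ - r) (h s)
      ≤ ENNReal.ofReal (Real.exp ((1 / 4 + 1 / 4) * (a ^ 2 * s))) ^ 2
        * (ENNReal.ofReal B * (4 * N) * S) := fun s hs => by
    have h1 := hBle 1 one_pos (F s) (D s) ((hUs s).add (hWs s)) (hDs s)
    rw [Real.one_rpow, mul_one] at h1
    calc _ ≤ _ := h1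
      _ ≤ ENNReal.ofReal B * ((4 * N) *
          (ENNReal.ofReal (Real.exp ((1 / 4 + 1 / 4) * (a ^ 2 * s))) ^ 2 * S)) := by
          gcongr
          · exact hFN s hs
          · exact hDS s hs
      _ = _ := by ring
  have hcvU : ∀ (V : ℝ → V3 → Fin 3 → ℂ), MeasVF V →
      (∀ t ∈ Icc 0 T, sqNorm 1 γ (fun ξ => ‖V t ξ‖ₑ) ≤ N) → ∀ s ∈ Icc 0 T, ∀ ξ,
      cv (fun ξ => ‖V s ξ‖ₑ) (fun ξ => ‖V s ξ‖ₑ) ξ ≤ N := fun V hVm hV s hs ξ => by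
    have h1 := cv_sq_le (hVm.measurable_apply s).enorm (hVm.measurable_apply s).enorm ξ
    have h2 := (lintegral_sq_le_sqNorm hγ (fun ξ => ‖V s ξ‖ₑ)).trans (hV s hs)
    have h3 := h1.trans (mul_le_mul' h2 h2)
    rw [← sq] at h3
    exact (ENNReal.pow_le_pow_left_iff two_ne_zero).1 h3
  have hDle : ∀ t ∈ Icc 0 T, ∀ ξ, D t ξ ≤ ENNReal.ofReal A * ∫⁻ s in Ioo 0 t,
      ENNReal.ofReal (en ξ * Real.exp (-((t - s) * (en ξ ^ 2 - a * en ξ)))) * h s ξ :=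
    fun t ht ξ => by
    have hx := en_nonneg ξ
    have hsub : ∀ s ∈ Ioo 0 t, s ∈ Icc 0 T := fun s hs => ⟨hs.1.le, hs.2.le.trans ht.2⟩
    rw [hD]
    dsimp only
    rw [hU t ht ξ, hW t ht ξ]
    refine (enorm_duh_sub_le α U₀ hUm hWm ht.1 hN (fun s hs => hcvU U hUm hUN s (hsub s hs) ξ)
      (fun s hs => hcvU W hWm hWN s (hsub s hs) ξ)).trans ?_
    rw [← lintegral_const_mul' _ _ ENNReal.ofReal_ne_top]
    refine setLIntegral_mono' measurableSet_Ioo fun s hs => ?_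
    have h1 := hQ (U s) (W s) ξ (fun k => hUm.comp measurable_const measurable_id k)
      (fun k => hWm.comp measurable_const measurable_id k)
      ((hcvU U hUm hUN s (hsub s hs) ξ).trans_lt hN) ((hcvU W hWm hWN s (hsub s hs) ξ).trans_lt hN)
    calc _ ≤ ENNReal.ofReal (Real.exp (-((t - s) * en ξ ^ 2))) *
          (ENNReal.ofReal (A * en ξ) * h s ξ) := by gcongr
      _ ≤ ENNReal.ofReal (Real.exp (-((t - s) * (en ξ ^ 2 - a * en ξ)))) *
          (ENNReal.ofReal (A * en ξ) * h s ξ) := by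
          gcongr
          · linarith [hs.2]
          · have := mul_nonneg ha0.le hx; linarith
      _ = _ := by
          rw [ENNReal.ofReal_mul hA.le, ENNReal.ofReal_mul hx]; ring
  clear_value h
  have hSle : S ≤ 1 / 2 * S := by
    refine iSup₂_le fun t ht => ?_
    have hm := measurable_duhamel hhm a t
    have h1 := hheat γ a 1 t one_pos ha1 h hhm (ENNReal.ofReal B * (4 * N) * S)
      (fun s hs => hhs s ⟨hs.1.le, hs.2.le.trans ht.2⟩)
    have h2 : sqNorm 1 γ (D t) ≤ ENNReal.ofReal A ^ 2 *
        (ENNReal.ofReal (C * a ^ (r - 1) * Real.exp ((1 / 4 + 1 / 4) * (a ^ 2 * t))) ^ 2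
          * (ENNReal.ofReal B * (4 * N) * S)) := by
      refine (sqNorm_mono (hDle t ht)).trans ?_
      rw [sqNorm_const_mul _ hm]
      gcongr
    rw [ENNReal.ofReal_mul (by positivity)] at h2
    refine (mul_le_mul' le_rfl h2).trans ?_
    calc _
        = (ENNReal.ofReal (Real.exp ((1 / 4 + 1 / 4) * (a ^ 2 * t)))
          * ENNReal.ofReal (Real.exp (-((1 / 4 + 1 / 4) * (a ^ 2 * t))))) ^ 2 *
          ((ENNReal.ofReal (C * a ^ (r - 1)) ^ 2 *
            (ENNReal.ofReal A ^ 2 * (ENNReal.ofReal B * (4 * N)))) * S) := by ring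
      _ ≤ 1 / 2 * S := by
          rw [hexp, one_pow, one_mul]; gcongr
  have hS0 : S = 0 := by
    by_contra h0
    have h1 : (1 / 2 : ℝ≥0∞) * S < S := by
      rw [one_div, ← ENNReal.div_eq_inv_mul]
      exact ENNReal.half_lt_self h0 hSlt.ne
    exact absurd hSle (not_le.2 h1)
  intro t ht ξ
  rw [hU t ht ξ, hW t ht ξ]
  refine duh_congr_ae α U₀ ht.1 (fun s hs => ?_) ξ
  have hs' : s ∈ Icc 0 T := ⟨hs.1, hs.2.trans ht.2⟩
  have h0 : sqNorm 1 γ (D s) = 0 := le_antisymm ((hDS s hs').trans (by simp [hS0])) bot_le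
  filter_upwards [ae_eq_zero_of_sqNorm_eq_zero hγ (hDs s) h0] with η hη
  simpa [hD, sub_eq_zero] using hη

lemma ofReal_exp_add (x y : ℝ) : ENNReal.ofReal (Real.exp (x + y))
    = ENNReal.ofReal (Real.exp x) * ENNReal.ofReal (Real.exp y) := by
  rw [Real.exp_add, ENNReal.ofReal_mul (Real.exp_nonneg _)]

lemma ofReal_exp_sq (x : ℝ) : ENNReal.ofReal (Real.exp x) ^ 2 = ENNReal.ofReal (Real.exp (2 * x)) := by
  rw [two_mul, ofReal_exp_add, sq]

lemma ofReal_exp_mono {x y : ℝ} (h : x ≤ y) :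
    ENNReal.ofReal (Real.exp x) ≤ ENNReal.ofReal (Real.exp y) :=
  ENNReal.ofReal_le_ofReal (Real.exp_le_exp.2 h)

/-- The truncated exponential weight `exp(a s min(|ξ|, R))`. -/
def tw (a R s : ℝ) (ξ : V3) : ℝ≥0∞ := ENNReal.ofReal (Real.exp (a * s * min (en ξ) R))

lemma measurable_uncurry_tw (a R : ℝ) : Measurable (Function.uncurry (tw a R)) := by
  unfold tw Function.uncurry; fun_prop

@[fun_prop]
lemma measurable_tw (a R s : ℝ) : Measurable (tw a R s) := by unfold tw; fun_prop

lemma tw_le_mul {a R s : ℝ} (ha : 0 ≤ a) (hR : 0 ≤ R) (hs : 0 ≤ s) (ξ η : V3) :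
    tw a R s ξ ≤ tw a R s η * tw a R s (ξ - η) := by
  rw [tw, tw, tw, ← ofReal_exp_add, ← mul_add]
  refine ofReal_exp_mono (mul_le_mul_of_nonneg_left ?_ (mul_nonneg ha hs))
  have h1 := en_le_add_sub ξ η
  have h2 := en_nonneg η
  have h3 := en_nonneg (ξ - η)
  rcases min_cases (en η) R with h | h <;> rcases min_cases (en (ξ - η)) R with h' | h' <;>
    rcases min_cases (en ξ) R with h'' | h'' <;> linarith

lemma tw_mul_cv_le {a R s : ℝ} (ha : 0 ≤ a) (hR : 0 ≤ R) (hs : 0 ≤ s) (f g : V3 → ℝ≥0∞) (ξ : V3) :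
    tw a R s ξ * cv f g ξ ≤ cv (fun ξ => tw a R s ξ * f ξ) (fun ξ => tw a R s ξ * g ξ) ξ := by
  unfold cv
  rw [← lintegral_const_mul' _ _ (show tw a R s ξ ≠ ⊤ from ENNReal.ofReal_ne_top)]
  refine lintegral_mono fun η => ?_
  calc tw a R s ξ * (f η * g (ξ - η)) ≤ (tw a R s η * tw a R s (ξ - η)) * (f η * g (ξ - η)) := by
        gcongr; exact tw_le_mul ha hR hs ξ η
    _ = _ := by ring

lemma measurableSet_le_en (ρ : ℝ) : MeasurableSet {ξ : V3 | ρ ≤ en ξ} :=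
  measurableSet_le measurable_const measurable_en

/-- Frequency splitting: at least one factor has a high frequency. -/
lemma cv_self_le_split {V : V3 → ℝ≥0∞} (hV : Measurable V) {ρ : ℝ} {ξ : V3} (hξ : 2 * ρ ≤ en ξ) :
    cv V V ξ ≤ 2 * cv ({ξ | ρ ≤ en ξ}ᶜ.indicator V) ({ξ | ρ ≤ en ξ}.indicator V) ξ
      + cv ({ξ | ρ ≤ en ξ}.indicator V) ({ξ | ρ ≤ en ξ}.indicator V) ξ := by
  set S : Set V3 := {ξ | ρ ≤ en ξ}
  have hS : MeasurableSet S := measurableSet_le_en ρ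
  have hL : Measurable (Sᶜ.indicator V) := hV.indicator hS.compl
  have hH : Measurable (S.indicator V) := hV.indicator hS
  rw [two_mul]
  nth_rewrite 3 [cv_comm]
  unfold cv
  rw [← lintegral_add_left (by fun_prop), ← lintegral_add_left (by fun_prop)]
  refine lintegral_mono fun η => ?_
  by_cases h1 : η ∈ S <;> by_cases h2 : ξ - η ∈ S
  · simp [h1, h2]
  · simp [h1, h2]
  · simp [h1, h2]
  · exfalso
    have h1' : en η < ρ := not_le.1 h1
    have h2' : en (ξ - η) < ρ := not_le.1 h2
    linarith [en_le_add_sub ξ η]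

/-- Product estimate for a low-frequency and a high-frequency factor. -/
lemma exists_sqNorm_split_le {γ r c : ℝ} (hr : 0 ≤ r) (hr1 : r < 1) (hγ : 0 ≤ γ)
    (hrγ : 3 / 2 < r + γ) (hc : 0 < c) (hc1 : c ≤ 1) :
    ∃ K : ℝ, 0 < K ∧ ∀ a : ℝ, 1 ≤ a → ∀ L H : V3 → ℝ≥0∞, Measurable L → Measurable H →
      (∀ ξ, c * a < en ξ → L ξ = 0) →
      sqNorm a (γ - r) (fun ξ => 2 * cv L H ξ + cv H H ξ) ≤ ENNReal.ofReal K *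
        (sqNorm 1 γ L * sqNorm a γ H
          + ENNReal.ofReal (a ^ (3 - 2 * (r + γ))) * sqNorm a γ H ^ 2) := by
  obtain ⟨D, hD, hDle⟩ := exists_sqNorm_cv_le hr hγ hrγ
  obtain ⟨d, hd0, hd⟩ : ∃ d : ℝ, 0 ≤ d ∧ decayInt (r + γ) = ENNReal.ofReal d :=
    ⟨_, ENNReal.toReal_nonneg, (ENNReal.ofReal_toReal (decayInt_lt_top hrγ).ne).symm⟩
  refine ⟨8 * 4 ^ γ * 4 * d + 2 * D, by positivity, fun a ha L H hL hH hsupp => ?_⟩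
  have ha0 : 0 < a := by linarith
  have h1 := sqNorm_cv_le_of_support ha0 hr hγ hL hH
    (fun ξ hξ => hsupp ξ (lt_of_le_of_lt (by nlinarith) hξ))
  have h2 := lintegral_sq_le_of_support (R := c * a) (r := r) (p := γ) (by positivity) hr hL hsupp
  have h3 := hDle a ha0 H H hH hH
  have h4 : ENNReal.ofReal (4 ^ γ * a ^ (-2 * r)) * ENNReal.ofReal ((1 + c * a) ^ (2 * r))
      ≤ ENNReal.ofReal (4 ^ γ * 4) := by
    rw [← ENNReal.ofReal_mul (by positivity), mul_assoc]
    refine ENNReal.ofReal_le_ofReal (mul_le_mul_of_nonneg_left ?_ (by positivity))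
    calc a ^ (-2 * r) * (1 + c * a) ^ (2 * r) ≤ a ^ (-2 * r) * (2 * a) ^ (2 * r) := by
          gcongr; nlinarith
      _ = 2 ^ (2 * r) := by
          rw [Real.mul_rpow (by norm_num) ha0.le, mul_left_comm, ← Real.rpow_add ha0]
          simp
      _ ≤ 2 ^ (2 : ℝ) := Real.rpow_le_rpow_of_exponent_le (by norm_num) (by linarith)
      _ = 4 := by norm_num
  have hm := measurable_cv hL hH
  calc _ ≤ 2 * sqNorm a (γ - r) (fun ξ => 2 * cv L H ξ) + 2 * sqNorm a (γ - r) (cv H H) :=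
        sqNorm_add_le (by fun_prop)
    _ ≤ 2 * (2 ^ 2 * (ENNReal.ofReal (4 ^ γ * a ^ (-2 * r)) *
          ((ENNReal.ofReal ((1 + c * a) ^ (2 * r)) * (decayInt (r + γ) * sqNorm 1 γ L))
            * sqNorm a γ H)))
        + 2 * (ENNReal.ofReal (D * a ^ (3 - 2 * (r + γ))) * (sqNorm a γ H * sqNorm a γ H)) := by
        rw [sqNorm_const_mul _ hm]
        gcongr
        refine h1.trans ?_
        gcongr
    _ = 8 * ((ENNReal.ofReal (4 ^ γ * a ^ (-2 * r)) * ENNReal.ofReal ((1 + c * a) ^ (2 * r)))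
            * ENNReal.ofReal d) * (sqNorm 1 γ L * sqNorm a γ H)
        + 2 * ENNReal.ofReal D * (ENNReal.ofReal (a ^ (3 - 2 * (r + γ))) * sqNorm a γ H ^ 2) := by
        rw [hd, ENNReal.ofReal_mul hD.le]; ring
    _ ≤ 8 * (ENNReal.ofReal (4 ^ γ * 4) * ENNReal.ofReal d) * (sqNorm 1 γ L * sqNorm a γ H)
        + 2 * ENNReal.ofReal D * (ENNReal.ofReal (a ^ (3 - 2 * (r + γ))) * sqNorm a γ H ^ 2) := by
        gcongr
    _ ≤ _ := by
        have h0 : 0 ≤ (4 : ℝ) ^ γ * d := by positivity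
        have h5 : 8 * (ENNReal.ofReal (4 ^ γ * 4) * ENNReal.ofReal d)
            ≤ ENNReal.ofReal (8 * 4 ^ γ * 4 * d + 2 * D) := by
          rw [show (8 : ℝ≥0∞) = ENNReal.ofReal 8 by simp, ← ENNReal.ofReal_mul (by positivity),
            ← ENNReal.ofReal_mul (by norm_num)]
          refine ENNReal.ofReal_le_ofReal ?_
          nlinarith
        have h6 : 2 * ENNReal.ofReal D ≤ ENNReal.ofReal (8 * 4 ^ γ * 4 * d + 2 * D) := by
          rw [show (2 : ℝ≥0∞) = ENNReal.ofReal 2 by simp, ← ENNReal.ofReal_mul (by norm_num)]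
          refine ENNReal.ofReal_le_ofReal ?_
          nlinarith
        exact (add_le_add (mul_le_mul' h5 le_rfl) (mul_le_mul' h6 le_rfl)).trans_eq
          (mul_add _ _ _).symm

lemma sqNorm_indicator {b σ : ℝ} {S : Set V3} (hS : MeasurableSet S) (f : V3 → ℝ≥0∞) :
    sqNorm b σ (S.indicator f) = ∫⁻ ξ in S, (lw b σ ξ * f ξ) ^ 2 := by
  rw [← lintegral_indicator hS]
  refine lintegral_congr fun ξ => ?_
  by_cases h : ξ ∈ S <;> simp [h]

lemma lw_le_of_le_en {γ a c : ℝ} (hγ : 0 ≤ γ) (ha : 0 < a) (hc : 0 < c) {ξ : V3}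
    (hξ : c * a ≤ en ξ) :
    lw a γ ξ ≤ ENNReal.ofReal ((1 / c + 1) ^ γ) * ENNReal.ofReal (en ξ ^ γ) := by
  have hx := en_nonneg ξ
  rw [lw, ← ENNReal.ofReal_mul (by positivity), ← Real.mul_rpow (by positivity) hx]
  refine ENNReal.ofReal_le_ofReal (Real.rpow_le_rpow (by positivity) ?_ hγ)
  rw [add_mul, one_mul]
  gcongr
  rw [one_div, ← div_eq_inv_mul, le_div_iff₀ hc]
  linarith

/-- A weighted high-frequency norm is controlled by the homogeneous one. -/
lemma sqNorm_indicator_add_le {γ a c : ℝ} (hγ : 0 ≤ γ) (ha : 0 < a) (hc : 0 < c)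
    {f g : V3 → ℝ≥0∞} (hf : Measurable f) (hg : Measurable g) {E : ℝ≥0∞}
    (hfE : ∫⁻ ξ in {ξ | c * a ≤ en ξ}, (ENNReal.ofReal (en ξ ^ γ) * f ξ) ^ 2 ≤ E)
    (hgE : ∫⁻ ξ in {ξ | c * a ≤ en ξ}, (ENNReal.ofReal (en ξ ^ γ) * g ξ) ^ 2 ≤ E) :
    sqNorm a γ ({ξ | c * a ≤ en ξ}.indicator fun ξ => f ξ + g ξ)
      ≤ ENNReal.ofReal ((1 / c + 1) ^ γ) ^ 2 * (4 * E) := by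
  rw [sqNorm_indicator (measurableSet_le_en _)]
  calc _ ≤ ∫⁻ ξ in {ξ | c * a ≤ en ξ}, ENNReal.ofReal ((1 / c + 1) ^ γ) ^ 2 *
        (2 * (ENNReal.ofReal (en ξ ^ γ) * f ξ) ^ 2 + 2 * (ENNReal.ofReal (en ξ ^ γ) * g ξ) ^ 2) := by
        refine setLIntegral_mono' (measurableSet_le_en _) fun ξ hξ => ?_
        calc _ ≤ ((ENNReal.ofReal ((1 / c + 1) ^ γ) * ENNReal.ofReal (en ξ ^ γ)) * (f ξ + g ξ)) ^ 2 := by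
              gcongr; exact lw_le_of_le_en hγ ha hc hξ
          _ = ENNReal.ofReal ((1 / c + 1) ^ γ) ^ 2 *
              (ENNReal.ofReal (en ξ ^ γ) * f ξ + ENNReal.ofReal (en ξ ^ γ) * g ξ) ^ 2 := by ring
          _ ≤ _ := by gcongr; exact sq_add_le _ _
    _ = ENNReal.ofReal ((1 / c + 1) ^ γ) ^ 2 *
        (2 * (∫⁻ ξ in {ξ | c * a ≤ en ξ}, (ENNReal.ofReal (en ξ ^ γ) * f ξ) ^ 2)
          + 2 * ∫⁻ ξ in {ξ | c * a ≤ en ξ}, (ENNReal.ofReal (en ξ ^ γ) * g ξ) ^ 2) := by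
        rw [lintegral_const_mul _ (by fun_prop), lintegral_add_left (by fun_prop),
          lintegral_const_mul _ (by fun_prop), lintegral_const_mul _ (by fun_prop)]
    _ ≤ ENNReal.ofReal ((1 / c + 1) ^ γ) ^ 2 * (2 * E + 2 * E) := by gcongr
    _ = _ := by ring

/-- Duhamel estimate for the low-high and high-high interactions. -/
lemma exists_sqNorm_duhamel_split_le {γ r c N : ℝ} (hr : 0 ≤ r) (hr1 : r < 1) (hγ : 0 ≤ γ)
    (hrγ : 3 / 2 < r + γ) (hc : 0 < c) (hc1 : c ≤ 1 / 4) (hN : 0 ≤ N) :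
    ∃ K : ℝ, 0 < K ∧ ∀ a s t B ε : ℝ, 1 ≤ a → 0 ≤ s → s ≤ t → 0 ≤ B →
      a ^ (2 * r - 2) * Real.exp (2 * c * (a ^ 2 * t)) ≤ ε →
      a ^ (1 - 2 * γ) * Real.exp (1 / 2 * (a ^ 2 * t)) * B ≤ ε →
      ∀ L H : ℝ → V3 → ℝ≥0∞, Measurable (Function.uncurry L) → Measurable (Function.uncurry H) →
      (∀ τ ξ, c * a < en ξ → L τ ξ = 0) →
      (∀ τ ∈ Ioo 0 s, sqNorm 1 γ (L τ) ≤ ENNReal.ofReal (Real.exp (2 * c * (a ^ 2 * τ)) * N)) →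
      (∀ τ ∈ Ioo 0 s, sqNorm a γ (H τ) ≤ ENNReal.ofReal (Real.exp (1 / 2 * (a ^ 2 * τ)) * B)) →
      sqNorm a γ (fun ξ => ∫⁻ τ in Ioo 0 s,
          ENNReal.ofReal (en ξ * Real.exp (-((s - τ) * (en ξ ^ 2 - a * en ξ)))) *
            (2 * cv (L τ) (H τ) ξ + cv (H τ) (H τ) ξ))
        ≤ ENNReal.ofReal (Real.exp (1 / 2 * (a ^ 2 * s)) * (K * ε * B)) := by
  obtain ⟨C, hC, hheat⟩ := exists_sqNorm_duhamel_le hr hr1 hc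
  obtain ⟨K, hK, hsplit⟩ := exists_sqNorm_split_le hr hr1 hγ hrγ hc (by linarith)
  refine ⟨C ^ 2 * K * (N + 1), by positivity, ?_⟩
  intro a s t B ε ha hs hst hB hε1 hε2 L H hLm hHm hsupp hL hH
  have ha0 : 0 < a := by linarith
  have hm : Measurable (Function.uncurry fun τ ξ => 2 * cv (L τ) (H τ) ξ + cv (H τ) (H τ) ξ) :=
    ((measurable_uncurry_cv hLm hHm).const_mul 2).add (measurable_uncurry_cv hHm hHm)
  set Z : ℝ := K * (N * B + a ^ (3 - 2 * (r + γ)) * Real.exp ((1 / 2 - 2 * c) * (a ^ 2 * t)) * B ^ 2)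
    with hZ
  have hsize : ∀ τ ∈ Ioo 0 s, sqNorm a (γ - r) (fun ξ => 2 * cv (L τ) (H τ) ξ + cv (H τ) (H τ) ξ)
      ≤ ENNReal.ofReal (Real.exp ((1 / 4 + c) * (a ^ 2 * τ))) ^ 2 * ENNReal.ofReal Z := by
    intro τ hτ
    have hτ0 : 0 ≤ a ^ 2 * τ := mul_nonneg (sq_nonneg a) hτ.1.le
    have hτt : a ^ 2 * τ ≤ a ^ 2 * t := by
      have := hτ.2
      gcongr
      linarith
    refine (hsplit a ha (L τ) (H τ) (hLm.of_uncurry_left) (hHm.of_uncurry_left)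
      (hsupp τ)).trans ?_
    calc _ ≤ ENNReal.ofReal K * (ENNReal.ofReal (Real.exp (2 * c * (a ^ 2 * τ)) * N) *
            ENNReal.ofReal (Real.exp (1 / 2 * (a ^ 2 * τ)) * B)
          + ENNReal.ofReal (a ^ (3 - 2 * (r + γ))) *
            ENNReal.ofReal (Real.exp (1 / 2 * (a ^ 2 * τ)) * B) ^ 2) := by
          gcongr
          · exact hL τ hτ
          · exact hH τ hτ
          · exact hH τ hτ
      _ = ENNReal.ofReal (K * (Real.exp (2 * c * (a ^ 2 * τ)) * N *
            (Real.exp (1 / 2 * (a ^ 2 * τ)) * B)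
          + a ^ (3 - 2 * (r + γ)) * (Real.exp (1 / 2 * (a ^ 2 * τ)) * B) ^ 2)) := by
          rw [← ENNReal.ofReal_mul (by positivity), ← ENNReal.ofReal_pow (by positivity),
            ← ENNReal.ofReal_mul (by positivity), ← ENNReal.ofReal_add (by positivity)
            (by positivity), ← ENNReal.ofReal_mul (by positivity)]
      _ ≤ ENNReal.ofReal (Real.exp ((1 / 4 + c) * (a ^ 2 * τ)) ^ 2 * Z) := by
          refine ENNReal.ofReal_le_ofReal ?_
          have e1 : Real.exp (2 * c * (a ^ 2 * τ)) * Real.exp (1 / 2 * (a ^ 2 * τ))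
              = Real.exp ((1 / 4 + c) * (a ^ 2 * τ)) ^ 2 := by
            rw [← Real.exp_add, sq (Real.exp _), ← Real.exp_add]; congr 1; ring
          have e2 : Real.exp (1 / 2 * (a ^ 2 * τ)) ^ 2
              = Real.exp ((1 / 4 + c) * (a ^ 2 * τ)) ^ 2 *
                Real.exp ((1 / 2 - 2 * c) * (a ^ 2 * τ)) := by
            rw [sq (Real.exp _), sq (Real.exp _), ← Real.exp_add, ← Real.exp_add, ← Real.exp_add]; congr 1; ring
          have e3 : Real.exp ((1 / 2 - 2 * c) * (a ^ 2 * τ))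
              ≤ Real.exp ((1 / 2 - 2 * c) * (a ^ 2 * t)) :=
            Real.exp_le_exp.2 (mul_le_mul_of_nonneg_left hτt (by linarith))
          calc _ = K * ((Real.exp (2 * c * (a ^ 2 * τ)) * Real.exp (1 / 2 * (a ^ 2 * τ))) * (N * B)
                + a ^ (3 - 2 * (r + γ)) * Real.exp (1 / 2 * (a ^ 2 * τ)) ^ 2 * B ^ 2) := by ring
            _ = Real.exp ((1 / 4 + c) * (a ^ 2 * τ)) ^ 2 * (K * (N * B + a ^ (3 - 2 * (r + γ)) *
                  Real.exp ((1 / 2 - 2 * c) * (a ^ 2 * τ)) * B ^ 2)) := by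
                rw [e1, e2]; ring
            _ ≤ _ := by rw [hZ]; gcongr
      _ = _ := by rw [ENNReal.ofReal_mul (by positivity), ENNReal.ofReal_pow (by positivity)]
  refine (hheat γ a a s ha0 le_rfl _ hm _ hsize).trans ?_
  rw [← ENNReal.ofReal_pow (by positivity), ← ENNReal.ofReal_mul (by positivity)]
  refine ENNReal.ofReal_le_ofReal ?_
  have hst' : a ^ 2 * s ≤ a ^ 2 * t := by gcongr
  have p1 : (a ^ (r - 1)) ^ 2 = a ^ (2 * r - 2) := by
    rw [← Real.rpow_natCast, ← Real.rpow_mul ha0.le]; congr 1; push_cast; ring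
  have p2 : a ^ (2 * r - 2) * a ^ (3 - 2 * (r + γ)) = a ^ (1 - 2 * γ) := by
    rw [← Real.rpow_add ha0]; congr 1; ring
  have e1 : Real.exp ((1 / 4 + c) * (a ^ 2 * s)) ^ 2
      = Real.exp (1 / 2 * (a ^ 2 * s)) * Real.exp (2 * c * (a ^ 2 * s)) := by
    rw [← Real.exp_add, sq (Real.exp _), ← Real.exp_add]; congr 1; ring
  have e2 : Real.exp (2 * c * (a ^ 2 * s)) ≤ Real.exp (2 * c * (a ^ 2 * t)) := by gcongr
  have e3 : Real.exp (2 * c * (a ^ 2 * t)) * Real.exp ((1 / 2 - 2 * c) * (a ^ 2 * t))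
      = Real.exp (1 / 2 * (a ^ 2 * t)) := by
    rw [← Real.exp_add]; congr 1; ring
  calc (C * a ^ (r - 1) * Real.exp ((1 / 4 + c) * (a ^ 2 * s))) ^ 2 * Z
      = C ^ 2 * (a ^ (r - 1)) ^ 2 * Real.exp ((1 / 4 + c) * (a ^ 2 * s)) ^ 2 * Z := by ring
    _ = Real.exp (1 / 2 * (a ^ 2 * s)) * (C ^ 2 * a ^ (2 * r - 2) *
          Real.exp (2 * c * (a ^ 2 * s)) * Z) := by rw [p1, e1]; ring
    _ ≤ Real.exp (1 / 2 * (a ^ 2 * s)) * (C ^ 2 * a ^ (2 * r - 2) *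
          Real.exp (2 * c * (a ^ 2 * t)) * Z) := by gcongr
    _ = Real.exp (1 / 2 * (a ^ 2 * s)) * (C ^ 2 * K *
          (N * (a ^ (2 * r - 2) * Real.exp (2 * c * (a ^ 2 * t))) +
          (a ^ (2 * r - 2) * a ^ (3 - 2 * (r + γ))) * (Real.exp (2 * c * (a ^ 2 * t)) *
            Real.exp ((1 / 2 - 2 * c) * (a ^ 2 * t))) * B) * B) := by rw [hZ]; ring
    _ ≤ Real.exp (1 / 2 * (a ^ 2 * s)) * (C ^ 2 * K * (N * ε + ε) * B) := by
        rw [p2, e3]; gcongr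
    _ = _ := by ring

lemma IsMildSol.apply_zero {α : Coeffs} {U₀ : V3 → Fin 3 → ℂ} {U : ℝ → V3 → Fin 3 → ℂ} {T : ℝ}
    (h : IsMildSol α U₀ U T) (hT : 0 ≤ T) : U 0 = U₀ := by
  ext ξ j
  simpa using h 0 ⟨le_rfl, hT⟩ ξ j

lemma tw_le_heat {a R s τ : ℝ} (ha : 0 ≤ a) (hτ : τ ≤ s) (ξ : V3) :
    tw a R s ξ * ENNReal.ofReal (Real.exp (-((s - τ) * en ξ ^ 2)))
      ≤ ENNReal.ofReal (Real.exp (-((s - τ) * (en ξ ^ 2 - a * en ξ)))) * tw a R τ ξ := by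
  rw [tw, tw, ← ofReal_exp_add, ← ofReal_exp_add]
  refine ofReal_exp_mono ?_
  have := mul_le_mul_of_nonneg_left (min_le_left (en ξ) R) (mul_nonneg ha (sub_nonneg.2 hτ))
  nlinarith

lemma tw_le_of_en_le {a R s ρ : ℝ} (ha : 0 ≤ a) (hs : 0 ≤ s) {ξ : V3} (hξ : en ξ ≤ ρ) :
    tw a R s ξ ≤ ENNReal.ofReal (Real.exp (a * s * ρ)) := by
  rw [tw]
  refine ofReal_exp_mono ?_
  gcongr
  exact (min_le_left _ _).trans hξ

/-- High frequencies of the weighted solution, split into linear and nonlinear parts. -/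
lemma exists_tw_mul_enorm_le (α : Coeffs) : ∃ A : ℝ, 0 < A ∧
    ∀ (U₀ : V3 → Fin 3 → ℂ) (U : ℝ → V3 → Fin 3 → ℂ) (T : ℝ), IsMildSol α U₀ U T → MeasVF U →
    ∀ a R c s : ℝ, 0 < a → 0 ≤ R → 0 < c → c ≤ 1 / 8 → s ∈ Icc 0 T → ∀ ξ, c * a ≤ en ξ →
      tw a R s ξ * ‖U s ξ‖ₑ ≤
        ENNReal.ofReal (Real.exp (1 / 4 * (a ^ 2 * s))) * (‖U s ξ‖ₑ + ‖U 0 ξ‖ₑ)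
        + ENNReal.ofReal A * ∫⁻ τ in Ioo 0 s,
          ENNReal.ofReal (en ξ * Real.exp (-((s - τ) * (en ξ ^ 2 - a * en ξ)))) *
          (2 * cv ({ξ | c * a ≤ en ξ}ᶜ.indicator fun ξ => tw a R τ ξ * ‖U τ ξ‖ₑ)
              ({ξ | c * a ≤ en ξ}.indicator fun ξ => tw a R τ ξ * ‖U τ ξ‖ₑ) ξ
            + cv ({ξ | c * a ≤ en ξ}.indicator fun ξ => tw a R τ ξ * ‖U τ ξ‖ₑ)
              ({ξ | c * a ≤ en ξ}.indicator fun ξ => tw a R τ ξ * ‖U τ ξ‖ₑ) ξ) := by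
  obtain ⟨A, hA, hQ, -⟩ := exists_enorm_Qhat_le α
  refine ⟨A, hA, ?_⟩
  intro U₀ U T hU hUm a R c s ha hR hc hc8 hs ξ hξ
  have hx := en_nonneg ξ
  rcases le_or_gt (en ξ) (2 * (c * a)) with h2 | h2
  · refine le_add_right ?_
    gcongr
    · refine (tw_le_of_en_le ha.le hs.1 h2).trans (ofReal_exp_mono ?_)
      have : 0 ≤ a ^ 2 * s := mul_nonneg (sq_nonneg a) hs.1
      nlinarith
    · exact le_self_add
  · have h0 := hU.apply_zero (hs.1.trans hs.2)
    have hd := enorm_duh_le α U₀ U hs.1 ξ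
    rw [← (isMildSol_iff.1 hU) s hs ξ] at hd
    calc _ ≤ tw a R s ξ * (ENNReal.ofReal (Real.exp (-(s * en ξ ^ 2))) * ‖U₀ ξ‖ₑ
          + ∫⁻ τ in Ioo 0 s, ENNReal.ofReal (Real.exp (-((s - τ) * en ξ ^ 2)))
            * ‖Qhat α (U τ) (U τ) ξ‖ₑ) := by gcongr
      _ ≤ _ := by
        rw [mul_add]
        refine add_le_add ?_ ?_
        · rw [← mul_assoc, h0]
          gcongr
          · rw [tw, ← ofReal_exp_add]
            refine ofReal_exp_mono ?_
            have h3 := mul_le_mul_of_nonneg_left (min_le_left (en ξ) R) (mul_nonneg ha.le hs.1)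
            have h4 := mul_nonneg hs.1 (sq_nonneg (a / 2 - en ξ))
            nlinarith
          · exact le_add_self
        · rw [← lintegral_const_mul' _ _ (show tw a R s ξ ≠ ⊤ from ENNReal.ofReal_ne_top),
            ← lintegral_const_mul' _ _ ENNReal.ofReal_ne_top]
          refine setLIntegral_mono' measurableSet_Ioo fun τ hτ => ?_
          have hm : Measurable fun ξ => tw a R τ ξ * ‖U τ ξ‖ₑ :=
            (measurable_tw a R τ).mul (hUm.measurable_apply τ).enorm
          have hspl := (tw_mul_cv_le ha.le hR hτ.1.le (fun ξ => ‖U τ ξ‖ₑ) (fun ξ => ‖U τ ξ‖ₑ)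
            ξ).trans (cv_self_le_split hm h2.le)
          calc _ ≤ (tw a R s ξ * ENNReal.ofReal (Real.exp (-((s - τ) * en ξ ^ 2)))) *
                (ENNReal.ofReal (A * en ξ) * cv (fun ξ => ‖U τ ξ‖ₑ) (fun ξ => ‖U τ ξ‖ₑ) ξ) := by
                rw [mul_assoc]; gcongr; exact hQ _ _ _
            _ ≤ (ENNReal.ofReal (Real.exp (-((s - τ) * (en ξ ^ 2 - a * en ξ)))) * tw a R τ ξ) *
                (ENNReal.ofReal (A * en ξ) * cv (fun ξ => ‖U τ ξ‖ₑ) (fun ξ => ‖U τ ξ‖ₑ) ξ) := by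
                exact mul_le_mul' (tw_le_heat ha.le hτ.2.le ξ) le_rfl
            _ = ENNReal.ofReal A * (ENNReal.ofReal
                  (en ξ * Real.exp (-((s - τ) * (en ξ ^ 2 - a * en ξ)))) *
                (tw a R τ ξ * cv (fun ξ => ‖U τ ξ‖ₑ) (fun ξ => ‖U τ ξ‖ₑ) ξ)) := by
                rw [ENNReal.ofReal_mul hA.le, ENNReal.ofReal_mul hx]; ring
            _ ≤ _ := by gcongr

lemma measurable_uncurry_indicator {F : ℝ → V3 → ℝ≥0∞} (hF : Measurable (Function.uncurry F))
    {S : Set V3} (hS : MeasurableSet S) : Measurable (Function.uncurry fun τ => S.indicator (F τ)) := by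
  have h1 : (Function.uncurry fun τ => S.indicator (F τ))
      = (Prod.snd ⁻¹' S).indicator (Function.uncurry F) := by
    ext ⟨τ, ξ⟩
    by_cases h : ξ ∈ S <;> simp [h]
  rw [h1]
  exact hF.indicator (measurable_snd hS)

/-- The low-frequency part of the weighted solution. -/
lemma sqNorm_low_le {γ N a R c τ : ℝ} (ha : 0 ≤ a) (hτ : 0 ≤ τ) {f M : V3 → ℝ≥0∞}
    (hMm : Measurable M) (hMN : sqNorm 1 γ M ≤ ENNReal.ofReal N) (hf : ∀ ξ, f ξ ≤ M ξ) :
    sqNorm 1 γ ({ξ | c * a ≤ en ξ}ᶜ.indicator fun ξ => tw a R τ ξ * f ξ)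
      ≤ ENNReal.ofReal (Real.exp (2 * c * (a ^ 2 * τ)) * N) := by
  calc _ ≤ sqNorm 1 γ (fun ξ => ENNReal.ofReal (Real.exp (c * (a ^ 2 * τ))) * M ξ) := by
        refine sqNorm_mono fun ξ => ?_
        by_cases h : ξ ∈ {ξ : V3 | c * a ≤ en ξ}ᶜ
        · rw [indicator_of_mem h]
          refine mul_le_mul' ((tw_le_of_en_le ha hτ (not_le.1 (show ¬c * a ≤ en ξ from h)).le).trans
            (ofReal_exp_mono ?_)) (hf ξ)
          exact le_of_eq (by ring)
        · rw [indicator_of_notMem h]; exact bot_le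
    _ ≤ ENNReal.ofReal (Real.exp (c * (a ^ 2 * τ))) ^ 2 * ENNReal.ofReal N := by
        rw [sqNorm_const_mul _ hMm]; gcongr
    _ = _ := by
        rw [ofReal_exp_sq, ← ENNReal.ofReal_mul (Real.exp_nonneg _), mul_assoc 2 c]

/-- One step of the continuity argument for the truncated Gevrey norm. -/
lemma exists_gevrey_step (α : Coeffs) {γ r c N : ℝ} (hr : 0 ≤ r) (hr1 : r < 1) (hγ : 0 ≤ γ)
    (hrγ : 3 / 2 < r + γ) (hc : 0 < c) (hc8 : c ≤ 1 / 8) (hN : 0 ≤ N) :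
    ∃ C₀ : ℝ, 0 < C₀ ∧ ∃ ε : ℝ, 0 < ε ∧ ∀ (U₀ : V3 → Fin 3 → ℂ) (U : ℝ → V3 → Fin 3 → ℂ) (T : ℝ)
      (M : V3 → ℝ≥0∞), IsMildSol α U₀ U T → MeasVF U → Measurable M →
      sqNorm 1 γ M ≤ ENNReal.ofReal N → (∀ s ∈ Icc 0 T, ∀ ξ, ‖U s ξ‖ₑ ≤ M ξ) →
      ∀ a t E : ℝ, 1 ≤ a → t ∈ Icc 0 T → 0 ≤ E →
      (∀ s ∈ Icc 0 t, ∫⁻ ξ in {ξ | c * a ≤ en ξ}, (ENNReal.ofReal (en ξ ^ γ) * ‖U s ξ‖ₑ) ^ 2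
        ≤ ENNReal.ofReal E) →
      a ^ (2 * r - 2) * Real.exp (2 * c * (a ^ 2 * t)) ≤ ε →
      a ^ (1 - 2 * γ) * Real.exp (1 / 2 * (a ^ 2 * t)) * E ≤ ε →
      ∀ R s : ℝ, 0 ≤ R → s ∈ Icc 0 t →
      (∀ τ ∈ Ioo 0 s, sqNorm a γ ({ξ | c * a ≤ en ξ}.indicator fun ξ => tw a R τ ξ * ‖U τ ξ‖ₑ)
        ≤ ENNReal.ofReal (Real.exp (1 / 2 * (a ^ 2 * τ)) * (C₀ * E))) →
      sqNorm a γ ({ξ | c * a ≤ en ξ}.indicator fun ξ => tw a R s ξ * ‖U s ξ‖ₑ)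
        ≤ ENNReal.ofReal (Real.exp (1 / 2 * (a ^ 2 * s)) * (C₀ * E / 2)) := by
  obtain ⟨A, hA, hAle⟩ := exists_tw_mul_enorm_le α
  obtain ⟨K, hK, hKle⟩ := exists_sqNorm_duhamel_split_le hr hr1 hγ hrγ hc (by linarith) hN
  set C₀ : ℝ := 32 * ((1 / c + 1) ^ γ) ^ 2 with hC₀
  have hC₀pos : 0 < C₀ := by positivity
  refine ⟨C₀, hC₀pos, min (1 / (8 * A ^ 2 * K)) (1 / (8 * A ^ 2 * K) / C₀), by positivity, ?_⟩
  intro U₀ U T M hU hUm hMm hMN hUM a t E ha ht hE hhigh hε1 hε2 R s hR hs hG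
  have ha0 : 0 < a := by linarith
  have hS := measurableSet_le_en (c * a)
  have hsT : s ∈ Icc 0 T := ⟨hs.1, hs.2.trans ht.2⟩
  have hUe : Measurable (Function.uncurry fun s ξ => ‖U s ξ‖ₑ) := hUm.measurable.enorm
  have hVm : Measurable (Function.uncurry fun τ ξ => tw a R τ ξ * ‖U τ ξ‖ₑ) :=
    (measurable_uncurry_tw a R).mul hUe
  have hUs : ∀ s, Measurable fun ξ => ‖U s ξ‖ₑ := fun s => (hUm.measurable_apply s).enorm
  have hpt := hAle U₀ U T hU hUm a R c s ha0 hR hc hc8 hsT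
  have hLm := measurable_uncurry_indicator hVm hS.compl
  have hHm := measurable_uncurry_indicator hVm hS
  have hnl := hKle a s t (C₀ * E) (1 / (8 * A ^ 2 * K)) ha hs.1 hs.2 (by positivity)
    (hε1.trans (min_le_left _ _))
    (by
      have := mul_le_mul_of_nonneg_left (hε2.trans (min_le_right _ _)) hC₀pos.le
      rw [mul_div_cancel₀ _ hC₀pos.ne'] at this
      linarith) _ _ hLm hHm (fun τ ξ h => indicator_of_notMem (not_not.2 (show c * a ≤ en ξ from h.le)) _)
    (fun τ hτ => sqNorm_low_le ha0.le hτ.1.le hMm hMN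
      (hUM τ ⟨hτ.1.le, hτ.2.le.trans hsT.2⟩)) hG
  have hm : Measurable (Function.uncurry fun τ ξ =>
      2 * cv ({ξ | c * a ≤ en ξ}ᶜ.indicator fun ξ => tw a R τ ξ * ‖U τ ξ‖ₑ)
        ({ξ | c * a ≤ en ξ}.indicator fun ξ => tw a R τ ξ * ‖U τ ξ‖ₑ) ξ
      + cv ({ξ | c * a ≤ en ξ}.indicator fun ξ => tw a R τ ξ * ‖U τ ξ‖ₑ)
        ({ξ | c * a ≤ en ξ}.indicator fun ξ => tw a R τ ξ * ‖U τ ξ‖ₑ) ξ) :=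
    ((measurable_uncurry_cv hLm hHm).const_mul 2).add (measurable_uncurry_cv hHm hHm)
  set D : V3 → ℝ≥0∞ := fun ξ => ∫⁻ τ in Ioo 0 s,
    ENNReal.ofReal (en ξ * Real.exp (-((s - τ) * (en ξ ^ 2 - a * en ξ)))) *
    (2 * cv ({ξ | c * a ≤ en ξ}ᶜ.indicator fun ξ => tw a R τ ξ * ‖U τ ξ‖ₑ)
        ({ξ | c * a ≤ en ξ}.indicator fun ξ => tw a R τ ξ * ‖U τ ξ‖ₑ) ξ
      + cv ({ξ | c * a ≤ en ξ}.indicator fun ξ => tw a R τ ξ * ‖U τ ξ‖ₑ)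
        ({ξ | c * a ≤ en ξ}.indicator fun ξ => tw a R τ ξ * ‖U τ ξ‖ₑ) ξ) with hD
  have hDm : Measurable D := measurable_duhamel hm a s
  replace hpt : ∀ ξ, c * a ≤ en ξ → tw a R s ξ * ‖U s ξ‖ₑ ≤
      ENNReal.ofReal (Real.exp (1 / 4 * (a ^ 2 * s))) * (‖U s ξ‖ₑ + ‖U 0 ξ‖ₑ)
        + ENNReal.ofReal A * D ξ := hpt
  clear_value D
  have hlin := sqNorm_indicator_add_le hγ ha0 hc (hUs s) (hUs 0) (hhigh s hs)
    (hhigh 0 ⟨le_rfl, hs.1.trans hs.2⟩)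
  have hPm : Measurable ({ξ : V3 | c * a ≤ en ξ}.indicator fun ξ => ‖U s ξ‖ₑ + ‖U 0 ξ‖ₑ) :=
    ((hUs s).add (hUs 0)).indicator hS
  calc _ ≤ sqNorm a γ (fun ξ => ENNReal.ofReal (Real.exp (1 / 4 * (a ^ 2 * s))) *
          ({ξ : V3 | c * a ≤ en ξ}.indicator fun ξ => ‖U s ξ‖ₑ + ‖U 0 ξ‖ₑ) ξ
          + ENNReal.ofReal A * D ξ) := by
        refine sqNorm_mono fun ξ => ?_
        by_cases h : ξ ∈ {ξ : V3 | c * a ≤ en ξ}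
        · rw [indicator_of_mem h, indicator_of_mem h]; exact hpt ξ h
        · rw [indicator_of_notMem h]; exact bot_le
    _ ≤ 2 * (ENNReal.ofReal (Real.exp (1 / 2 * (a ^ 2 * s))) *
          (ENNReal.ofReal ((1 / c + 1) ^ γ) ^ 2 * (4 * ENNReal.ofReal E)))
        + 2 * (ENNReal.ofReal A ^ 2 * ENNReal.ofReal (Real.exp (1 / 2 * (a ^ 2 * s)) *
          (K * (1 / (8 * A ^ 2 * K)) * (C₀ * E)))) := by
        refine (sqNorm_add_le (hPm.const_mul _)).trans ?_
        rw [sqNorm_const_mul _ hPm, sqNorm_const_mul _ hDm, ofReal_exp_sq,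
          show 2 * (1 / 4 * (a ^ 2 * s)) = 1 / 2 * (a ^ 2 * s) by ring]
        gcongr
    _ = _ := by
        rw [← ENNReal.ofReal_pow (by positivity), ← ENNReal.ofReal_pow hA.le,
          show (4 : ℝ≥0∞) = ENNReal.ofReal 4 by simp, show (2 : ℝ≥0∞) = ENNReal.ofReal 2 by simp,
          ← ENNReal.ofReal_mul (by norm_num), ← ENNReal.ofReal_mul (by positivity),
          ← ENNReal.ofReal_mul (by positivity), ← ENNReal.ofReal_mul (by positivity),
          ← ENNReal.ofReal_mul (by positivity), ← ENNReal.ofReal_mul (by positivity),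
          ← ENNReal.ofReal_add (by positivity) (by positivity)]
        congr 1
        rw [hC₀]
        field_simp
        ring

lemma continuousOn_sqNorm_tw {γ a R T : ℝ} (hγ : 0 ≤ γ) (ha : 1 ≤ a) {U : ℝ → V3 → Fin 3 → ℂ}
    (hUm : MeasVF U) {M : V3 → ℝ≥0∞} (hMm : Measurable M) (hMf : sqNorm 1 γ M < ⊤)
    (hUM : ∀ s ∈ Icc 0 T, ∀ ξ, ‖U s ξ‖ₑ ≤ M ξ) (hUc : ∀ ξ, ContinuousOn (fun t => U t ξ) (Icc 0 T))
    (hR : 0 ≤ R) {S : Set V3} (hS : MeasurableSet S) :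
    ContinuousOn (fun s => sqNorm a γ (S.indicator fun ξ => tw a R s ξ * ‖U s ξ‖ₑ)) (Icc 0 T) := by
  have ha0 : 0 < a := by linarith
  refine continuousOn_lintegral_of_dominated
    (B := fun ξ => (ENNReal.ofReal (a ^ γ) * ENNReal.ofReal (Real.exp (a * T * R))) ^ 2 *
      (lw 1 γ ξ * M ξ) ^ 2) (fun s => ?_) ?_ (fun s hs ξ => ?_) (Eventually.of_forall fun ξ => ?_)
  · have := ((measurable_tw a R s).mul (hUm.measurable_apply s).enorm).indicator hS
    fun_prop
  · rw [lintegral_const_mul _ (by fun_prop)]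
    exact ENNReal.mul_lt_top (ENNReal.pow_lt_top (ENNReal.mul_lt_top ENNReal.ofReal_lt_top
      ENNReal.ofReal_lt_top)) hMf
  · rw [← mul_pow]
    refine pow_le_pow_left' ?_ 2
    calc _ ≤ (ENNReal.ofReal (a ^ γ) * lw 1 γ ξ) *
          (ENNReal.ofReal (Real.exp (a * T * R)) * M ξ) := by
          have hx := en_nonneg ξ
          refine mul_le_mul' (lw_le_mul ha0.le zero_le_one ha0.le hγ (by nlinarith)) ?_
          refine (indicator_le_self S _ ξ).trans (mul_le_mul' ?_ (hUM s hs ξ))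
          refine ofReal_exp_mono ?_
          have := hs.1
          exact mul_le_mul (mul_le_mul_of_nonneg_left hs.2 ha0.le) (min_le_right _ _)
            (le_min hx hR) (mul_nonneg ha0.le (hs.1.trans hs.2))
      _ = _ := by ring
  · by_cases h : ξ ∈ S
    · have h1 : ∀ s, (lw a γ ξ * S.indicator (fun ξ => tw a R s ξ * ‖U s ξ‖ₑ) ξ) ^ 2
          = ENNReal.ofReal (((a + en ξ) ^ γ *
              (Real.exp (a * s * min (en ξ) R) * ‖U s ξ‖)) ^ 2) := fun s => by
        have := en_nonneg ξ
        rw [indicator_of_mem h, lw, tw, ← ofReal_norm, ← ENNReal.ofReal_mul (Real.exp_nonneg _),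
          ← ENNReal.ofReal_mul (by positivity), ENNReal.ofReal_pow (by positivity)]
      simp_rw [h1]
      refine ENNReal.continuous_ofReal.comp_continuousOn ((ContinuousOn.mul continuousOn_const
        (ContinuousOn.mul (by fun_prop) (hUc ξ).norm)).pow 2)
    · simp [h, continuousOn_const]

/-- Gevrey regularity for high frequencies, with truncated weight. -/
lemma exists_gevrey_truncated (α : Coeffs) {γ r c N : ℝ} (hr : 0 ≤ r) (hr1 : r < 1) (hγ : 0 ≤ γ)
    (hrγ : 3 / 2 < r + γ) (hc : 0 < c) (hc8 : c ≤ 1 / 8) (hN : 0 ≤ N) :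
    ∃ C₀ : ℝ, 0 < C₀ ∧ ∃ ε : ℝ, 0 < ε ∧ ∀ (U₀ : V3 → Fin 3 → ℂ) (U : ℝ → V3 → Fin 3 → ℂ) (T : ℝ)
      (M : V3 → ℝ≥0∞), IsMildSol α U₀ U T → MeasVF U → Measurable M →
      sqNorm 1 γ M ≤ ENNReal.ofReal N → (∀ s ∈ Icc 0 T, ∀ ξ, ‖U s ξ‖ₑ ≤ M ξ) →
      (∀ ξ, ContinuousOn (fun t => U t ξ) (Icc 0 T)) →
      ∀ a t E : ℝ, 1 ≤ a → t ∈ Icc 0 T → 0 < E →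
      (∀ s ∈ Icc 0 t, ∫⁻ ξ in {ξ | c * a ≤ en ξ}, (ENNReal.ofReal (en ξ ^ γ) * ‖U s ξ‖ₑ) ^ 2
        ≤ ENNReal.ofReal E) →
      a ^ (2 * r - 2) * Real.exp (2 * c * (a ^ 2 * t)) ≤ ε →
      a ^ (1 - 2 * γ) * Real.exp (1 / 2 * (a ^ 2 * t)) * E ≤ ε →
      ∀ R s : ℝ, 0 ≤ R → s ∈ Icc 0 t →
      sqNorm a γ ({ξ | c * a ≤ en ξ}.indicator fun ξ => tw a R s ξ * ‖U s ξ‖ₑ)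
        ≤ ENNReal.ofReal (Real.exp (1 / 2 * (a ^ 2 * s)) * (C₀ * E)) := by
  obtain ⟨C₀, hC₀, ε, hε, hstep⟩ := exists_gevrey_step α hr hr1 hγ hrγ hc hc8 hN
  refine ⟨C₀, hC₀, ε, hε, ?_⟩
  intro U₀ U T M hU hUm hMm hMN hUM hUc a t E ha ht hE hhigh hε1 hε2 R s hR hs
  have hstep' := hstep U₀ U T M hU hUm hMm hMN hUM a t E ha ht hE.le hhigh hε1 hε2 R
  have hcont := (continuousOn_sqNorm_tw hγ ha hUm hMm (hMN.trans_lt ENNReal.ofReal_lt_top) hUM hUc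
    hR (measurableSet_le_en (c * a))).mono (Icc_subset_Icc_right ht.2)
  set G : ℝ → ℝ≥0∞ := fun s =>
    sqNorm a γ ({ξ | c * a ≤ en ξ}.indicator fun ξ => tw a R s ξ * ‖U s ξ‖ₑ)
  have hcont2 : ContinuousOn (fun s => ENNReal.ofReal (Real.exp (1 / 2 * (a ^ 2 * s)) * (C₀ * E)))
      (Icc 0 t) := (ENNReal.continuous_ofReal.comp (by fun_prop)).continuousOn
  by_contra hbad
  have hcl := isClosed_Icc.isClosed_le hcont2 hcont
  have hcpt : IsCompact {s ∈ Icc 0 t |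
      ENNReal.ofReal (Real.exp (1 / 2 * (a ^ 2 * s)) * (C₀ * E)) ≤ G s} :=
    isCompact_Icc.of_isClosed_subset hcl fun s hs => hs.1
  obtain ⟨s₀, ⟨hs₀, hle⟩, hleast⟩ := hcpt.exists_isLeast ⟨s, hs, (not_le.1 hbad).le⟩
  have h1 := hstep' s₀ hR hs₀ fun τ hτ => by
    by_contra h
    exact absurd (hleast ⟨⟨hτ.1.le, hτ.2.le.trans hs₀.2⟩, (not_le.1 h).le⟩) (not_le.2 hτ.2)
  have h2 := hle.trans h1
  rw [ENNReal.ofReal_le_ofReal_iff (by positivity)] at h2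
  have h3 : 0 < Real.exp (1 / 2 * (a ^ 2 * s₀)) * (C₀ * E) := by positivity
  linarith

/-- Gevrey regularity for high frequencies. -/
lemma exists_gevrey (α : Coeffs) {γ r c N : ℝ} (hr : 0 ≤ r) (hr1 : r < 1) (hγ : 0 ≤ γ)
    (hrγ : 3 / 2 < r + γ) (hc : 0 < c) (hc8 : c ≤ 1 / 8) (hN : 0 ≤ N) :
    ∃ C₀ : ℝ, 0 < C₀ ∧ ∃ ε : ℝ, 0 < ε ∧ ∀ (U₀ : V3 → Fin 3 → ℂ) (U : ℝ → V3 → Fin 3 → ℂ) (T : ℝ)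
      (M : V3 → ℝ≥0∞), IsMildSol α U₀ U T → MeasVF U → Measurable M →
      sqNorm 1 γ M ≤ ENNReal.ofReal N → (∀ s ∈ Icc 0 T, ∀ ξ, ‖U s ξ‖ₑ ≤ M ξ) →
      (∀ ξ, ContinuousOn (fun t => U t ξ) (Icc 0 T)) →
      ∀ a t E : ℝ, 1 ≤ a → t ∈ Icc 0 T → 0 < E →
      (∀ s ∈ Icc 0 t, ∫⁻ ξ in {ξ | c * a ≤ en ξ}, (ENNReal.ofReal (en ξ ^ γ) * ‖U s ξ‖ₑ) ^ 2
        ≤ ENNReal.ofReal E) →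
      a ^ (2 * r - 2) * Real.exp (2 * c * (a ^ 2 * t)) ≤ ε →
      a ^ (1 - 2 * γ) * Real.exp (1 / 2 * (a ^ 2 * t)) * E ≤ ε →
      ∫⁻ ξ in {ξ | c * a ≤ en ξ},
          (lw a γ ξ * (ENNReal.ofReal (Real.exp (a * t * en ξ)) * ‖U t ξ‖ₑ)) ^ 2
        ≤ ENNReal.ofReal (Real.exp (1 / 2 * (a ^ 2 * t)) * (C₀ * E)) := by
  obtain ⟨C₀, hC₀, ε, hε, htr⟩ := exists_gevrey_truncated α hr hr1 hγ hrγ hc hc8 hN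
  refine ⟨C₀, hC₀, ε, hε, ?_⟩
  intro U₀ U T M hU hUm hMm hMN hUM hUc a t E ha ht hE hhigh hε1 hε2
  have ha0 : 0 ≤ a := by linarith
  have h1 : ∀ n : ℕ, ∫⁻ ξ in {ξ | c * a ≤ en ξ}, (lw a γ ξ * (tw a n t ξ * ‖U t ξ‖ₑ)) ^ 2
      ≤ ENNReal.ofReal (Real.exp (1 / 2 * (a ^ 2 * t)) * (C₀ * E)) := fun n => by
    rw [← sqNorm_indicator (measurableSet_le_en _)]
    exact htr U₀ U T M hU hUm hMm hMN hUM hUc a t E ha ht hE hhigh hε1 hε2 n t n.cast_nonneg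
      ⟨ht.1, le_rfl⟩
  have hUt : Measurable fun ξ => ‖U t ξ‖ₑ := (hUm.measurable_apply t).enorm
  calc _ ≤ ∫⁻ ξ in {ξ | c * a ≤ en ξ}, ⨆ n : ℕ, (lw a γ ξ * (tw a n t ξ * ‖U t ξ‖ₑ)) ^ 2 := by
        refine lintegral_mono fun ξ => ?_
        obtain ⟨n, hn⟩ := exists_nat_ge (en ξ)
        refine le_iSup_of_le n ?_
        rw [tw, min_eq_left hn]
    _ = ⨆ n : ℕ, ∫⁻ ξ in {ξ | c * a ≤ en ξ}, (lw a γ ξ * (tw a n t ξ * ‖U t ξ‖ₑ)) ^ 2 := by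
        refine lintegral_iSup (fun n => by fun_prop) fun m n hmn ξ => ?_
        dsimp only
        gcongr
        refine ofReal_exp_mono ?_
        have : 0 ≤ t := ht.1
        have : (m : ℝ) ≤ n := by exact_mod_cast hmn
        gcongr
    _ ≤ _ := iSup_le h1

/-- Choice of the Gevrey radius: all smallness conditions hold for small times. -/
lemma exists_param_bounds {γ r c ε : ℝ} (hγ : 1 / 2 < γ) (hr1 : r < 1) (hc : 0 < c)
    (hcr : 22 * (γ - 1 / 2) * c ≤ 1 - r) (hε : 0 < ε) :
    ∃ b L₀ : ℝ, 0 ≤ b ∧ 1 ≤ L₀ ∧ ∀ L β s : ℝ, L₀ ≤ L → b ≤ β → β ≤ 1 / 2 * (γ - 1 / 2) * L →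
      s = Real.exp (-L / 2) → ∀ a : ℝ, 0 ≤ a →
      (a * s) ^ 2 = (2 * γ - 1) * (L + Real.log L) + 3 * β →
      1 ≤ a ∧ 0.01 * s⁻¹ ≤ c * a ∧
      a ^ (2 * r - 2) * Real.exp (2 * c * (a * s) ^ 2) ≤ ε ∧
      a ^ (1 - 2 * γ) * Real.exp (1 / 2 * (a * s) ^ 2) * Real.exp (-(2 * β)) ≤ ε := by
  obtain ⟨κ, hκ⟩ : ∃ κ, κ = γ - 1 / 2 := ⟨_, rfl⟩
  obtain rfl : γ = κ + 1 / 2 := by linarith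
  have hκ0 : 0 < κ := by linarith
  set b : ℝ := max 0 (-2 * Real.log (ε * (2 * κ) ^ κ)) with hb
  set L₀ : ℝ := max 1 (max (1 / (2 * κ)) (max ((0.01 / c) ^ 2 / (2 * κ))
    (-2 * Real.log ε / (1 - r)))) with hL₀
  refine ⟨b, L₀, le_max_left _ _, le_max_left _ _, ?_⟩
  intro L β s hL hbβ hβ hs a ha hlam
  have hL1 : 1 ≤ L := (le_max_left _ _).trans hL
  have hL2 : 1 / (2 * κ) ≤ L := ((le_max_left _ _).trans (le_max_right _ _)).trans hL
  have hL3 : (0.01 / c) ^ 2 / (2 * κ) ≤ L :=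
    (((le_max_left _ _).trans (le_max_right _ _)).trans (le_max_right _ _)).trans hL
  have hL4 : -2 * Real.log ε / (1 - r) ≤ L :=
    (((le_max_right _ _).trans (le_max_right _ _)).trans (le_max_right _ _)).trans hL
  have hL0 : 0 < L := by linarith
  have hlog0 : 0 ≤ Real.log L := Real.log_nonneg hL1
  have hlog1 : Real.log L ≤ L := (Real.log_le_sub_one_of_pos hL0).trans (by linarith)
  have hβ0 : 0 ≤ β := (le_max_left _ _).trans hbβ
  have hs0 : 0 < s := hs ▸ Real.exp_pos _
  have hs1 : s ≤ 1 := by rw [hs, Real.exp_le_one_iff]; linarith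
  have hlow : 2 * κ * L ≤ (a * s) ^ 2 := by rw [hlam]; nlinarith
  have hup : (a * s) ^ 2 ≤ 11 / 2 * κ * L := by rw [hlam]; nlinarith
  have has0 : 0 ≤ a * s := by positivity
  have has1 : 1 ≤ a * s := by
    rw [div_le_iff₀ (by positivity)] at hL2
    nlinarith
  have ha1 : 1 ≤ a := by nlinarith
  have ha0 : 0 < a := by linarith
  have ha2 : a ^ 2 = (a * s) ^ 2 * Real.exp L := by
    have : s ^ 2 * Real.exp L = 1 := by
      rw [hs, sq, ← Real.exp_add, ← Real.exp_add, Real.exp_eq_one_iff]; ring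
    rw [mul_pow, mul_assoc, this, mul_one]
  refine ⟨ha1, ?_, ?_, ?_⟩
  · rw [← div_eq_mul_inv, div_le_iff₀ hs0, mul_assoc, ← div_le_iff₀' hc]
    rw [div_le_iff₀ (by positivity)] at hL3
    have : (0.01 / c) ^ 2 ≤ (a * s) ^ 2 := by linarith
    exact le_of_sq_le_sq this has0
  · have h1 : a ^ (2 * r - 2) ≤ Real.exp (-(1 - r) * L) := by
      rw [show 2 * r - 2 = (2 : ℕ) * (-(1 - r)) by push_cast; ring, Real.rpow_mul ha0.le,
        Real.rpow_natCast, mul_comm (-(1 - r)), Real.exp_mul]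
      refine Real.rpow_le_rpow_of_nonpos (Real.exp_pos _) ?_ (by linarith)
      rw [ha2]
      exact le_mul_of_one_le_left (Real.exp_nonneg _) (one_le_pow₀ has1)
    calc _ ≤ Real.exp (-(1 - r) * L) * Real.exp ((1 - r) / 2 * L) := by
          refine mul_le_mul h1 (Real.exp_le_exp.2 ?_) (Real.exp_nonneg _) (Real.exp_nonneg _)
          have h2 := mul_le_mul_of_nonneg_left hup (by positivity : 0 ≤ 2 * c)
          have h3 := mul_le_mul_of_nonneg_right hcr hL0.le
          nlinarith
      _ = Real.exp (-((1 - r) / 2 * L)) := by rw [← Real.exp_add]; congr 1; ring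
      _ ≤ ε := by
          rw [← Real.le_log_iff_exp_le hε]
          rw [div_le_iff₀ (by linarith)] at hL4
          linarith
  · have h1 : a ^ (1 - 2 * (κ + 1 / 2)) ≤ (2 * κ) ^ (-κ) * L ^ (-κ) * Real.exp (-(κ * L)) := by
      rw [show 1 - 2 * (κ + 1 / 2) = (2 : ℕ) * (-κ) by push_cast; ring, Real.rpow_mul ha0.le,
        Real.rpow_natCast, ha2, Real.mul_rpow (by positivity) (Real.exp_nonneg _),
        ← Real.mul_rpow (by positivity) hL0.le, ← Real.exp_mul,
        show L * -κ = -(κ * L) by ring]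
      gcongr ?_ * _
      exact Real.rpow_le_rpow_of_nonpos (by positivity) hlow (by linarith)
    have h2 : Real.exp (1 / 2 * (a * s) ^ 2)
        = Real.exp (κ * L) * L ^ κ * Real.exp (3 / 2 * β) := by
      rw [hlam, Real.rpow_def_of_pos hL0, ← Real.exp_add, ← Real.exp_add]; congr 1; ring
    have h3 : L ^ (-κ) * L ^ κ = 1 := by
      rw [← Real.rpow_add hL0]; simp
    have h4 : Real.exp (-(κ * L)) * Real.exp (κ * L) = 1 := by
      rw [← Real.exp_add]; simp
    have h5 : Real.exp (3 / 2 * β) * Real.exp (-(2 * β)) = Real.exp (-(β / 2)) := by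
      rw [← Real.exp_add]; congr 1; ring
    have h6 : Real.exp (-(β / 2)) ≤ ε * (2 * κ) ^ κ := by
      rw [← Real.le_log_iff_exp_le (by positivity)]
      have := (le_max_right _ _).trans hbβ
      linarith
    rw [h2]
    calc _ ≤ (2 * κ) ^ (-κ) * L ^ (-κ) * Real.exp (-(κ * L)) *
          (Real.exp (κ * L) * L ^ κ * Real.exp (3 / 2 * β)) * Real.exp (-(2 * β)) := by gcongr
      _ = (2 * κ) ^ (-κ) * (L ^ (-κ) * L ^ κ) * (Real.exp (-(κ * L)) * Real.exp (κ * L)) *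
          (Real.exp (3 / 2 * β) * Real.exp (-(2 * β))) := by ring
      _ ≤ (2 * κ) ^ (-κ) * (ε * (2 * κ) ^ κ) := by
          rw [h3, h4, h5, mul_one, mul_one]; gcongr
      _ = ε * ((2 * κ) ^ (-κ) * (2 * κ) ^ κ) := by ring
      _ = ε := by rw [← Real.rpow_add (by positivity)]; simp

lemma betaF_bounds {γ b t : ℝ} {U : ℝ → V3 → Fin 3 → ℂ} (hb : 0 ≤ b)
    (hη : etaSup γ U (t ^ (-(1 : ℝ) / 2)) t ≤ ENNReal.ofReal (Real.exp (-b)))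
    (ht : b ≤ 1 / 2 * (γ - 1 / 2) * |Real.log t|) :
    b ≤ betaF γ U t ∧ betaF γ U t ≤ 1 / 2 * (γ - 1 / 2) * |Real.log t| ∧
      etaSup γ U (t ^ (-(1 : ℝ) / 2)) t ≤ ENNReal.ofReal (Real.exp (-betaF γ U t)) := by
  unfold betaF
  set η := etaSup γ U (t ^ (-(1 : ℝ) / 2)) t
  have hfin : η ≠ ⊤ := (hη.trans_lt ENNReal.ofReal_lt_top).ne
  split_ifs with h0
  · exact ⟨ht, le_rfl, by simp [h0]⟩
  · have hx0 : 0 < η.toReal := ENNReal.toReal_pos h0 hfin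
    have hx : Real.log η.toReal ≤ -b := by
      rw [Real.log_le_iff_le_exp hx0]
      exact ENNReal.toReal_le_of_le_ofReal (Real.exp_nonneg _) hη
    have habs : |Real.log η.toReal| = -Real.log η.toReal := abs_of_nonpos (by linarith)
    rw [habs]
    refine ⟨le_min (by linarith) ht, min_le_right _ _, ?_⟩
    rw [← ENNReal.ofReal_toReal hfin]
    refine ENNReal.ofReal_le_ofReal ?_
    rw [ENNReal.toReal_ofReal hx0.le, ← Real.log_le_iff_le_exp hx0]
    have := min_le_left (-Real.log η.toReal) (1 / 2 * (γ - 1 / 2) * |Real.log t|)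
    linarith

lemma tendsto_tail {F : V3 → ℝ≥0∞} (hF : Measurable F) (hFf : ∫⁻ ξ, F ξ < ⊤) :
    Tendsto (fun ρ : ℝ => ∫⁻ ξ in {ξ | ρ ≤ en ξ}, F ξ) atTop (𝓝 0) := by
  have h1 : Tendsto (fun ρ : ℝ => ∫⁻ ξ, {ξ | ρ ≤ en ξ}.indicator F ξ) atTop
      (𝓝 (∫⁻ _ : V3, (0 : ℝ≥0∞))) := by
    refine tendsto_lintegral_filter_of_dominated_convergence F
      (Eventually.of_forall fun ρ => hF.indicator (measurableSet_le_en ρ))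
      (Eventually.of_forall fun ρ => Eventually.of_forall fun ξ => indicator_le_self _ _ ξ) hFf.ne
      (Eventually.of_forall fun ξ => ?_)
    refine tendsto_const_nhds.congr' ?_
    filter_upwards [eventually_gt_atTop (en ξ)] with ρ hρ
    exact (indicator_of_notMem (show ξ ∉ {ξ | ρ ≤ en ξ} from not_le.2 hρ) _).symm
  simpa [lintegral_indicator (measurableSet_le_en _)] using h1

lemma ofReal_en_rpow_le_lw {γ : ℝ} (hγ : 0 ≤ γ) (ξ : V3) : ENNReal.ofReal (en ξ ^ γ) ≤ lw 1 γ ξ :=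
  ENNReal.ofReal_le_ofReal (Real.rpow_le_rpow (en_nonneg ξ) (by linarith) hγ)

lemma enorm_high_weight (γ ρ : ℝ) (f : V3 → ℝ≥0∞) (ξ : V3) :
    (‖(if ρ ≤ en ξ then en ξ ^ γ else 0 : ℝ)‖ₑ * f ξ) ^ 2
      = {ξ | ρ ≤ en ξ}.indicator (fun ξ => (ENNReal.ofReal (en ξ ^ γ) * f ξ) ^ 2) ξ := by
  by_cases h : ρ ≤ en ξ
  · rw [if_pos h, indicator_of_mem (by exact h),
      Real.enorm_of_nonneg (Real.rpow_nonneg (en_nonneg ξ) γ)]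
  · rw [if_neg h, indicator_of_notMem (by exact h)]
    simp

lemma etaSup_le {γ J t x : ℝ} (hγ : 0 ≤ γ) {U : ℝ → V3 → Fin 3 → ℂ} {M : V3 → ℝ≥0∞}
    (hUM : ∀ s ∈ Icc 0 t, ∀ ξ, ‖U s ξ‖ₑ ≤ M ξ)
    (hx : 3 * ∫⁻ ξ in {ξ | 0.01 * J ≤ en ξ}, (lw 1 γ ξ * M ξ) ^ 2 ≤ ENNReal.ofReal x ^ 2) :
    etaSup γ U J t ≤ ENNReal.ofReal x := by
  refine iSup₂_le fun s hs => (ENNReal.pow_le_pow_left_iff two_ne_zero).1 ?_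
  refine ((wnorm_sq_le _ _).trans ?_).trans hx
  rw [lintegral_congr fun ξ => enorm_high_weight γ (0.01 * J) (fun ξ => ‖U s ξ‖ₑ) ξ,
    lintegral_indicator (measurableSet_le_en _)]
  gcongr with ξ
  · exact ofReal_en_rpow_le_lw hγ ξ
  · exact hUM s hs ξ

lemma setLIntegral_le_etaSup_sq {γ J ρ t : ℝ} {U : ℝ → V3 → Fin 3 → ℂ} (hρ : 0.01 * J ≤ ρ) {s : ℝ}
    (hs : s ∈ Icc 0 t) :
    ∫⁻ ξ in {ξ | ρ ≤ en ξ}, (ENNReal.ofReal (en ξ ^ γ) * ‖U s ξ‖ₑ) ^ 2 ≤ etaSup γ U J t ^ 2 := by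
  calc _ ≤ ∫⁻ ξ in {ξ | 0.01 * J ≤ en ξ}, (ENNReal.ofReal (en ξ ^ γ) * ‖U s ξ‖ₑ) ^ 2 :=
        lintegral_mono_set fun ξ hξ => hρ.trans hξ
    _ = ∫⁻ ξ, (‖(if 0.01 * J ≤ en ξ then en ξ ^ γ else 0 : ℝ)‖ₑ * ‖U s ξ‖ₑ) ^ 2 := by
        rw [← lintegral_indicator (measurableSet_le_en _)]
        exact lintegral_congr fun ξ => (enorm_high_weight γ _ _ ξ).symm
    _ ≤ wnorm (fun ξ => if 0.01 * J ≤ en ξ then en ξ ^ γ else 0) (U s) ^ 2 :=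
        lintegral_sq_le_wnorm_sq _ _
    _ ≤ _ := by
        gcongr
        exact le_iSup₂ (f := fun τ (_ : τ ∈ Icc 0 t) =>
          wnorm (fun ξ => if 0.01 * J ≤ en ξ then en ξ ^ γ else 0) (U τ)) s hs

/-- Combination of the low- and high-frequency Gevrey bounds. -/
lemma wnorm_gevrey_le {γ σ c a t N H : ℝ} (hσ : 0 ≤ σ) (hσγ : σ ≤ γ) (hc8 : c ≤ 1 / 8)
    (ha : 1 ≤ a) (ht : 0 ≤ t) (hN : 0 ≤ N) (hH : 0 ≤ H) {f : V3 → Fin 3 → ℂ}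
    {M : V3 → ℝ≥0∞} (hfM : ∀ ξ, ‖f ξ‖ₑ ≤ M ξ) (hMN : sqNorm 1 γ M ≤ ENNReal.ofReal N)
    (hhigh : ∫⁻ ξ in {ξ | c * a ≤ en ξ},
        (lw a γ ξ * (ENNReal.ofReal (Real.exp (a * t * en ξ)) * ‖f ξ‖ₑ)) ^ 2
        ≤ ENNReal.ofReal (Real.exp (1 / 2 * (a ^ 2 * t)) * H)) :
    wnorm (fun ξ => Real.exp (a * t * en ξ) * en ξ ^ σ) f
      ≤ ENNReal.ofReal ((3 * (H + N) + 1) * Real.exp (1 / 4 * (a ^ 2 * t))) := by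
  have ha0 : 0 < a := by linarith
  have hS := measurableSet_le_en (c * a)
  have hw : ∀ b : ℝ, 1 ≤ b → ∀ ξ, ‖(Real.exp (a * t * en ξ) * en ξ ^ σ : ℝ)‖ₑ
      ≤ lw b γ ξ * ENNReal.ofReal (Real.exp (a * t * en ξ)) := fun b hb ξ => by
    have hx := en_nonneg ξ
    rw [Real.enorm_of_nonneg (by positivity), mul_comm, lw, ← ENNReal.ofReal_mul (by positivity)]
    refine ENNReal.ofReal_le_ofReal ?_
    gcongr
    exact (Real.rpow_le_rpow hx (by linarith) hσ).trans
      (Real.rpow_le_rpow_of_exponent_le (by linarith : 1 ≤ b + en ξ) hσγ)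
  refine (ENNReal.pow_le_pow_left_iff two_ne_zero).1 ((wnorm_sq_le _ _).trans ?_)
  rw [← lintegral_add_compl _ hS]
  have h1 : ∫⁻ ξ in {ξ | c * a ≤ en ξ}, (‖(Real.exp (a * t * en ξ) * en ξ ^ σ : ℝ)‖ₑ * ‖f ξ‖ₑ) ^ 2
      ≤ ENNReal.ofReal (Real.exp (1 / 2 * (a ^ 2 * t)) * H) := by
    refine (lintegral_mono fun ξ => ?_).trans hhigh
    rw [← mul_assoc]
    gcongr
    exact hw a ha ξ
  have h2 : ∫⁻ ξ in {ξ | c * a ≤ en ξ}ᶜ,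
      (‖(Real.exp (a * t * en ξ) * en ξ ^ σ : ℝ)‖ₑ * ‖f ξ‖ₑ) ^ 2
      ≤ ENNReal.ofReal (Real.exp (1 / 2 * (a ^ 2 * t)) * N) := by
    calc _ ≤ ∫⁻ ξ in {ξ | c * a ≤ en ξ}ᶜ, ENNReal.ofReal (Real.exp (1 / 4 * (a ^ 2 * t))) ^ 2 *
          (lw 1 γ ξ * M ξ) ^ 2 := by
          refine setLIntegral_mono' hS.compl fun ξ hξ => ?_
          have hξ' : en ξ < c * a := not_le.1 hξ
          rw [← mul_pow]
          refine pow_le_pow_left' ?_ 2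
          calc _ ≤ (lw 1 γ ξ * ENNReal.ofReal (Real.exp (a * t * en ξ))) * M ξ :=
                mul_le_mul' (hw 1 le_rfl ξ) (hfM ξ)
            _ ≤ (lw 1 γ ξ * ENNReal.ofReal (Real.exp (1 / 4 * (a ^ 2 * t)))) * M ξ := by
                refine mul_le_mul' (mul_le_mul' le_rfl (ofReal_exp_mono ?_)) le_rfl
                have h3 := mul_le_mul_of_nonneg_left hξ'.le (mul_nonneg ha0.le ht)
                have h4 : 0 ≤ a ^ 2 * t := by positivity
                nlinarith
            _ = _ := by ring
      _ ≤ ENNReal.ofReal (Real.exp (1 / 4 * (a ^ 2 * t))) ^ 2 * sqNorm 1 γ M := by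
          rw [lintegral_const_mul' _ _ (by simp)]
          gcongr
          exact setLIntegral_le_lintegral _ _
      _ ≤ ENNReal.ofReal (Real.exp (1 / 4 * (a ^ 2 * t))) ^ 2 * ENNReal.ofReal N := by gcongr
      _ = _ := by
          rw [ofReal_exp_sq, ← ENNReal.ofReal_mul (Real.exp_nonneg _)]
          congr 3; ring
  calc _ ≤ 3 * (ENNReal.ofReal (Real.exp (1 / 2 * (a ^ 2 * t)) * H)
        + ENNReal.ofReal (Real.exp (1 / 2 * (a ^ 2 * t)) * N)) := by gcongr
    _ = ENNReal.ofReal (3 * (H + N) * Real.exp (1 / 2 * (a ^ 2 * t))) := by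
        rw [← ENNReal.ofReal_add (by positivity) (by positivity),
          show (3 : ℝ≥0∞) = ENNReal.ofReal 3 by simp, ← ENNReal.ofReal_mul (by norm_num)]
        congr 1; ring
    _ ≤ _ := by
        rw [← ENNReal.ofReal_pow (by positivity)]
        refine ENNReal.ofReal_le_ofReal ?_
        have h3 : Real.exp (1 / 4 * (a ^ 2 * t)) ^ 2 = Real.exp (1 / 2 * (a ^ 2 * t)) := by
          rw [sq, ← Real.exp_add]; congr 1; ring
        rw [mul_pow, h3]
        gcongr
        nlinarith

/-- Admissible exponents for the bilinear estimate and the width of the low-frequency region. -/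
lemma exists_exponents {γ : ℝ} (hγ : 1 / 2 < γ) :
    ∃ r c : ℝ, 0 ≤ r ∧ r < 1 ∧ 3 / 2 < r + γ ∧ 0 < c ∧ c ≤ 1 / 8 ∧
      22 * (γ - 1 / 2) * c ≤ 1 - r := by
  obtain ⟨r, hr, hr1, hrγ⟩ : ∃ r : ℝ, 0 ≤ r ∧ r < 1 ∧ 3 / 2 < r + γ := by
    refine ⟨max 0 ((5 / 2 - γ) / 2), le_max_left _ _, max_lt one_pos (by linarith), ?_⟩
    rcases le_or_gt γ (3 / 2) with h | h
    · linarith [le_max_right 0 ((5 / 2 - γ) / 2)]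
    · linarith [le_max_left 0 ((5 / 2 - γ) / 2)]
  have hκ : 0 < 22 * (γ - 1 / 2) := by linarith
  have h1r : 0 < 1 - r := by linarith
  refine ⟨r, min (1 / 8) ((1 - r) / (22 * (γ - 1 / 2))), hr, hr1, hrγ,
    lt_min (by norm_num) (by positivity), min_le_left _ _, ?_⟩
  rw [← le_div_iff₀' hκ]
  exact min_le_right _ _

/-- The growth factor `e^{λ²/4}` in terms of powers of `t` and `|ln t|`. -/
lemma exp_quarter_le {γ δ t β : ℝ} (hδ : 0 ≤ δ) (ht : 0 < t) (hlog : 1 ≤ -Real.log t) :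
    Real.exp (1 / 4 * ((2 * γ - 1) * (-Real.log t + Real.log (-Real.log t)) + 3 * β))
      ≤ t ^ (-(γ + δ - 1 / 2) / 2) * (-Real.log t) ^ ((γ - 1 / 2) / 2)
        * Real.exp (3 / 4 * β) := by
  rw [Real.rpow_def_of_pos ht, Real.rpow_def_of_pos (by linarith), ← Real.exp_add, ← Real.exp_add,
    Real.exp_le_exp]
  nlinarith [mul_nonneg hδ (by linarith : 0 ≤ -Real.log t)]

/-- The Gevrey estimate with radius `λ(t)√t` for a mild solution with an `H^γ` majorant. -/
lemma IsMildSol.exists_wnorm_gevrey_le {α : Coeffs} {γ T : ℝ} (hγ : 1 / 2 < γ) (hT : 0 < T)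
    {U₀ : V3 → Fin 3 → ℂ} {U : ℝ → V3 → Fin 3 → ℂ} (h : IsMildSol α U₀ U T) (hU : MeasVF U)
    {M : V3 → ℝ≥0∞} (hMm : Measurable M) (hMf : sqNorm 1 γ M < ⊤)
    (hUM : ∀ s ∈ Icc 0 T, ∀ ξ, ‖U s ξ‖ₑ ≤ M ξ)
    (hcont : ∀ ξ, ContinuousOn (fun t => U t ξ) (Icc 0 T)) :
    ∃ t₀ ∈ Ioc (0 : ℝ) T, ∃ C > (0 : ℝ), ∀ δ : ℝ, 0 ≤ δ → 1 / 2 + δ ≤ γ → ∀ t ∈ Ioc (0 : ℝ) t₀,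
      wnorm (fun ξ => Real.exp (lamSub γ U t * Real.sqrt t * en ξ) * en ξ ^ (1 / 2 + δ)) (U t)
        ≤ ENNReal.ofReal (C * t ^ (-(γ + δ - 1 / 2) / 2) * |Real.log t| ^ ((γ - 1 / 2) / 2)
            * Real.exp (3 / 4 * betaF γ U t)) := by
  obtain ⟨r, c, hr, hr1, hrγ, hc, hc8, hcr⟩ := exists_exponents hγ
  have hγ0 : 0 ≤ γ := by linarith
  set N : ℝ := (sqNorm 1 γ M).toReal with hN
  have hN0 : 0 ≤ N := ENNReal.toReal_nonneg
  have hMN : sqNorm 1 γ M ≤ ENNReal.ofReal N := (ENNReal.ofReal_toReal hMf.ne).ge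
  obtain ⟨C₀, hC₀, ε, hε, hgev⟩ := exists_gevrey α hr hr1 hγ0 hrγ hc hc8 hN0
  obtain ⟨b, L₀, hb, hL₀, hpar⟩ := exists_param_bounds hγ hr1 hc hcr hε
  obtain ⟨ρ₀, hρ₀⟩ : ∃ ρ₀ : ℝ, ∀ ρ ≥ ρ₀,
      3 * ∫⁻ ξ in {ξ | ρ ≤ en ξ}, (lw 1 γ ξ * M ξ) ^ 2 ≤ ENNReal.ofReal (Real.exp (-b)) ^ 2 := by
    have h1 := tendsto_tail (F := fun ξ => (lw 1 γ ξ * M ξ) ^ 2)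
      (((measurable_lw 1 γ).mul hMm).pow_const 2) hMf
    have h2 := ENNReal.Tendsto.const_mul h1 (Or.inr (by simp : (3 : ℝ≥0∞) ≠ ⊤))
    rw [mul_zero] at h2
    have h3 : 0 < ENNReal.ofReal (Real.exp (-b)) ^ 2 := by
      have := Real.exp_pos (-b)
      positivity
    obtain ⟨ρ₀, h4⟩ := eventually_atTop.1 (h2.eventually_lt_const h3)
    exact ⟨ρ₀, fun ρ hρ => (h4 ρ hρ).le⟩
  set L₁ : ℝ := max L₀ (max (2 * b / (γ - 1 / 2)) (200 * ρ₀)) with hL₁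
  refine ⟨min T (Real.exp (-L₁)), ⟨lt_min hT (Real.exp_pos _), min_le_left _ _⟩,
    3 * (C₀ + N) + 1, by positivity, fun δ hδ hδγ t ht => ?_⟩
  have ht0 : 0 < t := ht.1
  have htT : t ∈ Icc 0 T := ⟨ht0.le, ht.2.trans (min_le_left _ _)⟩
  have hlog : L₁ ≤ -Real.log t := by
    have := (Real.log_le_iff_le_exp ht0).2 (ht.2.trans (min_le_right _ _))
    linarith
  have hLa : L₀ ≤ -Real.log t := (le_max_left _ _).trans hlog
  have hLb : 2 * b / (γ - 1 / 2) ≤ -Real.log t :=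
    ((le_max_left _ _).trans (le_max_right _ _)).trans hlog
  have hLc : 200 * ρ₀ ≤ -Real.log t := ((le_max_right _ _).trans (le_max_right _ _)).trans hlog
  have hL1 : 1 ≤ -Real.log t := hL₀.trans hLa
  have habs : |Real.log t| = -Real.log t := abs_of_nonpos (by linarith)
  have hs0 : 0 < √t := Real.sqrt_pos.2 ht0
  have hs : √t = Real.exp (- -Real.log t / 2) := by
    rw [neg_neg, Real.sqrt_eq_rpow, Real.rpow_def_of_pos ht0]; congr 1; ring
  have hsinv : t ^ (-(1 : ℝ) / 2) = (√t)⁻¹ := by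
    rw [Real.sqrt_eq_rpow, ← Real.rpow_neg ht0.le]; congr 1; ring
  have hρ : ρ₀ ≤ 0.01 * t ^ (-(1 : ℝ) / 2) := by
    have h1 := Real.add_one_le_exp (-Real.log t / 2)
    rw [hsinv, hs, ← Real.exp_neg, show -(- -Real.log t / 2) = -Real.log t / 2 by ring]
    linarith
  have hη := etaSup_le hγ0 (fun s hs => hUM s ⟨hs.1, hs.2.trans htT.2⟩) (hρ₀ _ hρ)
  obtain ⟨hβ1, hβ2, hβ3⟩ := betaF_bounds hb hη (by
    rw [habs]
    rw [div_le_iff₀ (by linarith)] at hLb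
    linarith)
  rw [habs] at hβ2 ⊢
  set β := betaF γ U t with hβ
  have hlam0 : 0 ≤ (2 * γ - 1) * (-Real.log t + Real.log (-Real.log t)) + 3 * β := by
    have := Real.log_nonneg hL1
    have : 0 ≤ (2 * γ - 1) * (-Real.log t + Real.log (-Real.log t)) :=
      mul_nonneg (by linarith) (by linarith)
    linarith
  have hlam : lamSub γ U t ^ 2 = (2 * γ - 1) * (-Real.log t + Real.log (-Real.log t)) + 3 * β := by
    rw [lamSub, habs, Real.sq_sqrt hlam0]
  obtain ⟨a, hal⟩ : ∃ a, a = lamSub γ U t / √t := ⟨_, rfl⟩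
  have has : a * √t = lamSub γ U t := by rw [hal, div_mul_cancel₀ _ hs0.ne']
  have ha0 : 0 ≤ a := hal ▸ div_nonneg (Real.sqrt_nonneg _) hs0.le
  have hat : a * t = lamSub γ U t * √t := by rw [← has, mul_assoc, Real.mul_self_sqrt ht0.le]
  have ha2t : a ^ 2 * t = (a * √t) ^ 2 := by rw [mul_pow, Real.sq_sqrt ht0.le]
  obtain ⟨ha1, haρ, hε1, hε2⟩ := hpar (-Real.log t) β √t hLa hβ1 hβ2 hs a ha0 (by rw [has, hlam])
  rw [← ha2t] at hε1 hε2
  have hhigh := hgev U₀ U T M h hU hMm hMN hUM hcont a t (Real.exp (-(2 * β))) ha1 htT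
    (Real.exp_pos _) (fun s hs' => by
      refine (setLIntegral_le_etaSup_sq (J := t ^ (-(1 : ℝ) / 2)) (by rwa [hsinv]) hs').trans ?_
      refine (pow_le_pow_left' hβ3 2).trans_eq ?_
      rw [ofReal_exp_sq]
      congr 2; ring) hε1 hε2
  have hE : C₀ * Real.exp (-(2 * β)) ≤ C₀ :=
    mul_le_of_le_one_right hC₀.le (Real.exp_le_one_iff.2 (by linarith))
  have hfin := wnorm_gevrey_le (σ := 1 / 2 + δ) (by linarith) hδγ hc8 ha1 ht0.le hN0 hC₀.le
    (hUM t htT) hMN (hhigh.trans (ENNReal.ofReal_le_ofReal (by gcongr)))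
  rw [hat] at hfin
  refine hfin.trans (ENNReal.ofReal_le_ofReal ?_)
  rw [ha2t, has, hlam, mul_assoc, mul_assoc, ← mul_assoc (t ^ _)]
  exact mul_le_mul_of_nonneg_left (exp_quarter_le hδ ht0 hL1) (by positivity)

/-- subcritical local well-posedness and Gevrey estimate with radius
`λ(t)√t`, for `u₀ ∈ H^γ`, `γ > 1/2`, divergence-free. -/
theorem statement0 (α : Coeffs) (γ : ℝ) (hγ : 1 / 2 < γ)
    (U₀ : V3 → Fin 3 → ℂ) (hmeas : ∀ j, Measurable fun ξ => U₀ ξ j)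
    (hreal : RealField U₀) (hdiv : DivFree U₀) (hH : wnorm (wH γ) U₀ < ⊤) :
    ∃ T > (0 : ℝ), ∃ U : ℝ → V3 → Fin 3 → ℂ, MeasVF U ∧
      (IsMildSol α U₀ U T ∧ ContInW (wH γ) U T ∧ MemL2W (wD (γ + 1)) U T) ∧
      (∀ W : ℝ → V3 → Fin 3 → ℂ,
        (MeasVF W ∧ IsMildSol α U₀ W T ∧ ContInW (wH γ) W T ∧ MemL2W (wD (γ + 1)) W T) →
        ∀ t ∈ Icc (0 : ℝ) T, ∀ ξ : V3, ∀ j : Fin 3, W t ξ j = U t ξ j) ∧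
      ∃ t₀ ∈ Ioc (0 : ℝ) T, ∃ δ₀ > (0 : ℝ), ∀ δ : ℝ, 0 < δ → δ < δ₀ → 1 / 2 + 2 * δ < γ →
        ∃ C > (0 : ℝ), ∀ t ∈ Ioc (0 : ℝ) t₀,
          wnorm (fun ξ => Real.exp (lamSub γ U t * Real.sqrt t * en ξ) * en ξ ^ (1 / 2 + δ))
              (U t)
            ≤ ENNReal.ofReal (C * t ^ (-(γ + δ - 1 / 2) / 2) * |Real.log t| ^ ((γ - 1 / 2) / 2)
                * Real.exp (3 / 4 * betaF γ U t)) := by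
  have hγ0 : 0 ≤ γ := by linarith
  obtain ⟨r, -, hr, hr1, hrγ, -⟩ := exists_exponents hγ
  have hU₀ : sqNorm 1 γ (fun ξ => ‖U₀ ξ‖ₑ) < ⊤ :=
    (sqNorm_le_wnorm_wH hγ0 U₀).trans_lt
      (ENNReal.mul_lt_top ENNReal.ofReal_lt_top (ENNReal.pow_lt_top hH))
  obtain ⟨T, hT, -, U, hU, hmild, M, hMm, hMf, hgM⟩ :=
    exists_mildSol α hγ0 hr hr1 hrγ hmeas hU₀
  have hUM : ∀ t ∈ Icc 0 T, ∀ ξ, ‖U t ξ‖ₑ ≤ M ξ := fun t ht ξ =>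
    (hgM t ht ξ).trans (mul_le_of_le_one_left' (gw_le_one t ξ))
  have hcont := hmild.continuousOn hU (cv_lt_top_of_sqNorm hγ0 hMm hMm hMf hMf) hUM
  have hC := contInW_of_majorant hγ0 hU hMm hMf hUM hcont
  refine ⟨T, hT, U, hU, ⟨hmild, hC, memL2W_of_majorant hγ0 hMm hMf hgM⟩, ?_, ?_⟩
  · rintro W ⟨hW, hWmild, hWC, -⟩ t ht ξ j
    obtain ⟨N₁, hN₁, h₁⟩ := exists_sqNorm_le_of_contInW hγ0 hU hC
    obtain ⟨N₂, hN₂, h₂⟩ := exists_sqNorm_le_of_contInW hγ0 hW hWC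
    have := IsMildSol.unique hγ0 hr hr1 hrγ hWmild hmild hW hU (max_lt hN₁ hN₂)
      (fun s hs => (h₂ s hs).trans (le_max_right _ _))
      (fun s hs => (h₁ s hs).trans (le_max_left _ _)) t ht ξ
    rw [this]
  · obtain ⟨t₀, ht₀, C, hC0, hbound⟩ :=
      hmild.exists_wnorm_gevrey_le hγ hT hU hMm hMf hUM hcont
    exact ⟨t₀, ht₀, 1, one_pos, fun δ hδ _ hδγ =>
      ⟨C, hC0, hbound δ hδ.le (by linarith)⟩⟩
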